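/- There exist a constant c > 0 and a threshold N₀ such that for every even integer N ≥ N₀ and every real θ with 0.838 ≤ θ ≤ 1, the number of primes p with p ≤ N^θ, N − p ≥ 1 and Ω(N − p) ≤ 3 is at least c · C(N) · N^θ / (log N)². -/

import Mathlib

/-- `C(N) = (∏_{p ∣ N, p > 2} (p−1)/(p−2)) · (∏_{p > 2} (1 − 1/(p−1)²))`,
both products over primes. -/
noncomputable def CN (N : ℕ) : ℝ :=
  (∏ p ∈ N.primeFactors.filter (fun p => 2 < p), ((p : ℝ) - 1) / ((p : ℝ) - 2)) *
    ∏' p : {p : ℕ // p.Prime ∧ 2 < p}, (1 - 1 / (((p : ℕ) : ℝ) - 1) ^ 2)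

section
open Complex MeasureTheory Filter Topology Asymptotics

/-- error term -/
noncomputable def EE (f : ℕ → ℂ) (ρ : ℂ) (M : ℕ) (t : ℝ) : ℂ :=
  ∑ k ∈ Finset.Ioc M ⌊t⌋₊, f k - ρ * (t - M)

lemma EE_meas (f : ℕ → ℂ) (ρ : ℂ) (M : ℕ) : Measurable (EE f ρ M) := by
  unfold EE
  have : Measurable (fun t : ℝ => ∑ k ∈ Finset.Ioc M ⌊t⌋₊, f k) :=
    (measurable_from_nat (f := fun n => ∑ k ∈ Finset.Ioc M n, f k)).comp Nat.measurable_floor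
  fun_prop

lemma EE_int {f : ℕ → ℂ} {ρ : ℂ} {M : ℕ} {K : ℝ} (hM : 1 ≤ M)
    (hK : ∀ t : ℝ, M ≤ t → ‖EE f ρ M t‖ ≤ K) {s : ℂ} (hs : 0 < s.re) :
    IntegrableOn (fun t : ℝ => EE f ρ M t * (t : ℂ) ^ (-(s + 1))) (Set.Ioi (M : ℝ)) ∧
    ‖∫ t in Set.Ioi (M : ℝ), EE f ρ M t * (t : ℂ) ^ (-(s + 1))‖ ≤ K * (M : ℝ) ^ (-s.re) / s.re := by
  have hM0 : (0 : ℝ) < M := by exact_mod_cast hM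
  have hi : IntegrableOn (fun t : ℝ => K * t ^ (-(s.re + 1))) (Set.Ioi (M : ℝ)) :=
    (integrableOn_Ioi_rpow_of_lt (by linarith) hM0).const_mul K
  have hb : ∀ t ∈ Set.Ioi (M : ℝ), ‖EE f ρ M t * (t : ℂ) ^ (-(s + 1))‖ ≤ K * t ^ (-(s.re + 1)) := by
    intro t ht
    have ht0 : 0 < t := hM0.trans ht
    rw [norm_mul, norm_cpow_eq_rpow_re_of_pos ht0]
    simp only [neg_re, add_re, one_re]
    gcongr
    exact hK t (le_of_lt ht)
  have hae := (ae_restrict_iff' (μ := volume) measurableSet_Ioi).2 (Eventually.of_forall hb)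
  refine ⟨hi.mono' ?_ hae, ?_⟩
  · refine ((EE_meas f ρ M).mul ?_).aestronglyMeasurable
    fun_prop
  · refine (norm_integral_le_of_norm_le hi hae).trans (le_of_eq ?_)
    rw [integral_const_mul, integral_Ioi_rpow_of_lt (by linarith) hM0]
    have : -(s.re + 1) + 1 = -s.re := by ring
    rw [this]; field_simp

lemma LS_eq {f : ℕ → ℂ} {ρ : ℂ} {M : ℕ} {K B : ℝ} (hM : 1 ≤ M) (hB : ∀ n, ‖f n‖ ≤ B)
    (hK : ∀ t : ℝ, M ≤ t → ‖EE f ρ M t‖ ≤ K) {s : ℂ} (hs : 1 < s.re) :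
    LSeries f s = ∑ n ∈ Finset.Icc 1 M, f n * (n : ℂ) ^ (-s) + ρ * (M : ℂ) ^ (1 - s) / (s - 1) +
      s * ∫ t in Set.Ioi (M : ℝ), EE f ρ M t * (t : ℂ) ^ (-(s + 1)) := by
  have hM0 : (0 : ℝ) < M := by exact_mod_cast hM
  have hs0 : s ≠ 0 := by rintro rfl; simp at hs; linarith
  have hs1 : s - 1 ≠ 0 := by
    intro h; have := congrArg re h; simp at this; linarith
  set f1 : ℕ → ℂ := fun n => if n ≤ M then f n else 0
  set f2 : ℕ → ℂ := fun n => if n ≤ M then 0 else f n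
  have hB0 : 0 ≤ B := (norm_nonneg _).trans (hB 0)
  have hb1 : ∀ n, ‖f1 n‖ ≤ B := fun n => by simp only [f1]; split_ifs <;> simp [hB, hB0]
  have hb2 : ∀ n, ‖f2 n‖ ≤ B := fun n => by simp only [f2]; split_ifs <;> simp [hB, hB0]
  have hsum1 : LSeriesSummable f1 s := LSeriesSummable_of_bounded_of_one_lt_re (fun n _ => hb1 n) hs
  have hsum2 : LSeriesSummable f2 s := LSeriesSummable_of_bounded_of_one_lt_re (fun n _ => hb2 n) hs
  have hf : f = f1 + f2 := by
    ext n; simp only [f1, f2, Pi.add_apply]; split_ifs <;> simp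
  rw [hf, LSeries_add hsum1 hsum2, ← hf, add_assoc]
  congr 1
  · rw [LSeries, tsum_eq_sum (s := Finset.Icc 1 M)]
    · refine Finset.sum_congr rfl fun n hn => ?_
      rw [Finset.mem_Icc] at hn
      rw [LSeries.term_of_ne_zero (by omega)]
      simp [f1, hn.2, cpow_neg, div_eq_mul_inv]
    · intro n hn
      rcases Nat.eq_zero_or_pos n with rfl | h
      · simp
      · rw [LSeries.term_of_ne_zero (by omega)]
        have : ¬ n ≤ M := fun h' => hn (Finset.mem_Icc.2 ⟨h, h'⟩)
        simp [f1, this]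
  · have hO : (fun n ↦ ∑ k ∈ Finset.Icc 1 n, ‖f2 k‖) =O[atTop] fun n ↦ (n : ℝ) ^ (1 : ℝ) := by
      refine IsBigO.of_bound B (Eventually.of_forall fun n => ?_)
      rw [Real.norm_of_nonneg (Finset.sum_nonneg fun _ _ => norm_nonneg _)]
      refine (Finset.sum_le_card_nsmul _ _ B fun k _ => hb2 k).trans ?_
      simp [mul_comm]
    rw [LSeries_eq_mul_integral' f2 zero_le_one hs hO]
    have hsub : Set.Ioi (M : ℝ) ⊆ Set.Ioi (1 : ℝ) := by
      exact Set.Ioi_subset_Ioi (by exact_mod_cast hM)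
    rw [setIntegral_eq_of_subset_of_forall_sdiff_eq_zero measurableSet_Ioi hsub]
    · have e1 : ∀ t ∈ Set.Ioi (M : ℝ), (∑ k ∈ Finset.Icc 1 ⌊t⌋₊, f2 k) * (t : ℂ) ^ (-(s + 1)) =
          EE f ρ M t * (t : ℂ) ^ (-(s + 1)) + (ρ * (t : ℂ) ^ (-s) - ρ * M * (t : ℂ) ^ (-(s + 1))) := by
        intro t ht
        have ht0 : 0 < t := hM0.trans ht
        have hne : (t : ℂ) ≠ 0 := by exact_mod_cast ht0.ne'
        have hfl : M ≤ ⌊t⌋₊ := Nat.le_floor (le_of_lt ht)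
        have : ∑ k ∈ Finset.Icc 1 ⌊t⌋₊, f2 k = ∑ k ∈ Finset.Ioc M ⌊t⌋₊, f k := by
          refine (Finset.sum_subset_zero_on_sdiff ?_ ?_ ?_).symm
          · intro k hk; simp at hk ⊢; omega
          · intro k hk; simp at hk; simp only [f2]; rw [if_pos]; by_contra h
            have := hk.2 (by omega); omega
          · intro k hk; simp at hk; simp only [f2]; rw [if_neg (by omega)]
        rw [this, EE]
        have h2 : (t : ℂ) ^ (-s) = t * (t : ℂ) ^ (-(s + 1)) := by
          rw [show -s = 1 + -(s + 1) by ring, cpow_add _ _ hne, cpow_one]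
        rw [h2]; ring
      rw [setIntegral_congr_fun measurableSet_Ioi e1]
      have i1 := (EE_int hM hK (s := s) (by linarith)).1
      have i2 : IntegrableOn (fun t : ℝ => (t : ℂ) ^ (-s)) (Set.Ioi (M : ℝ)) :=
        integrableOn_Ioi_cpow_of_lt (by simp; linarith) hM0
      have i3 : IntegrableOn (fun t : ℝ => (t : ℂ) ^ (-(s+1))) (Set.Ioi (M : ℝ)) :=
        integrableOn_Ioi_cpow_of_lt (by simp; linarith) hM0
      have i4 : IntegrableOn (fun t : ℝ => ρ * (t : ℂ) ^ (-s) - ρ * M * (t : ℂ) ^ (-(s + 1)))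
        (Set.Ioi (M : ℝ)) := (i2.const_mul ρ).sub (i3.const_mul _)
      rw [integral_add i1 i4,
        integral_sub (i2.const_mul ρ) (i3.const_mul _), integral_const_mul, integral_const_mul,
        integral_Ioi_cpow_of_lt (by simp; linarith) hM0,
        integral_Ioi_cpow_of_lt (by simp; linarith) hM0]
      have h3 : ((M : ℝ) : ℂ) ^ (-s + 1) = (M : ℂ) ^ (1 - s) := by push_cast; congr 1; ring
      have hMc : (M : ℂ) ≠ 0 := by exact_mod_cast hM0.ne'
      have h4 : (M : ℂ) * ((M : ℝ) : ℂ) ^ (-(s + 1) + 1) = (M : ℂ) ^ (1 - s) := by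
        rw [ofReal_natCast, show 1 - s = 1 + (-(s + 1) + 1) by ring, cpow_add 1 _ hMc, cpow_one]
      have h5 : -s + 1 ≠ 0 := by intro h; apply hs1; linear_combination -h
      have h6 : -(s + 1) + 1 ≠ 0 := by intro h; apply hs0; linear_combination -h
      have : ρ * M * (-((M : ℝ) : ℂ) ^ (-(s + 1) + 1) / (-(s + 1) + 1)) =
        ρ * (-(M : ℂ) ^ (1 - s) / (-(s + 1) + 1)) := by rw [← h4]; ring
      rw [this, h3, mul_add, add_comm]
      congr 1
      field_simp
      ring
    · intro t ht
      have h1 : ¬ (M : ℝ) < t := fun h => ht.2 h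
      rw [Finset.sum_eq_zero, zero_mul]
      intro k hk
      simp only [f2]; rw [if_pos]
      have h2 := (Finset.mem_Icc.1 hk).2
      have h3 : (k : ℝ) ≤ t := (Nat.cast_le.2 h2).trans (Nat.floor_le (by linarith [ht.1, Set.mem_Ioi.1 ht.1]))
      exact_mod_cast h3.trans (not_lt.1 h1)

lemma EE_diff {f : ℕ → ℂ} {ρ : ℂ} {M : ℕ} {K : ℝ} (hM : 1 ≤ M)
    (hK : ∀ t : ℝ, M ≤ t → ‖EE f ρ M t‖ ≤ K) {s : ℂ} (hs : 0 < s.re) :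
    DifferentiableAt ℂ (fun s : ℂ => ∫ t in Set.Ioi (M : ℝ), EE f ρ M t * (t : ℂ) ^ (-(s + 1))) s := by
  have hM0 : (0 : ℝ) < M := by exact_mod_cast hM
  set g : ℝ → ℂ := (Set.Ioi (M : ℝ)).indicator (EE f ρ M)
  have hK0 : 0 ≤ K := (norm_nonneg _).trans (hK M le_rfl)
  have hgb : ∀ t, ‖g t‖ ≤ K := by
    intro t; simp only [g]; rw [Set.indicator]; split_ifs with h
    · exact hK t (le_of_lt h)
    · simpa
  have hgm : Measurable g := (EE_meas f ρ M).indicator measurableSet_Ioi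
  have e : (fun s : ℂ => ∫ t in Set.Ioi (M : ℝ), EE f ρ M t * (t : ℂ) ^ (-(s + 1))) =
      fun s => mellin g (-s) := by
    ext s
    rw [mellin, setIntegral_eq_of_subset_of_forall_sdiff_eq_zero measurableSet_Ioi
      (Set.Ioi_subset_Ioi hM0.le)]
    · refine setIntegral_congr_fun measurableSet_Ioi fun t ht => ?_
      simp only [g]
      rw [Set.indicator_of_mem ht, smul_eq_mul, mul_comm]; congr 2; ring
    · intro t ht
      simp only [g]; rw [Set.indicator_of_notMem ht.2, smul_zero]
  rw [e]
  refine DifferentiableAt.fun_comp' (f := fun s : ℂ => -s) s ?_ (by fun_prop)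
  refine mellin_differentiableAt_of_isBigO_rpow (a := 0) (b := (-s).re - 1) ?_ ?_ (by simpa) ?_ (by linarith)
  · refine LocallyIntegrable.locallyIntegrableOn ?_ _
    exact (locallyIntegrable_const K).mono hgm.aestronglyMeasurable
      (Eventually.of_forall fun t => by rw [Real.norm_of_nonneg hK0]; exact hgb t)
  · refine IsBigO.of_bound K (Eventually.of_forall fun t => ?_)
    simpa using hgb t
  · refine IsBigO.of_bound 0 ?_
    filter_upwards [nhdsWithin_le_nhds (Iio_mem_nhds hM0)] with t ht
    simp only [g]; rw [Set.indicator_of_notMem (by simpa using le_of_lt ht)]; simp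

lemma sum_ZMod (q : ℕ) [NeZero q] (F : ZMod q → ℂ) :
    ∑ k ∈ Finset.range q, F k = ∑ a, F a := by
  obtain _ | q := q
  · exact absurd rfl (NeZero.ne 0)
  · rw [Finset.sum_range]
    refine Finset.sum_congr rfl fun a _ => ?_
    congr 1
    exact Fin.cast_val_eq_self a

lemma EE_bound (q : ℕ) [NeZero q] (F : ZMod q → ℂ) (hF : ∀ a, ‖F a‖ ≤ 1) {ρ : ℂ}
    (hρ : ∑ a, F a = ρ * q) {M : ℕ} {t : ℝ} (ht : M ≤ t) :
    ‖EE (fun n => F n) ρ M t‖ ≤ 5 * q := by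
  have hq0 : 0 < q := Nat.pos_of_ne_zero (NeZero.ne q)
  have hq : (1 : ℝ) ≤ q := by exact_mod_cast hq0
  have hρ1 : ‖ρ‖ ≤ 1 := by
    have h : ‖∑ a, F a‖ ≤ q := by
      refine (norm_sum_le_of_le _ fun a _ => hF a).trans ?_
      simp [ZMod.card]
    rw [hρ, norm_mul, Complex.norm_natCast] at h
    nlinarith
  set G : ℕ → ℂ := fun n => ∑ k ∈ Finset.range n, (F k - ρ)
  have hGq : G q = 0 := by
    simp only [G]; rw [Finset.sum_sub_distrib, sum_ZMod, hρ]; simp [mul_comm]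
  have hper : Function.Periodic G q := by
    intro n
    simp only [G]
    rw [add_comm n q, Finset.sum_range_add]
    have : ∑ k ∈ Finset.range q, (F k - ρ) = 0 := hGq
    rw [this, zero_add]
    simp
  have hGb : ∀ n, ‖G n‖ ≤ 2 * q := by
    intro n
    rw [← hper.map_mod_nat]
    have h1 : ‖G (n % q)‖ ≤ ∑ k ∈ Finset.range (n % q), (2 : ℝ) :=
      norm_sum_le_of_le _ fun a _ => (norm_sub_le _ _).trans (by linarith [hF a])
    have h2 : ((n % q : ℕ) : ℝ) ≤ q := by exact_mod_cast (Nat.mod_lt n hq0).le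
    simp at h1
    linarith
  have hfl : M ≤ ⌊t⌋₊ := Nat.le_floor ht
  have ht0 : 0 ≤ t := (Nat.cast_nonneg M).trans ht
  have key : EE (fun n => F n) ρ M t = G (⌊t⌋₊ + 1) - G (M + 1) - ρ * (t - ⌊t⌋₊) := by
    have h1 : G (⌊t⌋₊ + 1) - G (M + 1) = ∑ k ∈ Finset.Ico (M+1) (⌊t⌋₊+1), (F k - ρ) := by
      rw [Finset.sum_Ico_eq_sub _ (by omega)]
    have h2 : Finset.Ico (M+1) (⌊t⌋₊+1) = Finset.Ioc M ⌊t⌋₊ := by ext; simp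
    rw [h1, h2, EE, Finset.sum_sub_distrib]
    simp only [Finset.sum_const, Nat.card_Ioc, nsmul_eq_mul]
    push_cast [Nat.cast_sub hfl]
    ring
  have h3 : ‖(t : ℂ) - ⌊t⌋₊‖ ≤ 1 := by
    have : (t : ℂ) - ⌊t⌋₊ = ((t - ⌊t⌋₊ : ℝ) : ℂ) := by push_cast; rfl
    rw [this, Complex.norm_real, Real.norm_eq_abs, abs_le]
    constructor <;> linarith [Nat.floor_le ht0, Nat.lt_floor_add_one t]
  rw [key]
  calc _ ≤ ‖G (⌊t⌋₊ + 1)‖ + ‖G (M + 1)‖ + ‖ρ * (t - ⌊t⌋₊)‖ :=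
        (norm_sub_le _ _).trans (by gcongr; exact norm_sub_le _ _)
    _ ≤ 2 * q + 2 * q + 1 := by
        gcongr
        · exact hGb _
        · exact hGb _
        · rw [norm_mul]; exact mul_le_one₀ hρ1 (norm_nonneg _) h3
    _ ≤ _ := by linarith

/-- mean of a character -/
noncomputable def rr {q : ℕ} [NeZero q] (χ : DirichletCharacter ℂ q) : ℂ := (∑ a, χ a) / q

lemma LF_eq {q : ℕ} [NeZero q] (χ : DirichletCharacter ℂ q) {M : ℕ} (hM : 1 ≤ M) {s : ℂ}
    (hs : 1 < s.re ∨ (χ ≠ 1 ∧ 0 < s.re)) :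
    DirichletCharacter.LFunction χ s = ∑ n ∈ Finset.Icc 1 M, χ n * (n : ℂ) ^ (-s) +
      rr χ * (M : ℂ) ^ (1 - s) / (s - 1) +
      s * ∫ t in Set.Ioi (M : ℝ), EE (fun n => χ n) (rr χ) M t * (t : ℂ) ^ (-(s + 1)) := by
  have hq : (q : ℂ) ≠ 0 := by exact_mod_cast NeZero.ne q
  have hK : ∀ t : ℝ, M ≤ t → ‖EE (fun n => χ n) (rr χ) M t‖ ≤ 5 * q := fun t ht =>
    EE_bound q (fun a => χ a) (fun a => χ.norm_le_one a) (by rw [rr]; field_simp) ht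
  have h1 : ∀ s : ℂ, 1 < s.re → DirichletCharacter.LFunction χ s =
      ∑ n ∈ Finset.Icc 1 M, χ n * (n : ℂ) ^ (-s) + rr χ * (M : ℂ) ^ (1 - s) / (s - 1) +
      s * ∫ t in Set.Ioi (M : ℝ), EE (fun n => χ n) (rr χ) M t * (t : ℂ) ^ (-(s + 1)) := by
    intro s hs
    rw [DirichletCharacter.LFunction_eq_LSeries χ hs]
    exact LS_eq hM (fun n => χ.norm_le_one _) hK hs
  rcases hs with hs | ⟨hχ, hs⟩
  · exact h1 s hs
  have hr : rr χ = 0 := by rw [rr, χ.sum_eq_zero_of_ne_one hχ, zero_div]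
  set U : Set ℂ := {s | 0 < s.re}
  have hU : IsOpen U := isOpen_lt continuous_const continuous_re
  have hUc : IsPreconnected U := (convex_halfSpace_re_gt 0).isPreconnected
  refine AnalyticOnNhd.eqOn_of_preconnected_of_eventuallyEq (𝕜 := ℂ) (U := U) (z₀ := 2)
    (f := DirichletCharacter.LFunction χ) (g := fun s => ∑ n ∈ Finset.Icc 1 M, χ n * (n : ℂ) ^ (-s) +
      rr χ * (M : ℂ) ^ (1 - s) / (s - 1) +
      s * ∫ t in Set.Ioi (M : ℝ), EE (fun n => χ n) (rr χ) M t * (t : ℂ) ^ (-(s + 1)))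
    ?_ ?_ hUc (by simp [U]) ?_ hs
  · exact (DifferentiableOn.analyticOnNhd (DirichletCharacter.differentiable_LFunction hχ).differentiableOn hU)
  · refine DifferentiableOn.analyticOnNhd (fun s hs => DifferentiableAt.differentiableWithinAt ?_) hU
    rw [hr]
    simp only [zero_mul, zero_div, add_zero]
    refine DifferentiableAt.add ?_ (differentiableAt_id.mul (hr ▸ EE_diff hM hK hs))
    refine DifferentiableAt.fun_sum fun n hn => ?_
    have : (n : ℂ) ≠ 0 := by have := (Finset.mem_Icc.1 hn).1; exact_mod_cast (by omega : n ≠ 0)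
    exact (differentiableAt_const _).mul (DifferentiableAt.const_cpow (by fun_prop) (Or.inl this))
  · filter_upwards [(isOpen_lt continuous_const continuous_re : IsOpen {s : ℂ | 1 < s.re}).mem_nhds
      (by simp : (2 : ℂ) ∈ {s : ℂ | 1 < s.re})] with s hs
    exact h1 s hs
end

section
open Complex MeasureTheory Filter Topology Asymptotics

noncomputable def VV (q : ℕ) (s : ℂ) : ℝ := q * (|s.im| + 2)

lemma VV_ge {q : ℕ} [NeZero q] (s : ℂ) : 2 ≤ VV q s := by
  have hq : (1 : ℝ) ≤ q := by exact_mod_cast Nat.pos_of_ne_zero (NeZero.ne q)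
  unfold VV; nlinarith [abs_nonneg s.im]

lemma rr_zero {q : ℕ} [NeZero q] {χ : DirichletCharacter ℂ q} (hχ : χ ≠ 1) : rr χ = 0 := by
  rw [rr, χ.sum_eq_zero_of_ne_one hχ, zero_div]

lemma rr_norm {q : ℕ} [NeZero q] (χ : DirichletCharacter ℂ q) : ‖rr χ‖ ≤ 1 := by
  have hq : (1 : ℝ) ≤ q := by exact_mod_cast Nat.pos_of_ne_zero (NeZero.ne q)
  rw [rr, norm_div, Complex.norm_natCast, div_le_one (by linarith)]
  refine (norm_sum_le_of_le _ fun a _ => χ.norm_le_one a).trans ?_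
  simp [ZMod.card]

lemma LF_le {q : ℕ} [NeZero q] (χ : DirichletCharacter ℂ q) {M : ℕ} (hM : 1 ≤ M) {s : ℂ}
    (hs : 1 < s.re ∨ (χ ≠ 1 ∧ 0 < s.re)) :
    ‖DirichletCharacter.LFunction χ s‖ ≤ ∑ n ∈ Finset.Icc 1 M, (n : ℝ) ^ (-s.re) +
      ‖rr χ‖ * (M : ℝ) ^ (1 - s.re) / ‖s - 1‖ + ‖s‖ * (5 * q * (M : ℝ) ^ (-s.re) / s.re) := by
  have hM0 : (0 : ℝ) < M := by exact_mod_cast hM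
  have hq : (q : ℂ) ≠ 0 := by exact_mod_cast NeZero.ne q
  have hs0 : 0 < s.re := by rcases hs with h | h <;> [linarith; exact h.2]
  have hK : ∀ t : ℝ, M ≤ t → ‖EE (fun n => χ n) (rr χ) M t‖ ≤ 5 * q := fun t ht =>
    EE_bound q (fun a => χ a) (fun a => χ.norm_le_one a) (by rw [rr]; field_simp) ht
  rw [LF_eq χ hM hs]
  refine (norm_add₃_le).trans ?_
  gcongr ?_ + ?_ + ?_
  · refine norm_sum_le_of_le _ fun n hn => ?_
    have hn0 : (0 : ℝ) < n := by have := (Finset.mem_Icc.1 hn).1; exact_mod_cast this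
    rw [norm_mul, ← ofReal_natCast, norm_cpow_eq_rpow_re_of_pos hn0, neg_re]
    exact mul_le_of_le_one_left (by positivity) (χ.norm_le_one _)
  · rw [norm_div, norm_mul, ← ofReal_natCast, norm_cpow_eq_rpow_re_of_pos hM0]; simp
  · rw [norm_mul]; gcongr
    exact (EE_int hM hK hs0).2

lemma harm_le {M : ℕ} (hM : 1 ≤ M) {δ : ℝ} (hδ : 0 < δ) {σ : ℝ} (hσ : 1 - δ ≤ σ) :
    ∑ n ∈ Finset.Icc 1 M, (n : ℝ) ^ (-σ) ≤ (1 + 1 / δ) * (M : ℝ) ^ (2 * δ) := by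
  have hM1 : (1 : ℝ) ≤ M := by exact_mod_cast hM
  have h1 : ∑ n ∈ Finset.Icc 1 M, (n : ℝ) ^ (-σ) ≤ ∑ n ∈ Finset.Icc 1 M, (M : ℝ) ^ δ * (n : ℝ)⁻¹ := by
    refine Finset.sum_le_sum fun n hn => ?_
    rw [Finset.mem_Icc] at hn
    have hn1 : (1 : ℝ) ≤ n := by exact_mod_cast hn.1
    have hn2 : (n : ℝ) ≤ M := by exact_mod_cast hn.2
    calc (n : ℝ) ^ (-σ) ≤ (n : ℝ) ^ (δ + -1) := Real.rpow_le_rpow_of_exponent_le hn1 (by linarith)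
      _ = (n : ℝ) ^ δ * (n : ℝ)⁻¹ := by rw [Real.rpow_add (by linarith), Real.rpow_neg_one]
      _ ≤ _ := by gcongr
  have h2 : ∑ n ∈ Finset.Icc 1 M, (n : ℝ)⁻¹ ≤ 1 + Real.log M := by
    have := harmonic_le_one_add_log M
    rw [harmonic_eq_sum_Icc] at this
    push_cast at this
    exact this
  have h3 : 1 + Real.log M ≤ (1 + 1 / δ) * (M : ℝ) ^ δ := by
    have := Real.log_le_rpow_div (by linarith : (0:ℝ) ≤ M) hδ
    have h4 : 1 ≤ (M : ℝ) ^ δ := Real.one_le_rpow hM1 hδ.le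
    calc _ ≤ (M : ℝ) ^ δ + (M : ℝ) ^ δ / δ := by linarith
      _ = _ := by ring
  rw [← Finset.mul_sum] at h1
  calc _ ≤ (M : ℝ) ^ δ * ((1 + 1 / δ) * (M : ℝ) ^ δ) := h1.trans (by gcongr; exact h2.trans h3)
    _ = _ := by rw [two_mul, Real.rpow_add (by linarith)]; ring

lemma norm_div_re {s : ℂ} (hs : 1 / 2 ≤ s.re) : ‖s‖ / s.re ≤ 1 + 2 * |s.im| := by
  have h0 : 0 < s.re := by linarith
  rw [div_le_iff₀ h0]
  have := Complex.norm_le_abs_re_add_abs_im s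
  rw [abs_of_pos h0] at this
  nlinarith [abs_nonneg s.im]

/-- upper bound for L-functions near the 1-line -/
lemma LF_upper {ε : ℝ} (hε : 0 < ε) (hε1 : ε ≤ 1) : ∃ C : ℝ, 1 ≤ C ∧ ∀ (q : ℕ) [NeZero q]
    (χ : DirichletCharacter ℂ q) (s : ℂ), (1 < s.re ∨ (χ ≠ 1 ∧ 1 - ε / 8 ≤ s.re)) →
    ‖DirichletCharacter.LFunction χ s‖ ≤ C * VV q s ^ ε * (1 + ‖rr χ‖ / ‖s - 1‖) := by
  refine ⟨2 * (1 + 8 / ε) + 20, by have : 0 < 8 / ε := by positivity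
                                   linarith, fun q _ χ s hs => ?_⟩
  have hV := VV_ge (q := q) s
  set V := VV q s
  set M := ⌈V⌉₊ ^ 2
  have hc1 : V ≤ ⌈V⌉₊ := Nat.le_ceil V
  have hc2 : (⌈V⌉₊ : ℝ) ≤ 2 * V := by linarith [Nat.ceil_lt_add_one (by linarith : 0 ≤ V)]
  have hM : 1 ≤ M := by
    have : 0 < ⌈V⌉₊ := Nat.ceil_pos.2 (by linarith)
    exact Nat.one_le_pow _ _ this
  have hM1 : (1 : ℝ) ≤ M := by exact_mod_cast hM
  have hMV : V ^ 2 ≤ M := by simp only [M]; push_cast; gcongr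
  have hMV2 : (M : ℝ) ≤ 4 * V ^ 2 := by
    simp only [M]; push_cast; nlinarith
  have hq : (1 : ℝ) ≤ q := by exact_mod_cast Nat.pos_of_ne_zero (NeZero.ne q)
  have hσ : 1 - ε / 8 ≤ s.re := by rcases hs with h | h <;> [linarith; exact h.2]
  have hσ2 : 1 / 2 ≤ s.re := by linarith
  have hP : (M : ℝ) ^ (2 * (ε / 8)) ≤ 2 * V ^ ε := by
    calc (M : ℝ) ^ (2 * (ε / 8)) ≤ (4 * V ^ 2) ^ (2 * (ε / 8)) := by gcongr
      _ = 4 ^ (2 * (ε / 8)) * V ^ (ε / 2) := by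
          rw [Real.mul_rpow (by norm_num) (by positivity), ← Real.rpow_natCast, ← Real.rpow_mul (by linarith)]
          congr 2; push_cast; ring
      _ ≤ 4 ^ (1 / 2 : ℝ) * V ^ ε := by
          gcongr <;> first | linarith | norm_num
      _ = 2 * V ^ ε := by
          rw [← Real.sqrt_eq_rpow, show (4 : ℝ) = 2 ^ 2 by norm_num, Real.sqrt_sq (by norm_num)]
  have hV1 : 1 ≤ V ^ ε := Real.one_le_rpow (by linarith) hε.le
  have t1 := harm_le hM (by positivity : 0 < ε / 8) hσ
  have t2 : (M : ℝ) ^ (1 - s.re) ≤ 2 * V ^ ε :=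
    (Real.rpow_le_rpow_of_exponent_le hM1 (by linarith)).trans hP
  have t3 : ‖s‖ * (5 * q * (M : ℝ) ^ (-s.re) / s.re) ≤ 10 := by
    have h1 : (M : ℝ) ^ (-s.re) ≤ V⁻¹ := by
      calc (M : ℝ) ^ (-s.re) ≤ (M : ℝ) ^ (-(1 / 2) : ℝ) := Real.rpow_le_rpow_of_exponent_le hM1 (by linarith)
        _ = (√M)⁻¹ := by rw [Real.rpow_neg (by linarith), Real.sqrt_eq_rpow]
        _ ≤ V⁻¹ := by gcongr; exact Real.le_sqrt_of_sq_le hMV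
    calc _ = (‖s‖ / s.re) * (5 * q) * (M : ℝ) ^ (-s.re) := by ring
      _ ≤ (1 + 2 * |s.im|) * (5 * q) * V⁻¹ := by gcongr; exact norm_div_re hσ2
      _ ≤ (10 * V) * V⁻¹ := by
          refine mul_le_mul_of_nonneg_right ?_ (by positivity)
          change _ ≤ 10 * (q * (|s.im| + 2)); nlinarith [abs_nonneg s.im]
      _ = 10 := by field_simp
  have h := LF_le χ hM (s := s) (hs.imp_right fun h => ⟨h.1, by linarith⟩)
  have hb : 0 ≤ ‖rr χ‖ / ‖s - 1‖ := by positivity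
  have hε8 : 0 < 8 / ε := by positivity
  calc _ ≤ (1 + 8 / ε) * (2 * V ^ ε) + ‖rr χ‖ * (2 * V ^ ε) / ‖s - 1‖ + 10 * V ^ ε := by
        refine h.trans ?_
        gcongr ?_ + ?_ + ?_
        · refine t1.trans ?_
          rw [one_div_div]; gcongr
        · gcongr
        · linarith
    _ = V ^ ε * (2 * (1 + 8 / ε) + 10 + 2 * (‖rr χ‖ / ‖s - 1‖)) := by ring
    _ ≤ V ^ ε * ((2 * (1 + 8 / ε) + 20) * (1 + ‖rr χ‖ / ‖s - 1‖)) := by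
        gcongr; nlinarith
    _ = _ := by ring

lemma LF_poly {q : ℕ} [NeZero q] {χ : DirichletCharacter ℂ q} (hχ : χ ≠ 1) {s : ℂ}
    (hs : 1 / 2 ≤ s.re) : ‖DirichletCharacter.LFunction χ s‖ ≤ 1 + 10 * q * ‖s‖ := by
  have h := LF_le χ le_rfl (s := s) (Or.inr ⟨hχ, by linarith⟩)
  simp [rr_zero hχ] at h
  refine h.trans ?_
  have : 5 * (q:ℝ) / s.re ≤ 10 * q := by
    rw [div_le_iff₀ (by linarith)]; nlinarith [Nat.cast_nonneg (α := ℝ) q]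
  nlinarith [norm_nonneg s]
end

section
open Complex MeasureTheory Filter Topology Asymptotics
open scoped ComplexOrder

lemma estermann {a : ℕ → ℂ} (ha : 0 ≤ a) (ha1 : a 1 = 1)
    (hab : LSeries.abscissaOfAbsConv a ≤ 1) {H : ℂ → ℂ} (hH : Differentiable ℂ H) {l : ℝ}
    (hF : ∀ s : ℂ, 1 < s.re → LSeries a s = H s + l / (s - 1)) {K : ℝ}
    (hK : ∀ s ∈ Metric.sphere (2 : ℂ) (3 / 2), ‖H s‖ ≤ K) {β : ℝ} (hβ : 7 / 8 ≤ β) (hβ1 : β < 1)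
    {M : ℕ} (hM0 : 0 < M) (hM : 4 * K * (3 / 4) ^ M ≤ 1 / 2) :
    1 / 2 - l * (2 - β) ^ M / (1 - β) ≤ (H β).re + l / (β - 1) := by
  set w : ℝ := 2 - β
  have hw1 : 1 < w := by simp only [w]; linarith
  have hw2 : w ≤ 9 / 8 := by simp only [w]; linarith
  have hK0 : 0 ≤ K := (norm_nonneg _).trans (hK (7 / 2) (by simp [dist_eq]; norm_num))
  set c : ℕ → ℂ := fun n => (-1) ^ n * ((n.factorial : ℂ)⁻¹ * iteratedDeriv n H 2)
  have hsum : HasSum (fun n => c n * (w : ℂ) ^ n) (H β) := by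
    have h := Complex.hasSum_taylorSeries_of_entire hH 2 β
    have e : (fun n => c n * (w : ℂ) ^ n) = fun n : ℕ => (n.factorial : ℂ)⁻¹ •
        ((β : ℂ) - 2) ^ n • iteratedDeriv n H 2 := by
     funext n
     simp only [c, smul_eq_mul, w]
     have : (β : ℂ) - 2 = (-1) * ((2 - β : ℝ) : ℂ) := by push_cast; ring
     rw [this, mul_pow]; ring
    rw [e]; exact h
  have hcn : ∀ n, ‖c n‖ ≤ K * (2 / 3) ^ n := by
    intro n
    have h := norm_iteratedDeriv_le_of_forall_mem_sphere_norm_le n (by norm_num : (0:ℝ) < 3 / 2)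
      hH.diffContOnCl hK
    simp only [c]
    rw [norm_mul, norm_mul]
    simp only [norm_pow, norm_neg, norm_one, one_pow, one_mul, norm_inv, Complex.norm_natCast]
    have hf : (0 : ℝ) < n.factorial := by positivity
    calc _ ≤ (n.factorial : ℝ)⁻¹ * (n.factorial * K / (3 / 2) ^ n) := by gcongr
      _ = K * (((3 / 2) ^ n)⁻¹) := by field_simp
      _ = _ := by rw [← inv_pow]; norm_num
  -- b n = c n + l
  have hab2 : LSeries.abscissaOfAbsConv a < ((2 : ℝ) : EReal) := by
    refine lt_of_le_of_lt hab ?_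
    exact_mod_cast (by norm_num : (1 : ℝ) < 2)
  have hb : ∀ n, 0 ≤ (c n).re + l := by
    intro n
    have h1 := LSeries.iteratedDeriv_alternating ha hab2 n
    have e : LSeries a =ᶠ[𝓝 (2 : ℂ)] fun s => H s + l * (s - 1)⁻¹ := by
      filter_upwards [(isOpen_lt continuous_const continuous_re : IsOpen {s : ℂ | 1 < s.re}).mem_nhds
        (by simp : (2 : ℂ) ∈ {s : ℂ | 1 < s.re})] with s hs
      rw [hF s hs, div_eq_mul_inv]
    have hI : iteratedDeriv n (fun s : ℂ => (s - 1)⁻¹) 2 = (-1) ^ n * n.factorial := by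
      have := iteratedDeriv_comp_sub_const n (fun s : ℂ => s⁻¹) 1
      rw [this, iteratedDeriv_eq_iterate]
      change deriv^[n] Inv.inv ((2 : ℂ) - 1) = _
      rw [iter_deriv_inv]
      have h2 : (2 : ℂ) - 1 = 1 := by norm_num
      simp [h2]
    have hd : ContDiffAt ℂ n (fun s : ℂ => (s - 1)⁻¹) 2 := by
      refine ContDiffAt.inv (by fun_prop) (by norm_num)
    rw [ofReal_ofNat, (e.iteratedDeriv_eq n), iteratedDeriv_fun_add (hH.contDiff.contDiffAt) (contDiffAt_const.mul hd),
      iteratedDeriv_const_mul_field, hI] at h1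
    have hf : (0 : ℝ) < n.factorial := by positivity
    have h3 : (-1) ^ n * (iteratedDeriv n H 2 + l * ((-1) ^ n * n.factorial)) =
        (n.factorial : ℝ) * (c n + l) := by
      have : ((-1 : ℂ) ^ n) * (-1) ^ n = 1 := by rw [← mul_pow]; simp
      simp only [c]
      have hf' : (n.factorial : ℂ) ≠ 0 := by exact_mod_cast hf.ne'
      push_cast
      field_simp
      linear_combination (l * n.factorial : ℂ) * this
    rw [h3] at h1
    have h4 := (Complex.le_def.1 h1).1
    rw [re_ofReal_mul] at h4
    simp at h4
    exact nonneg_of_mul_nonneg_right h4 hf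
  have hb0 : 1 ≤ (c 0).re + l := by
    have h0 : LSeries a 2 = c 0 + l := by
      rw [hF 2 (by simp)]; simp [c]; norm_num
    have hs : LSeriesSummable a 2 := by
      apply LSeriesSummable_of_abscissaOfAbsConv_lt_re; simpa using hab2
    have h1 : (1 : ℂ) ≤ LSeries a 2 := by
      have := hs.le_tsum 1 (fun n _ => LSeries.term_nonneg (ha n) 2)
      simpa [LSeries, LSeries.term, ha1] using this
    rw [h0] at h1
    simpa using (Complex.le_def.1 h1).1
  have hre : HasSum (fun n => (c n).re * w ^ n) (H β).re := by
    have := Complex.hasSum_re hsum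
    simpa only [← ofReal_pow, re_mul_ofReal] using this
  have hsplit := hre.summable.sum_add_tsum_nat_add M
  rw [hre.tsum_eq] at hsplit
  have htail : |∑' n, (c (n + M)).re * w ^ (n + M)| ≤ 4 * K * (3 / 4) ^ M := by
    have hg : HasSum (fun n : ℕ => K * (3 / 4) ^ M * (3 / 4 : ℝ) ^ n) (K * (3 / 4) ^ M * (1 - 3 / 4)⁻¹) :=
      (hasSum_geometric_of_lt_one (by norm_num) (by norm_num)).mul_left _
    have := tsum_of_norm_bounded hg (f := fun n => (c (n + M)).re * w ^ (n + M)) (fun n => by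
      rw [norm_mul, norm_pow, Real.norm_of_nonneg (by linarith : 0 ≤ w)]
      calc _ ≤ (K * (2 / 3) ^ (n + M)) * (9 / 8) ^ (n + M) := by
            gcongr
            exact (Complex.abs_re_le_norm _).trans (hcn _)
        _ = K * ((2 / 3) * (9 / 8)) ^ (n + M) := by rw [mul_pow]; ring
        _ = _ := by norm_num [pow_add]; ring)
    rw [Real.norm_eq_abs] at this
    linarith
  have hhead : 1 - l * (w ^ M - 1) / (w - 1) ≤ ∑ n ∈ Finset.range M, (c n).re * w ^ n := by
    have h1 : ∑ n ∈ Finset.range M, (c n).re * w ^ n =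
        ∑ n ∈ Finset.range M, ((c n).re + l) * w ^ n - l * ((w ^ M - 1) / (w - 1)) := by
      rw [← geom_sum_eq hw1.ne', Finset.mul_sum, ← Finset.sum_sub_distrib]
      refine Finset.sum_congr rfl fun n _ => by ring
    have h2 : 1 ≤ ∑ n ∈ Finset.range M, ((c n).re + l) * w ^ n := by
      have := Finset.single_le_sum (f := fun n => ((c n).re + l) * w ^ n) (s := Finset.range M)
        (fun n _ => mul_nonneg (hb n) (by positivity)) (Finset.mem_range.2 hM0)
      simp at this
      linarith
    rw [h1, mul_div_assoc]; linarith
  have hne : w - 1 ≠ 0 := by linarith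
  have e1 : 1 - β = w - 1 := by simp only [w]; ring
  have e2 : β - 1 = -(w - 1) := by simp only [w]; ring
  rw [e1, e2]
  have habs := abs_le.1 (htail.trans hM)
  have : l * (w ^ M - 1) / (w - 1) = l * w ^ M / (w - 1) - l / (w - 1) := by ring
  rw [div_neg]
  linarith [habs.1]
end

section
open Complex MeasureTheory Filter Topology Asymptotics DirichletCharacter
open scoped ComplexOrder

lemma siegel_core : ∃ C0 : ℝ, 1 ≤ C0 ∧ ∀ (a : ℕ → ℂ) (P : ℂ → ℂ) (B β l : ℝ), 0 ≤ a → a 1 = 1 →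
    LSeries.abscissaOfAbsConv a ≤ 1 → Differentiable ℂ P →
    (∀ s : ℂ, 1 < s.re → LSeries a s = riemannZeta s * P s) → P 1 = l → 1 ≤ B →
    (∀ s ∈ Metric.closedBall (2 : ℂ) (3 / 2), ‖P s‖ ≤ B) → 7 / 8 ≤ β → β < 1 →
    (riemannZeta β * P β).re ≤ 0 → 1 - β ≤ 6 * l * (C0 * B) ^ (4 * (1 - β)) := by
  set Z := LFunctionTrivChar₁ 1
  have hZd : Differentiable ℂ Z := differentiable_LFunctionTrivChar₁ 1
  have hZ1 : Z 1 = 1 := by simp [Z]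
  have hZ : ∀ s, s ≠ 1 → Z s = (s - 1) * riemannZeta s := by
    intro s hs
    simp [Z, Function.update_of_ne hs, LFunctionTrivChar]
  obtain ⟨CZ, hCZ⟩ := (isCompact_closedBall (2 : ℂ) (3 / 2)).exists_bound_of_continuousOn
    hZd.continuous.continuousOn
  have h1m : (1 : ℂ) ∈ Metric.closedBall (2 : ℂ) (3 / 2) := by simp [dist_eq]; norm_num
  have hCZ1 : 1 ≤ CZ := by have := hCZ 1 h1m; rw [hZ1] at this; simpa using this
  refine ⟨8 * (2 * (CZ + 1)), by linarith, ?_⟩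
  intro a P B β l ha ha1 hab hP hF hl hB hPB hβ hβ1 hneg
  set G : ℂ → ℂ := fun s => Z s * P s
  have hG : Differentiable ℂ G := hZd.mul hP
  set H := dslope G 1
  have hH : Differentiable ℂ H := by
    rw [← differentiableOn_univ]
    exact (differentiableOn_dslope univ_mem).2 hG.differentiableOn
  have hG1 : G 1 = l := by simp [G, hZ1, hl]
  have hHs : ∀ s, s ≠ 1 → H s = (G s - l) / (s - 1) := by
    intro s hs
    simp only [H]; rw [dslope_of_ne _ hs, slope_def_field, hG1]
  have hzp : ∀ s, s ≠ 1 → riemannZeta s * P s = H s + l / (s - 1) := by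
    intro s hs
    have h1 := sub_ne_zero.2 hs
    rw [hHs s hs]; simp only [G]; rw [hZ s hs]; field_simp; ring
  set K : ℝ := 2 * (CZ + 1) * B
  have hK : ∀ s ∈ Metric.sphere (2 : ℂ) (3 / 2), ‖H s‖ ≤ K := by
    intro s hs
    have hs2 : s ∈ Metric.closedBall (2 : ℂ) (3 / 2) := Metric.sphere_subset_closedBall hs
    have hd : 1 / 2 ≤ ‖s - 1‖ := by
      have h1 : ‖s - 2‖ = 3 / 2 := by simpa [dist_eq] using hs
      have h2 : ‖s - 2‖ ≤ ‖s - 1‖ + ‖(-1 : ℂ)‖ := by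
        rw [show s - 2 = (s - 1) + (-1) by ring]; exact norm_add_le _ _
      rw [h1] at h2; simp at h2; linarith
    have hs1 : s ≠ 1 := by rintro rfl; simp at hd; linarith
    have hl' : ‖(l : ℂ)‖ ≤ B := hl ▸ hPB 1 h1m
    rw [hHs s hs1, norm_div, div_le_iff₀ (by linarith)]
    calc ‖G s - l‖ ≤ ‖Z s‖ * ‖P s‖ + ‖(l : ℂ)‖ := by
          refine (norm_sub_le _ _).trans ?_; rw [norm_mul]
      _ ≤ CZ * B + B := by gcongr; exacts [hCZ s hs2, hPB s hs2]
      _ = K * (1 / 2) := by simp only [K]; ring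
      _ ≤ _ := by gcongr
  have hK1 : 1 ≤ 8 * K := by simp only [K]; nlinarith
  set M := ⌈4 * Real.log (8 * K)⌉₊ + 1
  have hlog : 0 ≤ Real.log (8 * K) := Real.log_nonneg hK1
  have hM1 : 4 * Real.log (8 * K) ≤ M := by
    simp only [M]; push_cast; linarith [Nat.le_ceil (4 * Real.log (8 * K))]
  have hM2 : (M : ℝ) ≤ 4 * Real.log (8 * K) + 2 := by
    simp only [M]; push_cast
    linarith [Nat.ceil_lt_add_one (by positivity : 0 ≤ 4 * Real.log (8 * K))]
  have hM : 4 * K * (3 / 4) ^ M ≤ 1 / 2 := by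
    have h1 : (3 / 4 : ℝ) ^ M ≤ (8 * K)⁻¹ := by
      calc (3 / 4 : ℝ) ^ M ≤ (Real.exp (-(1 / 4))) ^ M := by
            gcongr; linarith [Real.add_one_le_exp (-(1 / 4) : ℝ)]
        _ = Real.exp (-(M / 4)) := by rw [← Real.exp_nat_mul]; ring_nf
        _ ≤ Real.exp (-Real.log (8 * K)) := by gcongr; linarith
        _ = _ := by rw [Real.exp_neg, Real.exp_log (by linarith)]
    calc 4 * K * (3 / 4) ^ M ≤ 4 * K * (8 * K)⁻¹ := by gcongr
      _ = _ := by have : K ≠ 0 := by intro h; simp [h] at hK1; linarith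
                  field_simp; norm_num
  have key := estermann ha ha1 hab hH (l := l) (fun s hs => by
    rw [hF s hs, hzp s (by rintro rfl; simp at hs)]) hK hβ hβ1 (by simp [M]) hM
  have hβne : (β : ℂ) ≠ 1 := by exact_mod_cast hβ1.ne
  have hb := hzp β hβne
  have hb' : (riemannZeta β * P β).re = (H β).re + l / (β - 1) := by
    rw [hb, add_re]
    congr 1
    rw [show (l : ℂ) / (β - 1) = ((l / (β - 1) : ℝ) : ℂ) by push_cast; rfl, ofReal_re]
  rw [← hb'] at key
  have h1β : 0 < 1 - β := by linarith
  have k2 : 1 / 2 ≤ l * (2 - β) ^ M / (1 - β) := by linarith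
  rw [le_div_iff₀ h1β] at k2
  have hl0 : 0 < l := by
    have : 0 < (2 - β) ^ M := by apply pow_pos; linarith
    by_contra h
    push Not at h
    nlinarith
  have hpow : (2 - β) ^ M ≤ 3 * (8 * K) ^ (4 * (1 - β)) := by
    calc (2 - β) ^ M ≤ (Real.exp (1 - β)) ^ M := by
          gcongr
          · linarith
          · linarith [Real.add_one_le_exp (1 - β)]
      _ = Real.exp (M * (1 - β)) := by rw [← Real.exp_nat_mul]
      _ ≤ Real.exp (Real.log (8 * K) * (4 * (1 - β)) + 1) := by
          gcongr; nlinarith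
      _ = Real.exp 1 * (8 * K) ^ (4 * (1 - β)) := by
          rw [Real.exp_add, Real.rpow_def_of_pos (by linarith), mul_comm]
      _ ≤ _ := by gcongr; linarith [Real.exp_one_lt_d9]
  have e : 8 * (2 * (CZ + 1)) * B = 8 * K := by simp only [K]; ring
  rw [e]
  nlinarith [mul_le_mul_of_nonneg_left hpow hl0.le]
end

section
open Complex MeasureTheory Filter Topology Asymptotics DirichletCharacter
open scoped ComplexOrder LSeries.notation

/-- arithmetic function of a character -/
noncomputable def XX {q : ℕ} (χ : DirichletCharacter ℂ q) : ArithmeticFunction ℂ :=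
  toArithmeticFunction (fun n => χ n)
/-- twisted von Mangoldt -/
noncomputable def XL {q : ℕ} (χ : DirichletCharacter ℂ q) : ArithmeticFunction ℂ :=
  toArithmeticFunction (fun n => χ n * (ArithmeticFunction.vonMangoldt n : ℂ))
/-- log derivation relation -/
def DD (f g : ArithmeticFunction ℂ) : Prop := ∀ n : ℕ, (Real.log n : ℂ) * f n = (g * f) n

lemma XX_apply {q : ℕ} (χ : DirichletCharacter ℂ q) {n : ℕ} (hn : n ≠ 0) : XX χ n = χ n := by
  simp [XX, toArithmeticFunction, hn]
lemma XL_apply {q : ℕ} (χ : DirichletCharacter ℂ q) (n : ℕ) :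
    XL χ n = χ n * (ArithmeticFunction.vonMangoldt n : ℂ) := by
  by_cases hn : n = 0 <;> simp [XL, toArithmeticFunction, hn]

lemma DD_XX {q : ℕ} (χ : DirichletCharacter ℂ q) : DD (XX χ) (XL χ) := by
  intro n
  have h := congrFun (convolution_twist_vonMangoldt χ) n
  change (XL χ * XX χ) n = _ at h
  rw [h]
  by_cases hn : n = 0
  · simp [hn]
  rw [XX_apply _ hn]; simp [ofReal_log, mul_comm]

lemma DD_mul {f g f' g' : ArithmeticFunction ℂ} (h : DD f g) (h' : DD f' g') :
    DD (f * f') (g + g') := by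
  intro n
  have e : (g + g') * (f * f') = (g * f) * f' + f * (g' * f') := by ring
  rw [e, ArithmeticFunction.add_apply]
  simp only [ArithmeticFunction.mul_apply (f := g * f), ArithmeticFunction.mul_apply (f := f),
    Finset.mul_sum]
  rw [← Finset.sum_add_distrib]
  refine Finset.sum_congr rfl fun x hx => ?_
  rw [← h, ← h']
  have := Nat.mem_divisorsAntidiagonal.1 hx
  have h1 : x.1 ≠ 0 := by rintro h0; simp [h0] at this; omega
  have h2 : x.2 ≠ 0 := by rintro h0; simp [h0] at this; omega
  rw [← this.1]; push_cast
  rw [Real.log_mul (by exact_mod_cast h1) (by exact_mod_cast h2)]; push_cast; ring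

lemma DD_nonneg {f g : ArithmeticFunction ℂ} (h : DD f g) (hg : ∀ n, 0 ≤ g n) (hg1 : g 1 = 0)
    (hf : f 1 = 1) : ∀ n, 0 ≤ f n := by
  intro n
  induction n using Nat.strong_induction_on with
  | _ n ih =>
    rcases Nat.lt_or_ge n 2 with hn | hn
    · interval_cases n <;> simp [hf]
    have h1 := h n
    have h2 : 0 ≤ (g * f) n := by
      rw [ArithmeticFunction.mul_apply]
      refine Finset.sum_nonneg fun x hx => ?_
      have hx' := Nat.mem_divisorsAntidiagonal.1 hx
      by_cases h1 : x.1 = 1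
      · simp [h1, hg1]
      · refine mul_nonneg (hg _) (ih _ ?_)
        have : x.1 ≠ 0 := by rintro h0; simp [h0] at hx'; omega
        have : x.2 ≠ 0 := by rintro h0; simp [h0] at hx'; omega
        have : 2 ≤ x.1 := by omega
        nlinarith [hx'.1, Nat.pos_of_ne_zero ‹x.2 ≠ 0›]
    rw [← h1] at h2
    have hl : 0 < Real.log n := Real.log_pos (by exact_mod_cast hn)
    have h3 : f n = ((Real.log n)⁻¹ : ℝ) * ((Real.log n : ℂ) * f n) := by
      have : (Real.log n : ℂ) ≠ 0 := by exact_mod_cast hl.ne'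
      rw [ofReal_inv, inv_mul_cancel_left₀ this]
    rw [h3]
    exact mul_nonneg (by rw [Complex.zero_le_real]; positivity) h2

lemma XX_LS {q : ℕ} [NeZero q] (χ : DirichletCharacter ℂ q) {s : ℂ} (hs : 1 < s.re) :
    LSeriesSummable (XX χ) s ∧ LSeries (XX χ) s = LFunction χ s := by
  have h1 := LSeriesSummable_of_one_lt_re χ hs
  have e : ∀ {n : ℕ}, n ≠ 0 → (fun n : ℕ => χ n) n = XX χ n := fun hn => (XX_apply χ hn).symm
  refine ⟨(LSeriesSummable_congr s e).1 h1, ?_⟩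
  rw [LFunction_eq_LSeries _ hs]
  exact (LSeries_congr e s).symm

lemma quad_val {q : ℕ} {χ : DirichletCharacter ℂ q} (h : χ ^ 2 = 1) (a : ZMod q) :
    χ a = 0 ∨ χ a = 1 ∨ χ a = -1 := (MulChar.isQuadratic_iff_sq_eq_one.2 h) a

/-- the character mod one -/
noncomputable abbrev one1 : DirichletCharacter ℂ 1 := 1

lemma one1_apply (a : ZMod 1) : one1 a = 1 := by rw [Subsingleton.elim a 1]; simp

lemma siegel_coef2 {q : ℕ} [NeZero q] {χ : DirichletCharacter ℂ q} (h : χ ^ 2 = 1) :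
    ∃ a : ℕ → ℂ, 0 ≤ a ∧ a 1 = 1 ∧ LSeries.abscissaOfAbsConv a ≤ 1 ∧
      ∀ s : ℂ, 1 < s.re → LSeries a s = riemannZeta s * LFunction χ s := by
  have hs := fun (s : ℂ) (hs : 1 < s.re) => And.intro (XX_LS one1 hs) (XX_LS χ hs)
  refine ⟨⇑(XX one1 * XX χ : ArithmeticFunction ℂ), ?_, by simp [XX_apply, one1_apply], ?_, ?_⟩
  · refine DD_nonneg (DD_mul (DD_XX one1) (DD_XX χ)) (fun n => ?_) (by simp [XL_apply]) (by simp [XX_apply, one1_apply])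
    have hl : (0 : ℂ) ≤ (ArithmeticFunction.vonMangoldt n : ℂ) := by
      rw [Complex.zero_le_real]; exact ArithmeticFunction.vonMangoldt_nonneg
    simp only [ArithmeticFunction.add_apply, XL_apply]
    rw [one1_apply]
    rcases quad_val h n with e | e | e <;> rw [e] <;> simp [hl, add_nonneg]
  · refine LSeries.abscissaOfAbsConv_le_of_forall_lt_LSeriesSummable (x := 1) fun y hy => ?_
    have := hs y (by simpa using hy)
    exact ArithmeticFunction.LSeriesSummable_mul this.1.1 this.2.1
  · intro s h1
    have := hs s h1
    rw [ArithmeticFunction.LSeries_mul' this.1.1 this.2.1, this.1.2, this.2.2,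
      LFunction_modOne_eq]

lemma siegel_coef4 {q : ℕ} [NeZero q] {χ ψ : DirichletCharacter ℂ q} (h : χ ^ 2 = 1)
    (h' : ψ ^ 2 = 1) :
    ∃ a : ℕ → ℂ, 0 ≤ a ∧ a 1 = 1 ∧ LSeries.abscissaOfAbsConv a ≤ 1 ∧
      ∀ s : ℂ, 1 < s.re → LSeries a s = riemannZeta s * (LFunction χ s * LFunction ψ s *
        LFunction (χ * ψ) s) := by
  have hs := fun (s : ℂ) (hs : 1 < s.re) => And.intro (XX_LS one1 hs) (And.intro (XX_LS χ hs)
    (And.intro (XX_LS ψ hs) (XX_LS (χ * ψ) hs)))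
  refine ⟨⇑(XX one1 * (XX χ * XX ψ * XX (χ * ψ)) : ArithmeticFunction ℂ), ?_, by simp [XX_apply, one1_apply], ?_, ?_⟩
  · refine DD_nonneg (DD_mul (DD_XX one1) (DD_mul (DD_mul (DD_XX χ) (DD_XX ψ)) (DD_XX (χ * ψ))))
      (fun n => ?_) (by simp [XL_apply]) (by simp [XX_apply, one1_apply])
    have hl : (0 : ℂ) ≤ (ArithmeticFunction.vonMangoldt n : ℂ) := by
      rw [Complex.zero_le_real]; exact ArithmeticFunction.vonMangoldt_nonneg
    simp only [ArithmeticFunction.add_apply, XL_apply, MulChar.mul_apply]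
    rw [one1_apply]
    rcases quad_val h n with e | e | e <;> rcases quad_val h' n with e' | e' | e' <;>
      rw [e, e'] <;> simp [hl, add_nonneg] <;>
      exact add_nonneg hl (add_nonneg (add_nonneg hl hl) hl)
  · refine LSeries.abscissaOfAbsConv_le_of_forall_lt_LSeriesSummable (x := 1) fun y hy => ?_
    have := hs y (by simpa using hy)
    exact ArithmeticFunction.LSeriesSummable_mul this.1.1 (ArithmeticFunction.LSeriesSummable_mul
      (ArithmeticFunction.LSeriesSummable_mul this.2.1.1 this.2.2.1.1) this.2.2.2.1)
  · intro s h1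
    have := hs s h1
    have t1 := ArithmeticFunction.LSeriesSummable_mul this.2.1.1 this.2.2.1.1
    rw [ArithmeticFunction.LSeries_mul' this.1.1 (ArithmeticFunction.LSeriesSummable_mul t1
      this.2.2.2.1), ArithmeticFunction.LSeries_mul' t1 this.2.2.2.1,
      ArithmeticFunction.LSeries_mul' this.2.1.1 this.2.2.1.1, this.1.2, this.2.1.2, this.2.2.1.2,
      this.2.2.2.2, LFunction_modOne_eq]
end

section
open Complex MeasureTheory Filter Topology Asymptotics DirichletCharacter
open scoped ComplexOrder ComplexConjugate

lemma quad_LF_real {q : ℕ} [NeZero q] {χ : DirichletCharacter ℂ q} (h : χ ^ 2 = 1) (h1 : χ ≠ 1)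
    (x : ℝ) : LFunction χ x = ((LFunction χ x).re : ℂ) := by
  have hd : Differentiable ℂ (LFunction χ) := differentiable_LFunction h1
  have hd2 : Differentiable ℂ (conj ∘ LFunction χ ∘ conj) := fun s => by
    have := (hd (conj s)).conj_conj
    simpa using this
  have e : LFunction χ = conj ∘ LFunction χ ∘ conj := by
    refine AnalyticOnNhd.eq_of_eventuallyEq (𝕜 := ℂ) (z₀ := 2) (fun z _ => hd.analyticAt z)
      (fun z _ => hd2.analyticAt z) ?_
    filter_upwards [(isOpen_lt continuous_const continuous_re : IsOpen {s : ℂ | 1 < s.re}).mem_nhds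
        (by simp : (2 : ℂ) ∈ {s : ℂ | 1 < s.re})] with s hs
    have hs' : 1 < (conj s).re := by simpa using hs
    simp only [Function.comp]
    rw [LFunction_eq_LSeries _ hs, LFunction_eq_LSeries _ hs', LSeries, LSeries, conj_tsum]
    refine tsum_congr fun n => ?_
    by_cases hn : n = 0
    · simp [hn]
    rw [LSeries.term_of_ne_zero hn, LSeries.term_of_ne_zero hn, map_div₀]
    have e1 : conj (χ n) = χ n := by rcases quad_val h n with e | e | e <;> rw [e] <;> simp
    have e2 : conj ((n : ℂ) ^ (conj s)) = (n : ℂ) ^ s := by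
      have := Complex.cpow_conj (n : ℂ) s (by rw [Complex.natCast_arg]; exact Real.pi_pos.ne)
      simp at this
      rw [this]; simp
    rw [e1, e2]
  have := congrFun e x
  simp only [Function.comp, conj_ofReal] at this
  exact (Complex.conj_eq_iff_re.1 this.symm).symm

lemma quad_LF_pos {q : ℕ} [NeZero q] {χ : DirichletCharacter ℂ q} (h : χ ^ 2 = 1) (h1 : χ ≠ 1)
    {β : ℝ} (hz : ∀ x : ℝ, β ≤ x → x < 1 → LFunction χ x ≠ 0) (hβ : β < 1) :
    ∀ x : ℝ, β ≤ x → x ≤ 2 → 0 < (LFunction χ x).re := by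
  have hd : Differentiable ℂ (LFunction χ) := differentiable_LFunction h1
  obtain ⟨a, ha0, ha1, hab, haL⟩ := siegel_coef2 h
  have h2 : 0 < (LFunction χ (2 : ℝ)).re := by
    have hs : LSeriesSummable a 2 := by
      apply LSeriesSummable_of_abscissaOfAbsConv_lt_re
      refine lt_of_le_of_lt hab ?_
      simp only [re_ofNat]; exact_mod_cast (by norm_num : (1 : ℝ) < 2)
    have h3 : (1 : ℂ) ≤ LSeries a 2 := by
      have := hs.le_tsum 1 (fun n _ => LSeries.term_nonneg (ha0 n) 2)
      simpa [LSeries, LSeries.term, ha1] using this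
    rw [haL 2 (by simp)] at h3
    have h4 := riemannZeta_pos_of_one_lt (x := 2) (by norm_num)
    have h5 := quad_LF_real h h1 2
    have h6 := (Complex.le_def.1 h3).1
    push_cast at h4 h5 ⊢
    rw [h5, re_mul_ofReal] at h6
    have h7 := (Complex.lt_def.1 h4).1
    simp at h6 h7
    by_contra hc
    push Not at hc
    nlinarith
  intro x hx hx2
  by_contra hc
  push Not at hc
  have hcont : ContinuousOn (fun y : ℝ => (LFunction χ (y : ℂ)).re) (Set.Icc x 2) :=
    (continuous_re.comp (hd.continuous.comp continuous_ofReal)).continuousOn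
  obtain ⟨y, hy, hy0⟩ := intermediate_value_Icc hx2 hcont (show (0 : ℝ) ∈ Set.Icc _ _ from ⟨hc, h2.le⟩)
  have hy' : LFunction χ y = 0 := by rw [quad_LF_real h h1]; simp at hy0; simp [hy0]
  rcases lt_or_ge y 1 with h' | h'
  · exact hz y (hx.trans hy.1) h' hy'
  · exact LFunction_ne_zero_of_one_le_re χ (Or.inl h1) (by simpa using h') hy'

lemma siegel_fin (n : ℕ) : ∃ c : ℝ, 0 < c ∧ ∀ (q : ℕ) [NeZero q] (χ : DirichletCharacter ℂ q),
    q < n → χ ≠ 1 → c ≤ ‖LFunction χ 1‖ := by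
  induction n with
  | zero => exact ⟨1, one_pos, fun q _ χ h => by omega⟩
  | succ n ih =>
    obtain ⟨c, hc, h⟩ := ih
    rcases Nat.eq_zero_or_pos n with rfl | hn
    · exact ⟨c, hc, fun q _ χ h => by have := NeZero.ne q; omega⟩
    haveI : NeZero n := ⟨hn.ne'⟩
    obtain ⟨χ0, h0⟩ := Finite.exists_min (fun χ : DirichletCharacter ℂ n =>
      if χ = 1 then (1 : ℝ) else ‖LFunction χ 1‖)
    refine ⟨min c (if χ0 = 1 then (1 : ℝ) else ‖LFunction χ0 1‖), ?_, fun q _ χ hq hχ => ?_⟩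
    · refine lt_min hc ?_
      split_ifs with h'
      · exact one_pos
      · exact norm_pos_iff.2 (LFunction_apply_one_ne_zero h')
    · rcases Nat.lt_succ_iff_lt_or_eq.1 hq with h1 | rfl
      · exact (min_le_left _ _).trans (h q χ h1 hχ)
      · have := h0 χ
        rw [if_neg hχ] at this
        convert (min_le_right c _).trans this

lemma LF_ball {q : ℕ} [NeZero q] {χ : DirichletCharacter ℂ q} (h1 : χ ≠ 1) {s : ℂ}
    (hs : s ∈ Metric.closedBall (2 : ℂ) (3 / 2)) : ‖LFunction χ s‖ ≤ 36 * q := by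
  have hs' : ‖s - 2‖ ≤ 3 / 2 := by simpa [dist_eq] using hs
  have hre : 1 / 2 ≤ s.re := by
    have := (abs_le.1 ((Complex.abs_re_le_norm (s - 2)).trans hs')).1
    simp at this; linarith
  have hn : ‖s‖ ≤ 7 / 2 := by
    have := norm_add_le (s - 2) 2
    simp at this; linarith
  have hq : (1 : ℝ) ≤ q := by exact_mod_cast NeZero.one_le
  have := LF_poly h1 hre
  nlinarith

theorem siegel {ε : ℝ} (hε : 0 < ε) (hε1 : ε ≤ 1) : ∃ c : ℝ, 0 < c ∧ ∀ (q : ℕ) [NeZero q]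
    (χ : DirichletCharacter ℂ q), χ.IsPrimitive → χ ^ 2 = 1 → χ ≠ 1 →
    c * (q : ℝ) ^ (-ε) ≤ ‖LFunction χ 1‖ := by
  obtain ⟨C0, hC0, core⟩ := siegel_core
  -- zeta negative
  obtain ⟨δ, hδ, hζ⟩ : ∃ δ : ℝ, 0 < δ ∧ ∀ x : ℝ, 1 - δ ≤ x → x < 1 → (riemannZeta x).re ≤ 0 := by
    have hc : Continuous fun x : ℝ => (LFunctionTrivChar₁ 1 (x : ℂ)).re :=
      continuous_re.comp ((differentiable_LFunctionTrivChar₁ 1).continuous.comp continuous_ofReal)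
    have h1 : ∀ᶠ x : ℝ in 𝓝 1, 0 < (LFunctionTrivChar₁ 1 (x : ℂ)).re :=
      hc.continuousAt.eventually (lt_mem_nhds (by simp))
    obtain ⟨δ, hδ, h⟩ := Metric.eventually_nhds_iff.1 h1
    refine ⟨δ / 2, by positivity, fun x hx hx1 => ?_⟩
    have h2 := h (y := x) (by rw [Real.dist_eq, abs_lt]; constructor <;> linarith)
    have hne : (x : ℂ) ≠ 1 := by exact_mod_cast hx1.ne
    rw [LFunctionTrivChar₁, Function.update_of_ne hne] at h2
    simp only [LFunctionTrivChar, LFunction_modOne_eq] at h2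
    rw [show ((x : ℂ) - 1) = ((x - 1 : ℝ) : ℂ) by push_cast; rfl, re_ofReal_mul] at h2
    by_contra hcon
    push Not at hcon
    nlinarith
  by_cases hcase : ∃ (q1 : ℕ) (_ : NeZero q1) (ψ : DirichletCharacter ℂ q1) (β : ℝ), ψ ^ 2 = 1 ∧
    ψ ≠ 1 ∧ 1 - ε / 48 ≤ β ∧ β < 1 ∧ LFunction ψ β = 0
  · obtain ⟨q1, _, ψ, β, hψ2, hψ, hβ, hβ1, hz⟩ := hcase
    obtain ⟨c, hc, hfin⟩ := siegel_fin (q1 + 1)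
    obtain ⟨C, hC, hup⟩ := LF_upper (ε := ε / 4) (by positivity) (by linarith)
    have hq1 : (1 : ℝ) ≤ q1 := by exact_mod_cast NeZero.one_le
    set A : ℝ := 6 * (2 ^ q1 * (C * (2 * q1) ^ (ε / 4)) ^ 2) * (C0 * (36 * q1) ^ 3) ^ (4 * (1 - β))
    have hA : 0 < A := by positivity
    refine ⟨min c ((1 - β) / A), lt_min hc (div_pos (by linarith) hA), ?_⟩
    intro q _ χ hpr hχ2 hχ
    have hq : (1 : ℝ) ≤ q := by exact_mod_cast NeZero.one_le
    rcases Nat.lt_or_ge q (q1 + 1) with hqq | hqq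
    · calc _ ≤ c * 1 := by
            gcongr
            · exact min_le_left _ _
            · exact Real.rpow_le_one_of_one_le_of_nonpos hq (by linarith)
        _ ≤ _ := by rw [mul_one]; exact hfin q χ hqq hχ
    set Q := q1 * q with hQdef
    have d1 : q1 ∣ Q := dvd_mul_right _ _
    have d2 : q ∣ Q := dvd_mul_left _ _
    haveI : NeZero Q := ⟨mul_ne_zero (NeZero.ne q1) (NeZero.ne q)⟩
    set ψ' := changeLevel d1 ψ
    set χ' := changeLevel d2 χ
    have hψ'2 : ψ' ^ 2 = 1 := by simp only [ψ']; rw [← map_pow, hψ2, map_one]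
    have hχ'2 : χ' ^ 2 = 1 := by simp only [χ']; rw [← map_pow, hχ2, map_one]
    have hψ' : ψ' ≠ 1 := fun h => hψ ((changeLevel_eq_one_iff d1).1 h)
    have hχ' : χ' ≠ 1 := fun h => hχ ((changeLevel_eq_one_iff d2).1 h)
    have hpp : χ' * ψ' ≠ 1 := by
      intro h
      have h1 : χ' = ψ' := by
        have : χ' * ψ' * ψ' = ψ' := by rw [h, one_mul]
        rwa [mul_assoc, ← sq, hψ'2, mul_one] at this
      have h2 := conductor_changeLevel (χ := χ) d2
      have h3 := conductor_changeLevel (χ := ψ) d1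
      rw [show changeLevel d2 χ = changeLevel d1 ψ from h1, h3, hpr] at h2
      have := Nat.le_of_dvd (Nat.pos_of_ne_zero (NeZero.ne q1)) (conductor_dvd_level ψ)
      omega
    have hpp2 : (χ' * ψ') ^ 2 = 1 := by rw [mul_pow, hχ'2, hψ'2, one_mul]
    obtain ⟨a, ha0, ha1, hab, haL⟩ := siegel_coef4 hχ'2 hψ'2
    have hQ : (Q : ℝ) = q1 * q := by simp [hQdef]
    have r1 := quad_LF_real hχ'2 hχ' 1
    have r2 := quad_LF_real hψ'2 hψ' 1
    have r3 := quad_LF_real hpp2 hpp 1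
    set l : ℝ := (LFunction χ' (1 : ℝ)).re * (LFunction ψ' (1 : ℝ)).re * (LFunction (χ' * ψ') (1 : ℝ)).re
    have hQ1 : (1 : ℝ) ≤ Q := by exact_mod_cast NeZero.one_le
    have hzβ : LFunction ψ' β = 0 := by
      simp only [ψ']; rw [LFunction_changeLevel d1 ψ (Or.inl hψ), hz, zero_mul]
    have key := core a (fun s => LFunction χ' s * LFunction ψ' s * LFunction (χ' * ψ') s)
      ((36 * Q) ^ 3) β l ha0 ha1 hab
      (((differentiable_LFunction hχ').mul (differentiable_LFunction hψ')).mul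
        (differentiable_LFunction hpp)) haL (by
          simp only [l]; push_cast at r1 r2 r3 ⊢; rw [← r1, ← r2, ← r3])
      (one_le_pow₀ (by linarith)) (fun s hs => by
        rw [norm_mul, norm_mul, show ((36 : ℝ) * Q) ^ 3 = (36 * Q) * (36 * Q) * (36 * Q) by ring]
        gcongr
        exacts [LF_ball hχ' hs, LF_ball hψ' hs, LF_ball hpp hs])
      (by linarith) hβ1 (by simp [hzβ])
    have hup1 : ∀ φ : DirichletCharacter ℂ Q, φ ≠ 1 → ‖LFunction φ 1‖ ≤ C * (2 * Q) ^ (ε / 4) := by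
      intro φ hφ
      have := hup Q φ 1 (Or.inr ⟨hφ, by simp; positivity⟩)
      simpa [rr_zero hφ, VV, mul_comm] using this
    have hchi : ‖LFunction χ' 1‖ ≤ ‖LFunction χ 1‖ * 2 ^ q1 := by
      simp only [χ']
      rw [LFunction_changeLevel d2 χ (Or.inl hχ), norm_mul]
      gcongr
      rw [norm_prod]
      calc _ ≤ ∏ p ∈ Q.primeFactors, (if p ∈ q1.primeFactors then (2 : ℝ) else 1) := by
            refine Finset.prod_le_prod (fun _ _ => norm_nonneg _) fun p hp => ?_
            have hpp := Nat.prime_of_mem_primeFactors hp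
            split_ifs with hp1
            · refine (norm_sub_le _ _).trans ?_
              rw [norm_one, norm_mul]
              have h1 : ‖χ p‖ ≤ 1 := χ.norm_le_one _
              have h2 : ‖(p : ℂ) ^ (-1 : ℂ)‖ ≤ 1 := by
                rw [cpow_neg_one, norm_inv, Complex.norm_natCast]
                exact inv_le_one_of_one_le₀ (by exact_mod_cast hpp.one_le)
              nlinarith [norm_nonneg (χ p), norm_nonneg ((p : ℂ) ^ (-1 : ℂ))]
            · have : p ∣ q := by
                rcases hpp.dvd_mul.1 (Nat.dvd_of_mem_primeFactors hp) with h | h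
                · exact absurd (Nat.mem_primeFactors.2 ⟨hpp, h, NeZero.ne q1⟩) hp1
                · exact h
              have h0 : χ (p : ZMod q) = 0 := by
                apply χ.map_nonunit
                rw [ZMod.isUnit_iff_coprime]
                intro hco
                exact hpp.one_lt.ne' (Nat.Coprime.eq_one_of_dvd hco this)
              simp [h0]
        _ ≤ ∏ p ∈ Q.primeFactors.filter (· ∈ q1.primeFactors), (2 : ℝ) := by
            rw [Finset.prod_filter]
        _ = 2 ^ (Q.primeFactors.filter (· ∈ q1.primeFactors)).card := by simp
        _ ≤ 2 ^ q1 := by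
            refine pow_le_pow_right₀ (by norm_num) ?_
            refine (Finset.card_le_card (t := Finset.Icc 1 q1) fun p hp => ?_).trans (by simp)
            have h1 := (Finset.mem_filter.1 hp).2
            exact Finset.mem_Icc.2 ⟨(Nat.prime_of_mem_primeFactors h1).one_le,
              Nat.le_of_mem_primeFactors h1⟩
    have hl : l ≤ ‖LFunction χ 1‖ * 2 ^ q1 * (C * (2 * Q) ^ (ε / 4)) * (C * (2 * Q) ^ (ε / 4)) := by
      have hn : l ≤ ‖LFunction χ' 1‖ * ‖LFunction ψ' 1‖ * ‖LFunction (χ' * ψ') 1‖ := by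
        refine (le_abs_self l).trans ?_
        simp only [l, abs_mul]
        rw [ofReal_one]
        gcongr <;> exact Complex.abs_re_le_norm _
      refine hn.trans ?_
      gcongr
      exacts [hup1 _ hψ', hup1 _ hpp]
    set x := ‖LFunction χ 1‖
    have e1 : (2 * (Q : ℝ)) ^ (ε / 4) = (2 * q1) ^ (ε / 4) * (q : ℝ) ^ (ε / 4) := by
      rw [hQ, ← mul_assoc, Real.mul_rpow (by positivity) (by positivity)]
    have e2 : (C0 * (36 * (Q : ℝ)) ^ 3) ^ (4 * (1 - β)) =
        (C0 * (36 * q1) ^ 3) ^ (4 * (1 - β)) * (q : ℝ) ^ (3 * (4 * (1 - β))) := by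
      rw [hQ, show C0 * (36 * ((q1 : ℝ) * q)) ^ 3 = (C0 * (36 * q1) ^ 3) * q ^ 3 by ring,
        Real.mul_rpow (by positivity) (by positivity), Real.rpow_mul (by positivity) 3]
      norm_num
    have e3 : (q : ℝ) ^ (3 * (4 * (1 - β))) ≤ (q : ℝ) ^ (ε / 4) :=
      Real.rpow_le_rpow_of_exponent_le hq (by linarith)
    have e4 : (q : ℝ) ^ (ε / 4) * (q : ℝ) ^ (ε / 4) * (q : ℝ) ^ (ε / 4) ≤ (q : ℝ) ^ ε := by
      rw [← Real.rpow_add (by linarith), ← Real.rpow_add (by linarith)]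
      exact Real.rpow_le_rpow_of_exponent_le hq (by linarith)
    have fin : 1 - β ≤ x * A * (q : ℝ) ^ ε := by
      refine key.trans ?_
      rw [e2]
      calc _ ≤ 6 * (x * 2 ^ q1 * (C * (2 * Q) ^ (ε / 4)) * (C * (2 * Q) ^ (ε / 4))) *
            ((C0 * (36 * q1) ^ 3) ^ (4 * (1 - β)) * (q : ℝ) ^ (ε / 4)) := by gcongr
        _ = x * A * ((q : ℝ) ^ (ε / 4) * (q : ℝ) ^ (ε / 4) * (q : ℝ) ^ (ε / 4)) := by
            rw [e1]; simp only [A]; ring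
        _ ≤ _ := by gcongr
    rw [Real.rpow_neg (by linarith), ← div_eq_mul_inv, div_le_iff₀ (by positivity)]
    refine (min_le_right _ _).trans ?_
    rw [div_le_iff₀ hA]; linarith
  · push Not at hcase
    set β : ℝ := 1 - min (ε / 48) (min δ (1 / 8))
    have hb1 : 1 - ε / 48 ≤ β := by simp only [β]; linarith [min_le_left (ε / 48) (min δ (1 / 8))]
    have hb2 : 1 - δ ≤ β := by
      simp only [β]; linarith [min_le_right (ε / 48) (min δ (1 / 8)), min_le_left δ (1 / 8 : ℝ)]
    have hb3 : 7 / 8 ≤ β := by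
      simp only [β]; linarith [min_le_right (ε / 48) (min δ (1 / 8)), min_le_right δ (1 / 8 : ℝ)]
    have hb4 : β < 1 := by
      have : 0 < min (ε / 48) (min δ (1 / 8)) := lt_min (by positivity) (lt_min hδ (by norm_num))
      simp only [β]; linarith
    set A : ℝ := 6 * (C0 * 36) ^ (4 * (1 - β))
    have hA : 0 < A := by positivity
    refine ⟨(1 - β) / A, div_pos (by linarith) hA, ?_⟩
    intro q _ χ hpr hχ2 hχ
    have hq : (1 : ℝ) ≤ q := by exact_mod_cast NeZero.one_le
    obtain ⟨a, ha0, ha1, hab, haL⟩ := siegel_coef2 hχ2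
    have r1 := quad_LF_real hχ2 hχ 1
    have hpos := quad_LF_pos hχ2 hχ (β := β) (fun x hx hx1 =>
      hcase q inferInstance χ x hχ2 hχ (hb1.trans hx) hx1) hb4 β le_rfl (by linarith)
    have key := core a (LFunction χ) (36 * q) β (LFunction χ (1 : ℝ)).re ha0 ha1 hab
      (differentiable_LFunction hχ) haL (by push_cast at r1 ⊢; exact r1) (by linarith)
      (fun s hs => LF_ball hχ hs) hb3 hb4 (by
        rw [quad_LF_real hχ2 hχ β, re_mul_ofReal]
        nlinarith [hζ β hb2 hb4])
    have hl : (LFunction χ (1 : ℝ)).re ≤ ‖LFunction χ 1‖ := by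
      rw [ofReal_one]; exact re_le_norm _
    set x := ‖LFunction χ 1‖
    have fin : 1 - β ≤ x * A * (q : ℝ) ^ ε := by
      refine key.trans ?_
      rw [← mul_assoc, Real.mul_rpow (by positivity) (by positivity)]
      have e3 : (q : ℝ) ^ (4 * (1 - β)) ≤ (q : ℝ) ^ ε :=
        Real.rpow_le_rpow_of_exponent_le hq (by linarith)
      calc _ ≤ 6 * x * ((C0 * 36) ^ (4 * (1 - β)) * (q : ℝ) ^ ε) := by gcongr
        _ = _ := by simp only [A]; ring
    rw [Real.rpow_neg (by linarith), ← div_eq_mul_inv, div_le_iff₀ (by positivity), div_le_iff₀ hA]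
    linarith
end

section
open Complex MeasureTheory Filter Topology Asymptotics DirichletCharacter

lemma LF_deriv {ε : ℝ} (hε : 0 < ε) (hε1 : ε ≤ 1) : ∃ C : ℝ, 1 ≤ C ∧ ∀ (q : ℕ) [NeZero q]
    (χ : DirichletCharacter ℂ q) (s : ℂ), χ ≠ 1 → 1 - ε / 16 ≤ s.re →
    ‖deriv (LFunction χ) s‖ ≤ C * VV q s ^ ε := by
  obtain ⟨C, hC, h⟩ := LF_upper hε hε1
  refine ⟨2 * C / (ε / 16), ?_, fun q _ χ s hχ hs => ?_⟩
  · rw [le_div_iff₀ (by positivity)]; linarith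
  have hV := VV_ge (q := q) s
  have := norm_deriv_le_of_forall_mem_sphere_norm_le (c := s) (R := ε / 16) (C := C * (2 * VV q s) ^ ε)
    (f := LFunction χ) (by positivity) (differentiable_LFunction hχ).diffContOnCl (fun z hz => by
      have hz' : ‖z - s‖ = ε / 16 := by simpa [dist_eq] using hz
      have h1 := (abs_le.1 ((abs_re_le_norm (z - s)).trans hz'.le)).1
      have h2 := ((abs_im_le_norm (z - s)).trans hz'.le)
      simp only [sub_re, sub_im] at h1 h2
      have := h q χ z (Or.inr ⟨hχ, by linarith⟩)
      simp only [rr_zero hχ, norm_zero, zero_div, add_zero, mul_one] at this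
      refine this.trans ?_
      gcongr
      · linarith [VV_ge (q := q) z]
      · unfold VV
        have h3 : |z.im| ≤ |s.im| + 1 := by
          have := abs_sub_abs_le_abs_sub z.im s.im; linarith
        have hq : (0 : ℝ) ≤ q := by positivity
        nlinarith [abs_nonneg s.im])
  refine this.trans ?_
  rw [Real.mul_rpow (by norm_num) (by linarith)]
  have h2 : (2 : ℝ) ^ ε ≤ 2 := by
    calc (2 : ℝ) ^ ε ≤ 2 ^ (1 : ℝ) := Real.rpow_le_rpow_of_exponent_le (by norm_num) hε1
      _ = 2 := by simp
  rw [div_mul_eq_mul_div]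
  have : 0 ≤ VV q s ^ ε := by positivity
  refine div_le_div_of_nonneg_right ?_ (by positivity)
  calc C * (2 ^ ε * VV q s ^ ε) ≤ C * (2 * VV q s ^ ε) := by gcongr
    _ = _ := by ring

lemma LF_mvt {ε : ℝ} (hε : 0 < ε) (hε1 : ε ≤ 1) : ∃ C : ℝ, 1 ≤ C ∧ ∀ (q : ℕ) [NeZero q]
    (χ : DirichletCharacter ℂ q) (s s' : ℂ), χ ≠ 1 → 1 - ε / 16 ≤ s.re → 1 - ε / 16 ≤ s'.re →
    |s'.im| ≤ |s.im| →
    ‖deriv (LFunction χ) s‖ ≤ C * VV q s ^ ε ∧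
    ‖LFunction χ s - LFunction χ s'‖ ≤ C * VV q s ^ ε * ‖s - s'‖ := by
  obtain ⟨C, hC, h⟩ := LF_deriv hε hε1
  refine ⟨C, hC, fun q _ χ s s' hχ hs hs' hi => ⟨h q χ s hχ hs, ?_⟩⟩
  have hS : Convex ℝ ({z : ℂ | 1 - ε / 16 ≤ z.re} ∩ {z : ℂ | -|s.im| ≤ z.im} ∩
      {z : ℂ | z.im ≤ |s.im|}) :=
    ((convex_halfSpace_re_ge _).inter (convex_halfSpace_im_ge _)).inter (convex_halfSpace_im_le _)
  refine hS.norm_image_sub_le_of_norm_deriv_le (𝕜 := ℂ) (f := LFunction χ)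
    (fun z _ => differentiable_LFunction hχ z) (fun z hz => ?_)
    ⟨⟨hs', (abs_le.1 hi).1⟩, (abs_le.1 hi).2⟩ ⟨⟨hs, neg_abs_le s.im⟩, le_abs_self s.im⟩
  refine (h q χ z hχ hz.1.1).trans ?_
  have := VV_ge (q := q) z
  gcongr
  have a1 : -|s.im| ≤ z.im := hz.1.2
  have a2 : z.im ≤ |s.im| := hz.2
  have a3 := abs_le.2 ⟨a1, a2⟩
  exact mul_le_mul_of_nonneg_left (by linarith) (by positivity)

lemma LF_341 {ε : ℝ} (hε : 0 < ε) (hε1 : ε ≤ 1) : ∃ c : ℝ, 0 < c ∧ ∀ (q : ℕ) [NeZero q]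
    (χ : DirichletCharacter ℂ q) (x t r : ℝ), 0 < x → x ≤ 1 → 0 < r → r ≤ 1 →
    (χ ^ 2 ≠ 1 ∨ r ≤ ‖(x + 2 * I * t : ℂ)‖) →
    c * x ^ 3 * r ≤ (‖LFunction χ (1 + x + I * t)‖ * (q * (|t| + 2)) ^ ε) ^ 4 := by
  obtain ⟨C, hC, h⟩ := LF_upper hε hε1
  refine ⟨1 / (32 * C ^ 4), by positivity, fun q _ χ x t r hx hx1 hr hr1 hcase => ?_⟩
  have hq : (1 : ℝ) ≤ q := by exact_mod_cast NeZero.one_le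
  set V : ℝ := q * (|t| + 2)
  have hV : 2 ≤ V := by simp only [V]; nlinarith [abs_nonneg t]
  have hVe : 0 < V ^ ε := by positivity
  have p := norm_LFunction_product_ge_one χ hx t
  rw [norm_mul, norm_mul, norm_pow, norm_pow] at p
  have b0 : ‖LFunctionTrivChar q (1 + x)‖ ≤ C * V ^ ε * (2 / x) := by
    refine (h q 1 (1 + x) (Or.inl (by simp [hx]))).trans ?_
    have : VV q (1 + (x : ℂ)) ≤ V := by
      simp [VV, V]; gcongr; linarith [abs_nonneg t]
    have h0 := VV_ge (q := q) (1 + (x : ℂ))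
    have h1 : 1 + ‖rr (1 : DirichletCharacter ℂ q)‖ / ‖(1 + (x : ℂ)) - 1‖ ≤ 2 / x := by
      rw [show (1 + (x : ℂ)) - 1 = x by ring, norm_real, Real.norm_of_nonneg hx.le,
        le_div_iff₀ hx, add_mul, div_mul_cancel₀ _ hx.ne']
      linarith [rr_norm (1 : DirichletCharacter ℂ q)]
    gcongr
  have b2 : ‖LFunction (χ ^ 2) (1 + x + 2 * I * t)‖ ≤ C * (2 * V ^ ε) * (2 / r) := by
    refine (h q (χ ^ 2) _ (Or.inl (by simp [hx]))).trans ?_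
    have h0 := VV_ge (q := q) (1 + x + 2 * I * (t : ℂ))
    have h1 : VV q (1 + x + 2 * I * (t : ℂ)) ≤ 2 * V := by
      simp only [VV, V]
      rw [show (1 + x + 2 * I * (t : ℂ)).im = 2 * t by simp, abs_mul, abs_two]
      nlinarith [abs_nonneg t]
    have h2 : VV q (1 + x + 2 * I * (t : ℂ)) ^ ε ≤ 2 * V ^ ε := by
      calc _ ≤ (2 * V) ^ ε := by gcongr
        _ = 2 ^ ε * V ^ ε := by rw [Real.mul_rpow (by norm_num) (by linarith)]
        _ ≤ 2 ^ (1 : ℝ) * V ^ ε := by gcongr; norm_num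
        _ = _ := by simp
    have h3 : 1 + ‖rr (χ ^ 2)‖ / ‖(1 + x + 2 * I * (t : ℂ)) - 1‖ ≤ 2 / r := by
      have hr2 : 1 ≤ 1 / r := by rw [le_div_iff₀ hr]; linarith
      have : ‖rr (χ ^ 2)‖ / ‖(1 + x + 2 * I * (t : ℂ)) - 1‖ ≤ 1 / r := by
        rcases hcase with hc | hc
        · rw [rr_zero hc]; simp; positivity
        · rw [show (1 + x + 2 * I * (t : ℂ)) - 1 = x + 2 * I * t by ring]
          gcongr
          exact rr_norm _
      rw [show 2 / r = 1 / r + 1 / r by ring]; linarith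
    gcongr
  set y := ‖LFunction χ (1 + x + I * t)‖
  have p2 : 1 ≤ (C * V ^ ε * (2 / x)) ^ 3 * y ^ 4 * (C * (2 * V ^ ε) * (2 / r)) := by
    refine p.le.trans ?_
    gcongr
  have e : (C * V ^ ε * (2 / x)) ^ 3 * y ^ 4 * (C * (2 * V ^ ε) * (2 / r)) =
    (y * V ^ ε) ^ 4 * (32 * C ^ 4) / (x ^ 3 * r) := by field_simp; ring
  rw [e, le_div_iff₀ (by positivity)] at p2
  rw [one_div, mul_assoc, inv_mul_le_iff₀ (by positivity)]
  linarith

theorem zero_free {ε : ℝ} (hε : 0 < ε) (hε1 : ε ≤ 1) : ∃ c : ℝ, 0 < c ∧ c ≤ 1 ∧ ∀ (q : ℕ) [NeZero q]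
    (χ : DirichletCharacter ℂ q) (s : ℂ), χ.IsPrimitive → χ ≠ 1 → 1 - c * VV q s ^ (-ε) ≤ s.re →
    s.re ≤ 2 → LFunction χ s ≠ 0 ∧ ‖deriv (LFunction χ) s / LFunction χ s‖ ≤ c⁻¹ * VV q s ^ ε := by
  set e := ε / 12 with he
  have he0 : 0 < e := by positivity
  have he1 : e ≤ 1 := by rw [he]; linarith
  obtain ⟨C, hC, hmv⟩ := LF_mvt he0 he1
  obtain ⟨c1, hc1, h341⟩ := LF_341 he0 he1
  obtain ⟨c2, hc2, hS⟩ := siegel he0 he1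
  set κ := min (c2 / (4 * C)) (e / 32)
  have hκ : 0 < κ := lt_min (by positivity) (by positivity)
  have hκ1 : κ ≤ e / 32 := min_le_right _ _
  have hκ2 : 4 * C * κ ≤ c2 := by
    have : κ ≤ c2 / (4 * C) := min_le_left _ _
    rw [le_div_iff₀ (by positivity)] at this; linarith
  set c3 := min 1 (c1 * κ)
  have hc3 : 0 < c3 := lt_min one_pos (by positivity)
  have hc31 : c3 ≤ 1 := min_le_left _ _
  have hc3' : c3 ^ 4 ≤ c1 * κ := by
    have : c3 ≤ c1 * κ := min_le_right _ _
    calc c3 ^ 4 = c3 ^ 3 * c3 := by ring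
      _ ≤ 1 * c3 := by gcongr; exact pow_le_one₀ hc3.le hc31
      _ ≤ _ := by linarith
  set κ3 := min κ (c3 / (4 * C))
  have hκ3 : 0 < κ3 := lt_min hκ (by positivity)
  have hκ3κ : κ3 ≤ κ := min_le_left _ _
  have hκ31 : κ3 ≤ 1 := by linarith
  have hκ3' : 4 * C * κ3 ≤ c3 := by
    have : κ3 ≤ c3 / (4 * C) := min_le_right _ _
    rw [le_div_iff₀ (by positivity)] at this; linarith
  set cl := min (c2 / 2) (c3 * κ3 ^ 3 / 2)
  have hcl : 0 < cl := lt_min (by positivity) (by positivity)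
  refine ⟨min (κ3 ^ 4) (cl / C), lt_min (by positivity) (by positivity),
    (min_le_left _ _).trans (pow_le_one₀ hκ3.le hκ31), ?_⟩
  intro q _ χ s hpr hχ hs hs2
  have hq : (1 : ℝ) ≤ q := by exact_mod_cast NeZero.one_le
  have hV := VV_ge (q := q) s
  set V := VV q s with hVdef
  have hV1 : 1 ≤ V := by linarith
  set W := V ^ e
  have hW1 : 1 ≤ W := Real.one_le_rpow hV1 he0.le
  have hW : V ^ ε = W ^ 12 := by
    simp only [W]; rw [← Real.rpow_mul_natCast (by linarith), he]; congr 1; push_cast; ring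
  rw [Real.rpow_neg (by linarith), hW] at hs
  rw [hW]
  set x0 := κ3 ^ 4 / W ^ 12
  have hx0 : 0 < x0 := by positivity
  have hs' : 1 - x0 ≤ s.re := by
    have : min (κ3 ^ 4) (cl / C) * (W ^ 12)⁻¹ ≤ x0 := by
      simp only [x0]; rw [div_eq_mul_inv (κ3 ^ 4)]
      exact mul_le_mul_of_nonneg_right (min_le_left _ _) (by positivity)
    linarith
  set r := κ / W ^ 2
  have hr : 0 < r := by positivity
  have hrκ : r ≤ κ := div_le_self hκ.le (one_le_pow₀ hW1)
  have hx0r : x0 ≤ r := by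
    simp only [x0, r]
    have h1 : κ3 ^ 4 ≤ κ := by
      calc κ3 ^ 4 = κ3 ^ 3 * κ3 := by ring
        _ ≤ 1 * κ := by gcongr; exact pow_le_one₀ hκ3.le hκ31
        _ = κ := one_mul _
    gcongr
    norm_num
  have hre : 1 - e / 16 ≤ s.re := by linarith
  have hder := (hmv q χ s 1 hχ hre (by simp; positivity) (by simp)).1
  have hlow : cl / W ^ 11 ≤ ‖LFunction χ s‖ := by
    by_cases hcase : χ ^ 2 = 1 ∧ ‖s - 1‖ ≤ 2 * r
    · have h1 := (hmv q χ s 1 hχ hre (by simp; positivity) (by simp)).2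
      have h2 := hS q χ hpr hcase.1 hχ
      have h3 : c2 / W ≤ ‖LFunction χ 1‖ := by
        refine le_trans ?_ h2
        rw [div_eq_mul_inv]
        simp only [W]
        rw [← Real.rpow_neg (by linarith)]
        have : (q : ℝ) ≤ V := by rw [hVdef]; unfold VV; nlinarith [abs_nonneg s.im]
        gcongr c2 * ?_
        exact Real.rpow_le_rpow_of_nonpos (by linarith) this (by linarith)
      have h4 : C * W * ‖s - 1‖ ≤ (c2 / 2) / W := by
        calc C * W * ‖s - 1‖ ≤ C * W * (2 * r) := by gcongr; exact hcase.2
          _ = (4 * C * κ / 2) / W := by simp only [r]; field_simp; ring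
          _ ≤ _ := by gcongr
      have h5 : (c2 / 2) / W ≤ ‖LFunction χ s‖ := by
        have h6 : ‖LFunction χ 1‖ ≤ ‖LFunction χ s‖ + ‖LFunction χ s - LFunction χ 1‖ := by
          have := norm_sub_norm_le (LFunction χ 1) (LFunction χ s)
          rw [norm_sub_rev] at this; linarith
        have h7 : c2 / W = (c2 / 2) / W + (c2 / 2) / W := by ring
        linarith
      refine le_trans ?_ h5
      gcongr
      · exact min_le_left _ _
      · exact le_self_pow₀ hW1 (by norm_num)
    · set x := max (s.re - 1) x0
      have hx : 0 < x := lt_max_of_lt_right hx0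
      have hx1 : x ≤ 1 := max_le (by linarith) (by linarith)
      have hcond : χ ^ 2 ≠ 1 ∨ r ≤ ‖(x + 2 * I * s.im : ℂ)‖ := by
        by_cases h : χ ^ 2 = 1
        · right
          have h1 : 2 * r < ‖s - 1‖ := by
            by_contra h'; exact hcase ⟨h, by linarith⟩
          have h2 := Complex.norm_le_abs_re_add_abs_im (s - 1)
          simp only [sub_re, one_re, sub_im, one_im, sub_zero] at h2
          rcases le_or_gt r |s.im| with h3 | h3
          · have := abs_im_le_norm (x + 2 * I * s.im : ℂ)
            simp [abs_mul] at this; linarith [abs_nonneg s.im]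
          · have h4 : r < |s.re - 1| := by linarith
            have h5 : r < s.re - 1 := by
              rcases lt_abs.1 h4 with h | h
              · exact h
              · linarith
            have := abs_re_le_norm (x + 2 * I * s.im : ℂ)
            simp at this
            have h6 : s.re - 1 ≤ x := le_max_left _ _
            linarith [le_abs_self x]
        · exact Or.inl h
      have h1 := h341 q χ x s.im r hx hx1 hr (by linarith) hcond
      set s' : ℂ := 1 + x + I * s.im
      have hle : x0 ≤ x := le_max_right _ _
      have h2 : c3 * κ3 ^ 3 / W ^ 11 ≤ ‖LFunction χ s'‖ := by
        have h3 : (c3 * κ3 ^ 3 / W ^ 10) ^ 4 ≤ (‖LFunction χ s'‖ * W) ^ 4 := by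
          refine le_trans ?_ h1
          calc (c3 * κ3 ^ 3 / W ^ 10) ^ 4 = c3 ^ 4 * κ3 ^ 12 / W ^ 40 := by
                field_simp
            _ ≤ (c1 * κ) * κ3 ^ 12 / W ^ 38 := by
                gcongr
                norm_num
            _ = c1 * x0 ^ 3 * r := by simp only [x0, r]; field_simp
            _ ≤ _ := by gcongr
        have h4 := le_of_pow_le_pow_left₀ (by norm_num) (by positivity) h3
        rw [← div_le_iff₀ (by linarith)] at h4
        refine le_trans (le_of_eq ?_) h4
        field_simp
      have hsre : s'.re = 1 + x := by simp [s']
      have hsim : s'.im = s.im := by simp [s']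
      have h3 := (hmv q χ s s' hχ hre (by rw [hsre]; linarith) (by rw [hsim])).2
      have h4 : ‖s - s'‖ ≤ 2 * x0 := by
        have e1 : s - s' = ((s.re - 1 - x : ℝ) : ℂ) := by
          apply Complex.ext
          · simp [hsre]; ring
          · simp [hsim]
        rw [e1, norm_real, Real.norm_eq_abs, abs_le]
        have h6 : s.re - 1 ≤ x := le_max_left _ _
        have h7 : x ≤ s.re - 1 + 2 * x0 := max_le (by linarith) (by linarith)
        constructor <;> linarith
      have h5 : C * W * ‖s - s'‖ ≤ c3 * κ3 ^ 3 / 2 / W ^ 11 := by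
        calc C * W * ‖s - s'‖ ≤ C * W * (2 * x0) := by gcongr
          _ = (4 * C * κ3) * κ3 ^ 3 / 2 / W ^ 11 := by simp only [x0]; field_simp; ring
          _ ≤ _ := by gcongr
      have h6 : ‖LFunction χ s'‖ ≤ ‖LFunction χ s‖ + ‖LFunction χ s - LFunction χ s'‖ := by
        have := norm_sub_norm_le (LFunction χ s') (LFunction χ s)
        rw [norm_sub_rev] at this; linarith
      have h7 : c3 * κ3 ^ 3 / W ^ 11 = c3 * κ3 ^ 3 / 2 / W ^ 11 + c3 * κ3 ^ 3 / 2 / W ^ 11 := by ring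
      have h8 : cl / W ^ 11 ≤ c3 * κ3 ^ 3 / 2 / W ^ 11 := by gcongr; exact min_le_right _ _
      linarith
  have hpos : 0 < ‖LFunction χ s‖ := lt_of_lt_of_le (by positivity) hlow
  refine ⟨norm_pos_iff.1 hpos, ?_⟩
  rw [norm_div]
  calc _ ≤ (C * W) / (cl / W ^ 11) := by gcongr
    _ = (cl / C)⁻¹ * W ^ 12 := by field_simp
    _ ≤ _ := by
        gcongr
        exact min_le_right _ _
end

section
open Complex MeasureTheory Filter Topology Asymptotics DirichletCharacter

lemma ker_bd {c : ℝ} (hc : 0 < c) (t : ℝ) :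
    min c 1 * (1 + t ^ 2) ≤ ‖((c + t * I : ℂ)) * (c + t * I + 1)‖ := by
  have h1 : ‖(c + t * I : ℂ)‖ ^ 2 = c ^ 2 + t ^ 2 := by
    rw [Complex.sq_norm, normSq_apply]; simp; ring
  have h2 : ‖(c + t * I + 1 : ℂ)‖ ^ 2 = (c + 1) ^ 2 + t ^ 2 := by
    rw [Complex.sq_norm, normSq_apply]; simp; ring
  rw [norm_mul]
  have hm : 0 < min c 1 := lt_min hc one_pos
  have hm1 : min c 1 ≤ c := min_le_left _ _
  have hm2 : min c 1 ≤ 1 := min_le_right _ _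
  refine abs_le_of_sq_le_sq' ?_ (by positivity) |>.2
  rw [mul_pow, mul_pow, h1, h2, sq (1 + t ^ 2), ← mul_assoc]
  gcongr
  · have a : min c 1 ^ 2 ≤ c ^ 2 := by gcongr
    have b : min c 1 ^ 2 * t ^ 2 ≤ 1 * t ^ 2 := by gcongr; nlinarith
    linarith
  · nlinarith

lemma ker_int {c : ℝ} (hc : 0 < c) :
    Integrable (fun t : ℝ => (1 : ℂ) / ((c + t * I) * (c + t * I + 1))) := by
  have hne : ∀ t : ℝ, ((c + t * I : ℂ)) * (c + t * I + 1) ≠ 0 := fun t => by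
    rw [← norm_pos_iff]; have := ker_bd hc t; have := lt_min hc one_pos
    exact lt_of_lt_of_le (by positivity) (ker_bd hc t)
  refine (integrable_inv_one_add_sq.const_mul (min c 1)⁻¹).mono'
    (Continuous.aestronglyMeasurable ?_) (.of_forall fun t => ?_)
  · exact continuous_const.div (by fun_prop) hne
  · rw [norm_div, norm_one, ← mul_inv, one_div]
    have := lt_min hc one_pos
    exact inv_anti₀ (by positivity) (ker_bd hc t)

lemma MF {c y : ℝ} (hc : 0 < c) (hy : 0 < y) :
    ∫ t : ℝ, (y : ℂ) ^ (c + t * I) * (1 / ((c + t * I) * (c + t * I + 1))) =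
      (2 * Real.pi * max 0 (1 - y⁻¹) : ℝ) := by
  set f : ℝ → ℂ := fun x => (Set.Ioc 0 1).indicator (fun _ => 1 : ℝ → ℂ) x -
    (Set.Ioc 0 1).indicator (fun t => ↑t ^ (1 : ℂ) : ℝ → ℂ) x with hf
  have hM : ∀ s : ℂ, 0 < s.re → HasMellin f s (1 / (s * (s + 1))) := fun s hs => by
    have h1 := hasMellin_one_Ioc hs
    have h2 := hasMellin_cpow_Ioc 1 (s := s) (by simp; linarith)
    have h3 := hasMellin_sub h1.1 h2.1
    rw [h1.2, h2.2] at h3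
    have a1 : s ≠ 0 := by rintro rfl; simp at hs
    have a2 : s + 1 ≠ 0 := fun h => by
      have := congrArg re h; simp at this; linarith
    rw [show 1 / (s * (s + 1)) = 1 / s - 1 / (s + 1) by field_simp; ring]
    exact h3
  have hfx : ∀ x : ℝ, 0 < x → f x = (max 0 (1 - x) : ℝ) := fun x hx => by
    by_cases h : x ≤ 1
    · simp [hf, hx, h]
    · have : 1 - x ≤ 0 := by linarith
      simp [hf, h, this]
  have hfc : ContinuousAt f y⁻¹ := by
    have : ContinuousAt (fun x : ℝ => ((max 0 (1 - x) : ℝ) : ℂ)) y⁻¹ := by fun_prop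
    refine this.congr ?_
    filter_upwards [lt_mem_nhds (inv_pos.2 hy)] with x hx using (hfx x hx).symm
  have hmel : ∀ t : ℝ, mellin f (c + t * I) = 1 / ((c + t * I) * (c + t * I + 1)) :=
    fun t => (hM _ (by simpa using hc)).2
  have := mellinInv_mellin_eq c f (inv_pos.2 hy) (hM _ (by simpa using hc)).1
    (by unfold VerticalIntegrable; simp_rw [hmel]; exact ker_int hc) hfc
  rw [hfx _ (inv_pos.2 hy), mellinInv] at this
  simp_rw [hmel] at this
  have e : ∀ t : ℝ, ((y⁻¹ : ℝ) : ℂ) ^ (-(c + t * I : ℂ)) = (y : ℂ) ^ (c + t * I : ℂ) := fun t => by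
    rw [ofReal_inv, Complex.inv_cpow _ _ (by rw [arg_ofReal_of_nonneg hy.le]; exact Real.pi_pos.ne),
      Complex.cpow_neg, inv_inv]
  simp_rw [e, smul_eq_mul] at this
  rw [ofReal_mul, ← this, Complex.real_smul]
  push_cast
  rw [← mul_assoc, mul_one_div_cancel, one_mul]
  simp [Real.pi_ne_zero]
end

section
open Complex MeasureTheory Filter Topology Asymptotics DirichletCharacter

lemma FI {g : ℂ → ℂ} {k : ℕ} {h b ρ : ℝ → ℝ} (hi : Integrable h) (hρ : ∀ t, 0 < ρ t)
    (hρ1 : ∀ t, ρ t ≤ 1) (hd : ∀ t : ℝ, DifferentiableOn ℂ g (Metric.closedBall (t : ℂ) (ρ t)))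
    (hb : ∀ t : ℝ, ∀ z ∈ Metric.closedBall (t : ℂ) (ρ t), ‖g z‖ ≤ b t)
    (hh : ∀ t, b t / ρ t ^ k ≤ h t) (y : ℝ) :
    |y| ^ k * ‖∫ t : ℝ, g t * cexp (t * y * I)‖ ≤ k.factorial * ∫ t, h t := by
  have hb0 : ∀ t, 0 ≤ b t := fun t => (norm_nonneg _).trans
    (hb t t (Metric.mem_closedBall_self (hρ t).le))
  have ha : ∀ t : ℝ, AnalyticAt ℂ g t := fun t =>
    (hd t).analyticAt (Metric.closedBall_mem_nhds _ (hρ t))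
  have hit : ∀ n, iteratedDeriv n (fun t : ℝ => g t) = fun t : ℝ => iteratedDeriv n g t := by
    intro n
    induction n with
    | zero => simp
    | succ n ih =>
      rw [iteratedDeriv_succ, ih]
      ext t
      rw [iteratedDeriv_succ]
      have h1 : AnalyticAt ℂ (iteratedDeriv n g) t := by
        rw [iteratedDeriv_eq_iterate]; exact (ha t).iterated_deriv n
      exact h1.differentiableAt.hasDerivAt.comp_ofReal.deriv
  have hcd : ContDiff ℝ (k : ℕ∞) (fun t : ℝ => g t) := by
    rw [contDiff_iff_contDiffAt]; intro t
    have := ((ha t).restrictScalars (𝕜 := ℝ)).comp_of_eq (ofRealCLM.analyticAt t) rfl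
    exact this.contDiffAt
  have hbd : ∀ n ≤ k, ∀ t : ℝ, ‖iteratedDeriv n g t‖ ≤ k.factorial * h t := by
    intro n hn t
    refine (norm_iteratedDeriv_le_of_forall_mem_sphere_norm_le (C := b t) n (hρ t)
      ((hd t).diffContOnCl_ball subset_rfl)
      fun z hz => hb t z (Metric.sphere_subset_closedBall hz)).trans ?_
    rw [mul_div_assoc]
    have h1 : b t / ρ t ^ n ≤ h t := (div_le_div_of_nonneg_left (hb0 t)
      (pow_pos (hρ t) _) (pow_le_pow_of_le_one (hρ t).le (hρ1 t) hn)).trans (hh t)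
    have h2 : (0 : ℝ) ≤ b t / ρ t ^ n := div_nonneg (hb0 t) (pow_pos (hρ t) _).le
    gcongr
  have hint : ∀ n : ℕ, (n : ℕ∞) ≤ (k : ℕ∞) → Integrable (iteratedDeriv n (fun t : ℝ => g t)) := by
    intro n hn
    refine (hi.const_mul (k.factorial : ℝ)).mono' ?_ (.of_forall fun t => ?_)
    · exact (hcd.continuous_iteratedDeriv n (by exact_mod_cast hn)).aestronglyMeasurable
    · rw [hit]; exact hbd n (by exact_mod_cast hn) t
  have key := congrFun (Real.fourier_iteratedDeriv hcd hint le_rfl) (-y / (2 * Real.pi))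
  have e1 : FourierTransform.fourier (fun t : ℝ => g t) (-y / (2 * Real.pi)) =
      ∫ t : ℝ, g t * cexp (t * y * I) := by
    rw [Real.fourier_eq']
    refine integral_congr_ae (.of_forall fun t => ?_)
    simp only [RCLike.inner_apply, conj_trivial, smul_eq_mul]
    rw [mul_comm]; congr 2; push_cast
    have : (Real.pi : ℂ) ≠ 0 := by simp [Real.pi_ne_zero]
    field_simp
  have := congrArg norm key
  rw [norm_smul, e1, norm_pow] at this
  have e2 : ‖(2 * Real.pi * I * ((-y / (2 * Real.pi) : ℝ) : ℂ))‖ = |y| := by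
    have : (2 * Real.pi * I * ((-y / (2 * Real.pi) : ℝ) : ℂ)) = (-y : ℝ) * I := by
      push_cast
      have : (Real.pi : ℂ) ≠ 0 := by simp [Real.pi_ne_zero]
      field_simp
    rw [this, norm_mul, norm_I, mul_one, norm_real, norm_neg, Real.norm_eq_abs]
  rw [e2] at this
  rw [← this, Real.fourier_eq']
  refine (norm_integral_le_of_norm_le (hi.const_mul (k.factorial : ℝ)) (.of_forall fun t => ?_)).trans
    (by rw [integral_const_mul])
  rw [hit, norm_smul]
  have : ‖cexp (((-2 * Real.pi * inner ℝ t (-y / (2 * Real.pi)) : ℝ) : ℂ) * I)‖ = 1 :=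
    norm_exp_ofReal_mul_I _
  rw [this, one_mul]; exact hbd k le_rfl t
end

section
open Complex MeasureTheory Filter Topology Asymptotics DirichletCharacter
open scoped ArithmeticFunction.vonMangoldt

noncomputable def wt (x : ℝ) : ℝ := max 0 (1 - x)
noncomputable def WS (f : ℕ → ℂ) (X : ℝ) : ℂ := ∑ n ∈ Finset.Icc 1 ⌊X⌋₊, f n * (wt (n / X) : ℂ)

lemma perron {f : ℕ → ℂ} {c X : ℝ} (hc : 0 < c) (hX : 0 < X) (hf : LSeriesSummable f c) :
    2 * Real.pi * WS f X = ∫ t : ℝ, (X : ℂ) ^ (c + t * I) * LSeries f (c + t * I) *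
      (1 / ((c + t * I) * (c + t * I + 1))) := by
  have hXc : (X : ℂ) ≠ 0 := by exact_mod_cast hX.ne'
  set K : ℝ → ℂ := fun t => 1 / ((c + t * I) * (c + t * I + 1)) with hK
  set F : ℕ → ℝ → ℂ := fun n t => (X : ℂ) ^ (c + t * I) * LSeries.term f (c + t * I) n * K t with hF
  have hn1 : ∀ n : ℕ, ∀ t : ℝ, ‖LSeries.term f (c + t * I) n‖ = ‖LSeries.term f c n‖ := fun n t => by
    rw [LSeries.norm_term_eq, LSeries.norm_term_eq]; simp
  have hFn : ∀ n t, ‖F n t‖ = X ^ c * ‖LSeries.term f c n‖ * ‖K t‖ := fun n t => by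
    rw [hF]; simp only [norm_mul, hn1]
    rw [norm_cpow_eq_rpow_re_of_pos hX]; simp
  have hm : ∀ n, Continuous fun t : ℝ => LSeries.term f (c + t * I) n := fun n => by
    rcases eq_or_ne n 0 with rfl | hn
    · simp [LSeries.term_zero]; exact continuous_const
    · simp_rw [LSeries.term_of_ne_zero hn]
      have hn' : (n : ℂ) ≠ 0 := by exact_mod_cast hn
      refine continuous_const.div ?_ fun t => by simp [cpow_eq_zero_iff, hn']
      exact Continuous.const_cpow (by fun_prop) (.inl hn')
  have hXm : Continuous fun t : ℝ => (X : ℂ) ^ (c + t * I) :=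
    Continuous.const_cpow (by fun_prop) (.inl hXc)
  have hKi : Integrable K := ker_int hc
  have hFi : ∀ n, Integrable (F n) := fun n => by
    refine (hKi.norm.const_mul (X ^ c * ‖LSeries.term f c n‖)).mono'
      ((hXm.mul (hm n)).aestronglyMeasurable.mul hKi.1) (.of_forall fun t => (hFn n t).le)
  have hs : Summable fun n => ∫ t, ‖F n t‖ := by
    simp_rw [hFn, integral_const_mul]
    exact (hf.norm.mul_left _).mul_right _
  have h := hasSum_integral_of_summable_integral_norm hFi hs
  have h2 : ∀ n, ∫ t, F n t = if n ∈ Finset.Icc 1 ⌊X⌋₊ then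
      2 * Real.pi * (f n * (wt (n / X) : ℂ)) else 0 := fun n => by
    rcases eq_or_ne n 0 with rfl | hn
    · simp [hF]
    have hn0 : (0 : ℝ) < n := by positivity
    have : ∀ t, F n t = f n * (((X / n : ℝ) : ℂ) ^ (c + t * I) * K t) := fun t => by
      rw [hF]; simp only
      rw [LSeries.term_of_ne_zero hn, div_eq_mul_inv X, ofReal_mul, mul_cpow_ofReal_nonneg hX.le
        (by positivity), ofReal_inv, ofReal_natCast, inv_cpow _ _ (by
          rw [natCast_arg]; exact Real.pi_pos.ne)]
      ring
    simp_rw [this, integral_const_mul]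
    rw [MF hc (div_pos hX hn0), inv_div]
    split_ifs with h
    · rw [wt]; push_cast; ring
    · have : X < n := by
        rw [Finset.mem_Icc, not_and] at h
        exact (Nat.floor_lt hX.le).1 (not_le.1 (h (by omega)))
      rw [max_eq_left]
      · simp
      · have := (one_lt_div hX).2 this; linarith
  simp_rw [h2] at h
  have h3 := hasSum_sum_of_ne_finset_zero (L := .unconditional _) (f := fun n => if n ∈ Finset.Icc 1 ⌊X⌋₊ then
      2 * Real.pi * (f n * (wt (n / X) : ℂ)) else 0) (s := Finset.Icc 1 ⌊X⌋₊)
      (fun n hn => if_neg hn)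
  have h4 := h3.unique h
  rw [Finset.sum_congr rfl (fun n hn => if_pos hn), ← Finset.mul_sum] at h4
  rw [WS, h4]
  refine integral_congr_ae (.of_forall fun t => ?_)
  simp only [hF, LSeries, tsum_mul_left, tsum_mul_right, hK]

set_option maxHeartbeats 1000000 in
lemma SW (A B : ℕ) : ∃ C : ℝ, 0 < C ∧ ∀ (q : ℕ) [NeZero q] (χ : DirichletCharacter ℂ q) (X : ℝ),
    χ.IsPrimitive → χ ≠ 1 → 2 ≤ Real.log X → 0 < X → q ≤ Real.log X ^ B →
    ‖WS (fun n => χ n * Λ n) X‖ ≤ C * X / Real.log X ^ A := by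
  set k := A + B with hk
  set ε : ℝ := 1 / (2 * (k + 1)) with hε
  have hε0 : 0 < ε := by positivity
  have hε1 : ε ≤ 1 := by
    rw [hε, div_le_one (by positivity)]; have : (0 : ℝ) ≤ k := by positivity
    linarith
  obtain ⟨c₀, hc0, hc1, hz⟩ := zero_free hε0 hε1
  set J : ℝ := ∫ t : ℝ, (1 + ‖t‖ ^ 2) ^ (-(3 / 2 : ℝ) / 2) with hJ
  have hJi : Integrable (fun t : ℝ => (1 + ‖t‖ ^ 2) ^ (-(3 / 2 : ℝ) / 2)) :=
    integrable_rpow_neg_one_add_norm_sq (by simp; norm_num)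
  have hJ0 : 0 ≤ J := integral_nonneg fun t => by positivity
  set K0 : ℝ := 8 * c₀⁻¹ * (4 / c₀) ^ k with hK0
  refine ⟨3 * (k.factorial * (K0 * 2 * J)) + 1, by positivity, fun q _ χ X hp hχ hX2 hX hq => ?_⟩
  set y := Real.log X with hy
  have hq1 : (1 : ℝ) ≤ q := by exact_mod_cast NeZero.one_le
  set c : ℝ := 1 + 1 / y with hc
  have hc1' : 1 < c := by rw [hc]; have : 0 < 1 / y := by positivity
                          linarith
  have hc2 : c ≤ 3 / 2 := by
    have : 1 / y ≤ 1 / 2 := by gcongr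
    rw [hc]; linarith
  set V : ℝ → ℝ := fun t => q * (|t| + 2) with hV
  have hV0 : ∀ t, 2 ≤ V t := fun t => by 
    exact (show (2:ℝ) ≤ |t| + 2 by linarith [abs_nonneg t]).trans (le_mul_of_one_le_left (by positivity) hq1)
  have hVe : ∀ t, V t ^ (-ε) ≤ 1 := fun t =>
    Real.rpow_le_one_of_one_le_of_nonpos (by linarith [hV0 t]) (by linarith)
  have hVp : ∀ t, 0 < V t ^ (-ε) := fun t => Real.rpow_pos_of_pos (by linarith [hV0 t]) _
  set ρ : ℝ → ℝ := fun t => c₀ / 4 * V t ^ (-ε) with hρ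
  have hρ0 : ∀ t, 0 < ρ t := fun t => mul_pos (by positivity) (hVp t)
  have hρ1 : ∀ t, ρ t ≤ 1 / 4 := fun t => by
    
    exact (mul_le_mul_of_nonneg_left (hVe t) (by positivity)).trans (by linarith)
  set g : ℂ → ℂ := fun z => -(deriv (LFunction χ) (c + z * I) / LFunction χ (c + z * I)) *
    (1 / ((c + z * I) * (c + z * I + 1))) with hg
  set b : ℝ → ℝ := fun t => c₀⁻¹ * (2 * V t ^ ε) * (4 / (1 + t ^ 2)) with hb
  have main : ∀ t : ℝ, ∀ z ∈ Metric.closedBall (t : ℂ) (ρ t), LFunction χ (c + z * I) ≠ 0 ∧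
      ‖deriv (LFunction χ) (c + z * I) / LFunction χ (c + z * I)‖ ≤ c₀⁻¹ * (2 * V t ^ ε) ∧
      (1 + t ^ 2) / 4 ≤ ‖(c + z * I) * (c + z * I + 1)‖ := by
    intro t z hz'
    rw [Metric.mem_closedBall, dist_eq] at hz'
    have hre : |z.re - t| ≤ ρ t := by simpa using (abs_re_le_norm (z - t)).trans hz'
    have him : |z.im| ≤ ρ t := by simpa using (abs_im_le_norm (z - t)).trans hz'
    have hr4 := hρ1 t
    have hr0 := hρ0 t
    have e1 : (c + z * I).re = c - z.im := by simp [sub_eq_add_neg]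
    have e2 : (c + z * I).im = z.re := by simp
    rw [abs_le] at him
    have hre2 := abs_le.1 hre
    have hVV : VV q (c + z * I) ≤ 2 * V t := by
      rw [VV, e2]; simp only [hV]
      have : |z.re| ≤ |t| + 1 / 4 := by
        have := abs_add_le (z.re - t) t; rw [sub_add_cancel] at this; linarith
      have := mul_le_mul_of_nonneg_left (show |z.re| + 2 ≤ 2 * (|t| + 2) by linarith [abs_nonneg t]) (show (0:ℝ) ≤ q by linarith)
      linarith
    have hVV2 := VV_ge (q := q) (c + z * I)
    have h2e : (2 : ℝ) ^ ε ≤ 2 := by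
      simpa using Real.rpow_le_rpow_of_exponent_le (x := 2) (by norm_num) hε1
    have hVe2 : VV q (c + z * I) ^ ε ≤ 2 * V t ^ ε := by
      calc _ ≤ (2 * V t) ^ ε := by gcongr
        _ = 2 ^ ε * V t ^ ε := Real.mul_rpow (by norm_num) (by linarith [hV0 t])
        _ ≤ _ := by gcongr
    have hVe3 : V t ^ (-ε) / 2 ≤ VV q (c + z * I) ^ (-ε) := by
      rw [Real.rpow_neg (by linarith), Real.rpow_neg (by linarith [hV0 t]), div_eq_mul_inv,
        ← mul_inv, mul_comm]
      exact inv_anti₀ (by positivity) hVe2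
    have := hz q χ (c + z * I) hp hχ (by
      rw [e1]
      have : c₀ * (V t ^ (-ε) / 2) ≤ c₀ * VV q (c + z * I) ^ (-ε) := by gcongr
      have h5 : ρ t = c₀ / 4 * V t ^ (-ε) := rfl
      linarith [mul_pos hc0 (hVp t)]) (by rw [e1]; linarith)
    refine ⟨this.1, this.2.trans (by gcongr), ?_⟩
    have hk := ker_bd (c := (c + z * I).re) (by rw [e1]; linarith) ((c + z * I).im)
    rw [re_add_im] at hk
    refine le_trans ?_ hk
    rw [e1, e2]
    have : 3 / 4 ≤ min (c - z.im) 1 := le_min (by linarith) (by norm_num)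
    have h6 : (1 + t ^ 2) / 2 ≤ 1 + z.re ^ 2 := by
      have : (z.re - t) ^ 2 ≤ (1 / 4) ^ 2 := sq_le_sq' (by linarith) (by linarith)
      linarith [sq_nonneg (z.re + z.re - t)]
    have h7 : 3 / 4 * ((1 + t ^ 2) / 2) ≤ min (c - z.im) 1 * (1 + z.re ^ 2) :=
      mul_le_mul this h6 (by positivity) (by linarith)
    linarith [sq_nonneg t]
  have hne : ∀ t : ℝ, ∀ z ∈ Metric.closedBall (t : ℂ) (ρ t),
      (c + z * I) * (c + z * I + 1) ≠ 0 := fun t z hz' => by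
    rw [← norm_pos_iff]; exact lt_of_lt_of_le (by positivity) (main t z hz').2.2
  have hFI := FI (g := g) (k := k) (h := fun t => K0 * (2 * q) * (1 + ‖t‖ ^ 2) ^ (-(3 / 2 : ℝ) / 2))
    (b := b) (ρ := ρ) (hJi.const_mul _) hρ0 (fun t => (hρ1 t).trans (by norm_num))
    (fun t z hz' => by
      have hL : Differentiable ℂ (LFunction χ) := differentiable_LFunction hχ
      have hL2 : Differentiable ℂ (deriv (LFunction χ)) := hL.deriv
      refine DifferentiableAt.differentiableWithinAt ?_
      refine DifferentiableAt.mul (DifferentiableAt.neg (DifferentiableAt.div ?_ ?_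
        (main t z hz').1)) (DifferentiableAt.div (by fun_prop) (by fun_prop) (hne t z hz'))
      · exact hL2.differentiableAt.comp z (by fun_prop)
      · exact hL.differentiableAt.comp z (by fun_prop))
    (fun t z hz' => by
      have m := main t z hz'
      simp only [hg, hb]
      rw [norm_mul, norm_neg]
      refine mul_le_mul m.2.1 ?_ (norm_nonneg _) (by have := hV0 t; positivity)
      rw [norm_div, norm_one, show 4 / (1 + t ^ 2) = 1 / ((1 + t ^ 2) / 4) by rw [one_div_div]]
      exact one_div_le_one_div_of_le (by positivity) m.2.2)
    (fun t => by
      have hV2 := hV0 t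
      have hVp' : 0 < V t := by linarith
      have e1 : b t / ρ t ^ k = K0 * (V t ^ (1 / 2 : ℝ) / (1 + t ^ 2)) := by
        simp only [hb, hρ, hK0]
        rw [mul_pow, Real.rpow_neg hVp'.le, inv_pow, ← Real.rpow_mul_natCast hVp'.le ε k]
        have : V t ^ (1 / 2 : ℝ) = V t ^ ε * V t ^ (ε * k) := by
          rw [← Real.rpow_add hVp']; congr 1; rw [hε]; field_simp; ring
        rw [this, div_pow, div_pow]; field_simp; norm_num
      simp only [e1]
      rw [mul_assoc K0 (2 * (q : ℝ))]
      refine mul_le_mul_of_nonneg_left ?_ (show (0 : ℝ) ≤ K0 by positivity)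
      have hT : 0 < 1 + t ^ 2 := by positivity
      rw [div_le_iff₀ hT, mul_assoc, Real.norm_eq_abs, sq_abs]
      have e2 : (1 + t ^ 2) ^ (-(3 / 2 : ℝ) / 2) * (1 + t ^ 2) = (1 + t ^ 2) ^ (1 / 4 : ℝ) := by
        rw [← Real.rpow_add_one hT.ne']; norm_num
      rw [e2]
      have h1 : V t ≤ (2 * q) ^ 2 * ((1 + t ^ 2) ^ (1 / 4 : ℝ)) ^ 2 := by
        have : ((1 + t ^ 2) ^ (1 / 4 : ℝ)) ^ 2 = √(1 + t ^ 2) := by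
          rw [← Real.rpow_mul_natCast hT.le, Real.sqrt_eq_rpow]; norm_num
        rw [this]; simp only [hV]
        have a1 : |t| ≤ √(1 + t ^ 2) := Real.abs_le_sqrt (by linarith)
        have a2 : 1 ≤ √(1 + t ^ 2) := Real.one_le_sqrt.2 (by linarith [sq_nonneg t])
        have a3 := mul_le_mul_of_nonneg_left (show |t| + 2 ≤ 4 * √(1 + t ^ 2) by linarith) (show (0:ℝ) ≤ q by linarith)
        have a4 := mul_le_mul_of_nonneg_right hq1 (show 0 ≤ q * √(1 + t ^ 2) by positivity)
        linarith
      rw [← Real.sqrt_eq_rpow]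
      exact Real.sqrt_le_iff.2 ⟨by positivity, by rw [mul_pow]; exact h1⟩) y
  rw [integral_const_mul, abs_of_pos (by linarith : 0 < y)] at hFI
  have hsum : LSeriesSummable (fun n => χ n * Λ n) c :=
    LSeriesSummable_twist_vonMangoldt χ (by simpa using hc1')
  have hper := perron (by linarith : 0 < c) hX hsum
  have e3 : ∀ t : ℝ, (X : ℂ) ^ (c + t * I) * LSeries (fun n => χ n * (Λ n : ℂ)) (c + t * I) *
      (1 / ((c + t * I) * (c + t * I + 1))) = (X ^ c : ℝ) * (g t * cexp (t * y * I)) := fun t => by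
    have hXc : (X : ℂ) ≠ 0 := by exact_mod_cast hX.ne'
    have hs1 : 1 < (c + t * I : ℂ).re := by simpa using hc1'
    have := LSeries_twist_vonMangoldt_eq χ hs1
    rw [← LFunction_eq_LSeries χ hs1, ← deriv_LFunction_eq_deriv_LSeries χ hs1] at this
    rw [show LSeries (fun n => χ n * (Λ n : ℂ)) (c + t * I) = _ from this, cpow_add _ _ hXc,
      ofReal_cpow hX.le, cpow_def_of_ne_zero hXc (t * I), ← ofReal_log hX.le]
    simp only [hg]
    rw [show (t * y * I : ℂ) = Real.log X * (t * I) by rw [hy]; ring]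
    ring
  simp_rw [e3, integral_const_mul] at hper
  have hXc : X ^ c = Real.exp 1 * X := by
    rw [hc, Real.rpow_add hX, Real.rpow_one, mul_comm]
    congr 1
    rw [Real.rpow_def_of_pos hX, ← hy, mul_one_div_cancel (by linarith)]
  set Z := ‖∫ t : ℝ, g t * cexp (t * y * I)‖ with hZ
  have h7 := congrArg norm hper
  rw [norm_mul, norm_mul, norm_mul, norm_real, norm_real, hXc, ← hZ] at h7
  simp only [Complex.norm_ofNat, Real.norm_eq_abs, abs_of_pos Real.pi_pos] at h7
  rw [abs_of_pos (by positivity)] at h7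
  have hW : ‖WS (fun n => χ n * Λ n) X‖ ≤ 3 * X * Z := by
    have hpi := Real.pi_gt_three
    have := Real.exp_one_lt_d9
    have h0 := norm_nonneg (WS (fun n => χ n * Λ n) X)
    have : Real.exp 1 * X * Z ≤ 3 * X * Z := by gcongr; linarith
    have := mul_le_mul_of_nonneg_right hpi.le h0
    linarith
  refine hW.trans ?_
  rw [le_div_iff₀ (by positivity)]
  have h8 : y ^ B * (y ^ A * Z) ≤ y ^ B * (k.factorial * (K0 * 2 * J)) := by
    calc _ = y ^ k * Z := by rw [hk, pow_add]; ring
      _ ≤ _ := hFI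
      _ = q * (k.factorial * (K0 * 2 * J)) := by ring
      _ ≤ _ := by gcongr
  have h9 := le_of_mul_le_mul_left h8 (by positivity)
  have h10 := mul_le_mul_of_nonneg_left h9 (show 0 ≤ 3 * X by linarith)
  linarith
end

section
open Complex MeasureTheory Finset

noncomputable def ee (x : ℝ) : ℂ := cexp (2 * Real.pi * I * x)

lemma ee_int (n m : ℕ) : ∫ x in (0 : ℝ)..1, ee (n * x) * (starRingEnd ℂ) (ee (m * x)) =
    if n = m then 1 else 0 := by
  have h : ∀ x : ℝ, ee (n * x) * (starRingEnd ℂ) (ee (m * x)) =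
      cexp (2 * Real.pi * I * ((n : ℂ) - m) * x) := fun x => by
    rw [ee, ee, ← exp_conj, ← Complex.exp_add]; congr 1; simp [conj_ofNat]; ring
  simp_rw [h]
  split_ifs with hnm
  · simp [hnm]
  · have h0 : 2 * Real.pi * I * ((n : ℂ) - m) ≠ 0 := by
      have : (n : ℂ) - m ≠ 0 := sub_ne_zero.2 (by exact_mod_cast hnm)
      simp [Real.pi_ne_zero, this]
    rw [integral_exp_mul_complex h0]
    have : cexp (2 * Real.pi * I * ((n : ℂ) - m) * (1 : ℝ)) = 1 := by
      rw [exp_eq_one_iff]; exact ⟨n - m, by push_cast; ring⟩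
    rw [this]; simp

lemma ee_cont : Continuous ee := by unfold ee; fun_prop

lemma ee_pars (F : Finset ℕ) (a : ℕ → ℂ) :
    ∫ x in (0 : ℝ)..1, ‖∑ n ∈ F, a n * ee (n * x)‖ ^ 2 = ∑ n ∈ F, ‖a n‖ ^ 2 := by
  have hc := ee_cont
  have h : ∀ x : ℝ, ((‖∑ n ∈ F, a n * ee (n * x)‖ ^ 2 : ℝ) : ℂ) =
      ∑ n ∈ F, ∑ m ∈ F, a n * (starRingEnd ℂ) (a m) *
        (ee (n * x) * (starRingEnd ℂ) (ee (m * x))) := fun x => by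
    push_cast
    rw [← mul_conj', map_sum, sum_mul_sum]
    refine sum_congr rfl fun n _ => sum_congr rfl fun m _ => ?_
    rw [map_mul]; ring
  apply ofReal_injective
  rw [← intervalIntegral.integral_ofReal]
  simp_rw [h]
  rw [intervalIntegral.integral_finsetSum fun n _ => (Continuous.intervalIntegrable
    (by have := continuous_conj; fun_prop) _ _)]
  push_cast
  refine sum_congr rfl fun n hn => ?_
  rw [intervalIntegral.integral_finsetSum fun n _ => (Continuous.intervalIntegrable
    (by have := continuous_conj; fun_prop) _ _)]
  simp_rw [intervalIntegral.integral_const_mul, ee_int]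
  simp [hn, mul_conj']

lemma gall {f f' g : ℝ → ℝ} (hf : ∀ x, HasDerivAt f (f' x) x) (hc : Continuous f')
    (hg : Continuous g) (hb : ∀ x, |f' x| ≤ g x) {δ : ℝ} (hδ : 0 < δ) (x : ℝ) :
    f x ≤ ∫ y in (x - δ)..x, (δ⁻¹ * f y + g y) := by
  have hfc : Continuous f := continuous_iff_continuousAt.2 fun x => (hf x).continuousAt
  have h := intervalIntegral.integral_eq_sub_of_hasDerivAt (a := x - δ) (b := x)
    (f := fun y => (y - (x - δ)) * f y) (f' := fun y => 1 * f y + (y - (x - δ)) * f' y)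
    (fun y _ => ((hasDerivAt_id y).sub_const _).mul (hf y))
    (Continuous.intervalIntegrable (by fun_prop) _ _)
  have h2 : ∫ y in (x - δ)..x, (1 * f y + (y - (x - δ)) * f' y) ≤
      ∫ y in (x - δ)..x, δ * (δ⁻¹ * f y + g y) := by
    refine intervalIntegral.integral_mono_on (by linarith)
      (Continuous.intervalIntegrable (by fun_prop) _ _)
      (Continuous.intervalIntegrable (by fun_prop) _ _) fun y hy => ?_
    have h3 : (y - (x - δ)) * f' y ≤ δ * g y :=
      (le_abs_self _).trans (by
        rw [abs_mul, abs_of_nonneg (by linarith [hy.1])]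
        exact mul_le_mul (by linarith [hy.2]) (hb y) (abs_nonneg _) hδ.le)
    rw [mul_add, mul_inv_cancel_left₀ hδ.ne']; linarith
  rw [intervalIntegral.integral_const_mul, h] at h2
  have : δ * f x ≤ δ * ∫ y in (x - δ)..x, (δ⁻¹ * f y + g y) := by
    refine le_trans (le_of_eq ?_) h2; ring
  exact le_of_mul_le_mul_left this hδ

lemma LS_add (F : Finset ℕ) (a : ℕ → ℂ) {M Q : ℝ} (hM : 1 ≤ M) (hF : ∀ n ∈ F, (n : ℝ) ≤ M)
    (hQ : 1 ≤ Q) (P : Finset ℝ) (hP : ∀ x ∈ P, 1 / Q ^ 2 ≤ x ∧ x ≤ 1)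
    (hs : ∀ x ∈ P, ∀ y ∈ P, x < y → 1 / Q ^ 2 ≤ y - x) :
    ∑ x ∈ P, ‖∑ n ∈ F, a n * ee (n * x)‖ ^ 2 ≤ (Q ^ 2 + 13 * M) * ∑ n ∈ F, ‖a n‖ ^ 2 := by
  set S : ℝ → ℂ := fun x => ∑ n ∈ F, a n * ee (n * x) with hS
  set S' : ℝ → ℂ := fun x => ∑ n ∈ F, (a n * (2 * Real.pi * I * n)) * ee (n * x) with hS'
  have hc := ee_cont
  have hSc : Continuous S := by fun_prop
  have hSc' : Continuous S' := by fun_prop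
  have hd : ∀ x, HasDerivAt S (S' x) x := fun x => by
    refine HasDerivAt.fun_sum fun n _ => ?_
    rw [mul_assoc]
    refine HasDerivAt.const_mul _ ?_
    unfold ee
    have : HasDerivAt (fun y : ℝ => (2 * Real.pi * I * ((n * y : ℝ) : ℂ))) (2 * Real.pi * I * n) x := by
      have := ((hasDerivAt_id x).const_mul (n : ℝ)).ofReal_comp.const_mul (2 * Real.pi * I)
      simpa using this
    exact this.cexp.congr_deriv (mul_comm _ _)
  set κ : ℝ := 2 * Real.pi * M with hκ
  have hκ0 : 0 < κ := by have := Real.pi_pos; positivity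
  set g : ℝ → ℝ := fun x => κ * ‖S x‖ ^ 2 + κ⁻¹ * ‖S' x‖ ^ 2 with hg
  have hδ : 0 < 1 / Q ^ 2 := by positivity
  set h : ℝ → ℝ := fun y => (1 / Q ^ 2)⁻¹ * ‖S y‖ ^ 2 + g y with hh
  have hhc : Continuous h := by fun_prop
  have hh0 : ∀ y, 0 ≤ h y := fun y => by positivity
  have h1 : ∀ x, ‖S x‖ ^ 2 ≤ ∫ y in (x - 1 / Q ^ 2)..x, h y := fun x => by
    refine gall (f' := fun x => 2 * inner ℝ (S x) (S' x)) (fun x => (hd x).norm_sq)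
      (by fun_prop) (by fun_prop) (fun x => ?_) hδ x
    have := abs_real_inner_le_norm (S x) (S' x)
    rw [abs_mul, abs_two]
    have e : g x - 2 * (‖S x‖ * ‖S' x‖) = κ⁻¹ * (κ * ‖S x‖ - ‖S' x‖) ^ 2 := by
      simp only [hg]; field_simp; ring
    have : 0 ≤ κ⁻¹ * (κ * ‖S x‖ - ‖S' x‖) ^ 2 := by positivity
    linarith
  have h2 : ∑ x ∈ P, ‖S x‖ ^ 2 ≤ ∫ y in (0 : ℝ)..1, h y := by
    refine (sum_le_sum fun x _ => h1 x).trans ?_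
    have e : ∀ x ∈ P, ∫ y in (x - 1 / Q ^ 2)..x, h y = ∫ y in Set.Ioc (x - 1 / Q ^ 2) x, h y :=
      fun x _ => intervalIntegral.integral_of_le (by linarith)
    rw [sum_congr rfl e, intervalIntegral.integral_of_le zero_le_one,
      ← integral_biUnion_finset P (fun x _ => measurableSet_Ioc) ?_
        (fun x _ => (hhc.integrableOn_Icc).mono_set Set.Ioc_subset_Icc_self)]
    · refine setIntegral_mono_set ((hhc.integrableOn_Icc).mono_set Set.Ioc_subset_Icc_self)
        (.of_forall hh0) (HasSubset.Subset.eventuallyLE ?_)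
      refine Set.iUnion₂_subset fun x hx y hy => ⟨?_, hy.2.trans (hP x hx).2⟩
      have := (hP x hx).1; linarith [hy.1]
    · intro x hx y hy hxy
      rw [Function.onFun, Set.disjoint_left]
      rintro z ⟨hz1, hz2⟩ ⟨hz3, hz4⟩
      rcases lt_or_gt_of_ne hxy with h | h
      · have := hs x hx y hy h; linarith
      · have := hs y hy x hx h; linarith
  refine h2.trans ?_
  have hi : ∀ f : ℝ → ℝ, Continuous f → IntervalIntegrable f volume 0 1 := fun f hf =>
    hf.intervalIntegrable _ _
  simp only [hh, hg]
  rw [intervalIntegral.integral_add (hi _ (by fun_prop)) (hi _ (by fun_prop)),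
    intervalIntegral.integral_add (hi _ (by fun_prop)) (hi _ (by fun_prop))]
  simp_rw [intervalIntegral.integral_const_mul]
  rw [ee_pars, ee_pars]
  have h3 : ∑ n ∈ F, ‖a n * (2 * Real.pi * I * n)‖ ^ 2 ≤ κ ^ 2 * ∑ n ∈ F, ‖a n‖ ^ 2 := by
    rw [mul_sum]
    refine sum_le_sum fun n hn => ?_
    rw [norm_mul, mul_pow, mul_comm]
    simp only [norm_mul, norm_I, Complex.norm_ofNat, norm_real, Complex.norm_natCast,
      Real.norm_eq_abs, abs_of_pos Real.pi_pos, mul_one]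
    have := hF n hn; have := Real.pi_pos
    gcongr; rw [hκ]; gcongr
  have h4 : κ⁻¹ * ∑ n ∈ F, ‖a n * (2 * Real.pi * I * n)‖ ^ 2 ≤ κ * ∑ n ∈ F, ‖a n‖ ^ 2 := by
    rw [inv_mul_le_iff₀ hκ0]; linarith
  have h5 : 2 * κ ≤ 13 * M := by
    have := Real.pi_lt_d2; rw [hκ]; nlinarith
  have h6 : (0 : ℝ) ≤ ∑ n ∈ F, ‖a n‖ ^ 2 := by positivity
  rw [one_div, inv_inv]
  nlinarith
end

section
open Complex MeasureTheory Finset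

noncomputable def PCs (q : ℕ) : Finset (DirichletCharacter ℂ q) :=
  (Set.toFinite {χ : DirichletCharacter ℂ q | χ.IsPrimitive}).toFinset

lemma mem_PCs {q : ℕ} {χ : DirichletCharacter ℂ q} : χ ∈ PCs q ↔ χ.IsPrimitive := by simp [PCs]

lemma gauss_norm {q : ℕ} [NeZero q] {χ : DirichletCharacter ℂ q} (h : χ.IsPrimitive) :
    ‖gaussSum χ ZMod.stdAddChar‖ ^ 2 = q := by
  set τ := gaussSum χ ZMod.stdAddChar with hτ
  have hF := h.fourierTransform_eq_inv_mul_gaussSum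
  have h1 := congrFun (ZMod.dft_dft (χ : ZMod q → ℂ)) (-1)
  rw [ZMod.dft_apply, neg_neg, map_one] at h1
  simp_rw [hF, smul_eq_mul] at h1
  have h2 : (starRingEnd ℂ) τ = ∑ k : ZMod q, ZMod.stdAddChar (-k) * χ⁻¹ k := by
    rw [hτ, gaussSum, map_sum]
    refine sum_congr rfl fun k _ => ?_
    rw [map_mul, ← AddChar.map_neg_eq_conj, starRingEnd_apply, MulChar.star_apply', mul_comm]
  have h3 : τ * (starRingEnd ℂ) τ = q := by
    rw [h2, mul_sum, ← Equiv.sum_comp (Equiv.neg (ZMod q))]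
    rw [mul_one] at h1
    rw [← h1]
    refine sum_congr rfl fun k _ => ?_
    simp; ring
  rw [mul_conj'] at h3
  exact_mod_cast h3

lemma char_pars {q : ℕ} [NeZero q] (f : ZMod q → ℂ) :
    ∑ χ : DirichletCharacter ℂ q, ‖∑ b, χ b * f b‖ ^ 2 =
      q.totient * ∑ b ∈ univ.filter (IsUnit (M := ZMod q)), ‖f b‖ ^ 2 := by
  apply ofReal_injective
  push_cast
  have h : ∀ χ : DirichletCharacter ℂ q, ((‖∑ b, χ b * f b‖ : ℝ) : ℂ) ^ 2 =
      ∑ c ∈ univ.filter (IsUnit (M := ZMod q)), ∑ b,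
        (χ c⁻¹ * χ b) * ((starRingEnd ℂ) (f c) * f b) := fun χ => by
    rw [← conj_mul', map_sum, sum_mul_sum, sum_filter]
    refine sum_congr rfl fun c _ => ?_
    split_ifs with hc
    · refine sum_congr rfl fun b _ => ?_
      have h0 : χ c⁻¹ * χ c = 1 := by rw [← map_mul, ZMod.inv_mul_of_unit _ hc, map_one]
      rw [map_mul, starRingEnd_apply (χ c), MulChar.star_apply', MulChar.inv_apply_eq_inv',
        eq_inv_of_mul_eq_one_left h0]; ring
    · rw [MulChar.map_nonunit χ hc]; simp
  simp_rw [h]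
  rw [sum_comm, mul_sum]
  refine sum_congr rfl fun c hc => ?_
  rw [sum_comm]
  simp_rw [← sum_mul, DirichletCharacter.sum_char_inv_mul_char_eq ℂ (mem_filter.1 hc).2]
  simp [conj_mul']

lemma LS_q {q : ℕ} [NeZero q] (F : Finset ℕ) (a : ℕ → ℂ) :
    (q : ℝ) / q.totient * ∑ χ ∈ PCs q, ‖∑ n ∈ F, a n * χ n‖ ^ 2 ≤
      ∑ b ∈ (range q).filter (fun b => b.Coprime q),
        ‖∑ n ∈ F, (starRingEnd ℂ) (a n) * ee (n * (b / q : ℝ))‖ ^ 2 := by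
  set f : ZMod q → ℂ := fun b => ∑ n ∈ F, (starRingEnd ℂ) (a n) * ZMod.stdAddChar (b * (n : ZMod q)) with hf
  have hφ : (0 : ℝ) < q.totient := by exact_mod_cast Nat.totient_pos.2 (NeZero.pos q)
  rw [div_mul_eq_mul_div, div_le_iff₀ hφ, mul_sum]
  have h1 : ∀ χ ∈ PCs q, (q : ℝ) * ‖∑ n ∈ F, a n * χ n‖ ^ 2 = ‖∑ b, χ b * f b‖ ^ 2 := by
    intro χ hχ
    rw [mem_PCs] at hχ
    rw [← gauss_norm hχ, ← RCLike.norm_conj (∑ n ∈ F, a n * χ n), ← mul_pow, ← norm_mul, map_sum,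
      mul_sum]
    congr 2
    simp only [hf, mul_sum]
    rw [sum_comm]
    refine sum_congr rfl fun n _ => ?_
    have h2 := hχ.fourierTransform_eq_inv_mul_gaussSum (-(n : ZMod q))
    rw [ZMod.dft_apply, neg_neg] at h2
    rw [map_mul, starRingEnd_apply (χ n), MulChar.star_apply', mul_left_comm,
      mul_comm (gaussSum _ _), ← h2, mul_sum]
    refine sum_congr rfl fun b _ => ?_
    rw [mul_neg, neg_neg, smul_eq_mul]; ring
  rw [sum_congr rfl h1]
  refine (sum_le_sum_of_subset_of_nonneg (subset_univ _) fun _ _ _ => by positivity).trans ?_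
  rw [char_pars, mul_comm]
  gcongr
  refine le_of_eq (sum_nbij' ZMod.val (fun b => (b : ZMod q)) ?_ ?_ ?_ ?_ ?_)
  · intro b hb
    rw [mem_filter] at hb
    refine mem_filter.2 ⟨mem_range.2 (ZMod.val_lt b), ?_⟩
    rw [← ZMod.isUnit_iff_coprime, ZMod.natCast_zmod_val]; exact hb.2
  · intro b hb
    exact mem_filter.2 ⟨mem_univ _, (ZMod.isUnit_iff_coprime _ _).2 (mem_filter.1 hb).2⟩
  · intro b _; simp
  · intro b hb; exact ZMod.val_cast_of_lt (mem_range.1 (mem_filter.1 hb).1)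
  · intro b _
    simp only [hf]
    congr 2
    refine sum_congr rfl fun n _ => ?_
    congr 1
    have := ZMod.stdAddChar_coe (N := q) ((b.val * n : ℕ) : ℤ)
    push_cast at this
    rw [ZMod.natCast_zmod_val] at this
    rw [this, ee]; push_cast; congr 1; ring

lemma LS_mul (F : Finset ℕ) (a : ℕ → ℂ) {M : ℝ} {Q : ℕ} (hM : 1 ≤ M) (hF : ∀ n ∈ F, (n : ℝ) ≤ M)
    (hQ : 1 ≤ Q) :
    ∑ q ∈ Icc 2 Q, (q : ℝ) / q.totient * ∑ χ ∈ PCs q, ‖∑ n ∈ F, a n * χ n‖ ^ 2 ≤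
      (Q ^ 2 + 13 * M) * ∑ n ∈ F, ‖a n‖ ^ 2 := by
  set T := (Icc 2 Q).sigma fun q => (range q).filter (fun b => b.Coprime q) with hT
  have hT' : ∀ x ∈ T, 2 ≤ x.1 ∧ x.1 ≤ Q ∧ x.2 < x.1 ∧ x.2.Coprime x.1 ∧ 0 < x.2 := by
    intro x hx
    simp only [hT, mem_sigma, mem_Icc, mem_filter, mem_range] at hx
    refine ⟨hx.1.1, hx.1.2, hx.2.1, hx.2.2, Nat.pos_of_ne_zero fun h => ?_⟩
    have := hx.2.2; rw [h, Nat.coprime_zero_left] at this; omega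
  set pt : (Σ _ : ℕ, ℕ) → ℝ := fun x => (x.2 : ℝ) / x.1 with hpt
  have hinj : Set.InjOn pt T := by
    rintro ⟨q, b⟩ hx ⟨q', b'⟩ hy h
    obtain ⟨h1, _, _, h4, _⟩ := hT' _ hx
    obtain ⟨h1', _, _, h4', _⟩ := hT' _ hy
    simp only [hpt] at h h1 h1' h4 h4'
    rw [div_eq_div_iff (by positivity) (by positivity)] at h
    have h : b * q' = b' * q := by exact_mod_cast h
    have d1 : q ∣ q' := h4.symm.dvd_of_dvd_mul_left ⟨b', by rw [h]; ring⟩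
    have d2 : q' ∣ q := h4'.symm.dvd_of_dvd_mul_left ⟨b, by rw [← h]; ring⟩
    have := Nat.dvd_antisymm d1 d2
    subst this
    rw [Nat.eq_of_mul_eq_mul_right (by omega) h]
  have hQ' : (1 : ℝ) ≤ Q := by exact_mod_cast hQ
  have key := LS_add F (fun n => (starRingEnd ℂ) (a n)) hM hF hQ' (T.image pt) (by
    intro x hx
    obtain ⟨y, hy, rfl⟩ := mem_image.1 hx
    obtain ⟨h1, h2, h3, h4, h5⟩ := hT' y hy
    have a1 : (y.1 : ℝ) ≤ Q := by exact_mod_cast h2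
    have a2 : (1 : ℝ) ≤ y.2 := by exact_mod_cast h5
    have a3 : (y.2 : ℝ) ≤ y.1 := by exact_mod_cast h3.le
    have a4 : (2 : ℝ) ≤ y.1 := by exact_mod_cast h1
    refine ⟨?_, div_le_one_of_le₀ a3 (by positivity)⟩
    simp only [hpt]
    exact div_le_div₀ (by positivity) a2 (by linarith) (by nlinarith)) (by
    intro x hx x' hx' hlt
    obtain ⟨y, hy, rfl⟩ := mem_image.1 hx
    obtain ⟨y', hy', rfl⟩ := mem_image.1 hx'
    obtain ⟨h1, h2, h3, h4, h5⟩ := hT' y hy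
    obtain ⟨h1', h2', h3', h4', h5'⟩ := hT' y' hy'
    simp only [hpt] at hlt ⊢
    have p1 : (0 : ℝ) < y.1 := by positivity
    have p2 : (0 : ℝ) < y'.1 := by positivity
    have hlt := (div_lt_div_iff₀ p1 p2).1 hlt
    have hlt : y.2 * y'.1 + 1 ≤ y'.2 * y.1 := by exact_mod_cast hlt
    have hlt : (y.2 : ℝ) * y'.1 + 1 ≤ y'.2 * y.1 := by exact_mod_cast hlt
    rw [div_sub_div _ _ p2.ne' p1.ne']
    have a1 : (y.1 : ℝ) ≤ Q := by exact_mod_cast h2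
    have a1' : (y'.1 : ℝ) ≤ Q := by exact_mod_cast h2'
    exact div_le_div₀ (by nlinarith) (by linarith) (by positivity) (by nlinarith))
  rw [sum_image hinj, hT, sum_sigma] at key
  simp only [RCLike.norm_conj] at key
  refine le_trans (sum_le_sum fun q hq => ?_) key
  have : NeZero q := ⟨by have := (mem_Icc.1 hq).1; omega⟩
  exact LS_q F a
end

section
open Complex MeasureTheory Finset

lemma ker_norm {c : ℝ} (hc : 0 < c) (hc1 : c ≤ 1) :
    ∫ t : ℝ, ‖(1 : ℂ) / ((c + t * I) * (c + t * I + 1))‖ ≤ Real.pi / c := by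
  have : Real.pi / c = ∫ t : ℝ, c⁻¹ * (1 + t ^ 2)⁻¹ := by
    rw [integral_const_mul, integral_univ_inv_one_add_sq]; field_simp
  rw [this]
  refine integral_mono (ker_int hc).norm (integrable_inv_one_add_sq.const_mul _) fun t => ?_
  simp only
  rw [norm_div, norm_one, ← mul_inv, one_div]
  have := ker_bd hc t
  rw [min_eq_left hc1] at this
  exact inv_anti₀ (by positivity) this

lemma typeII (FA FB : Finset ℕ) (α β : ℕ → ℂ) {X MA MB : ℝ} {Q : ℕ} (hQ : 1 ≤ Q) (hX : 0 < X)
    (hl : 1 ≤ Real.log X) (hMA : 1 ≤ MA) (hMB : 1 ≤ MB) (hA : ∀ a ∈ FA, 0 < a ∧ (a : ℝ) ≤ MA)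
    (hB : ∀ b ∈ FB, 0 < b ∧ (b : ℝ) ≤ MB) :
    ∑ q ∈ Icc 2 Q, (q : ℝ) / q.totient * ∑ χ ∈ PCs q, ‖∑ a ∈ FA, ∑ b ∈ FB,
      α a * χ a * (β b * χ b) * (wt (a * b / X) : ℂ)‖ ≤
    2 * Real.log X * (√((Q ^ 2 + 13 * MA) * ∑ a ∈ FA, ‖α a‖ ^ 2) *
      √((Q ^ 2 + 13 * MB) * ∑ b ∈ FB, ‖β b‖ ^ 2)) := by
  set l := Real.log X with hlX
  set c : ℝ := 1 / l with hc
  have hc0 : 0 < c := by positivity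
  have hc1 : c ≤ 1 := by rw [hc, div_le_one (by linarith)]; exact hl
  set K : ℝ → ℂ := fun t => 1 / ((c + t * I) * (c + t * I + 1)) with hK
  have hKi : Integrable K := ker_int hc0
  set S := (Icc 2 Q).sigma PCs with hS
  set Z := √((Q ^ 2 + 13 * MA) * ∑ a ∈ FA, ‖α a‖ ^ 2) *
      √((Q ^ 2 + 13 * MB) * ∑ b ∈ FB, ‖β b‖ ^ 2) with hZ
  set F : (Σ q : ℕ, DirichletCharacter ℂ q) → ℝ → ℂ := fun x t => ∑ a ∈ FA, ∑ b ∈ FB,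
    α a * x.2 a * (β b * x.2 b) * (((X / (a * b) : ℝ) : ℂ) ^ (c + t * I) * K t) with hF
  have hi0 : ∀ y : ℝ, 0 < y → Integrable fun t : ℝ => (y : ℂ) ^ (c + t * I) * K t := by
    intro y hy
    refine (hKi.norm.const_mul (y ^ c)).mono' ?_ (.of_forall fun t => ?_)
    · refine (Continuous.aestronglyMeasurable ?_).mul hKi.1
      exact Continuous.const_cpow (by fun_prop) (.inl (by exact_mod_cast hy.ne'))
    · rw [norm_mul, norm_cpow_eq_rpow_re_of_pos hy]; simp
  have hp : ∀ a ∈ FA, ∀ b ∈ FB, 0 < X / (a * b) := fun a ha b hb => by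
    have := (hA a ha).1; have := (hB b hb).1; positivity
  have hFi : ∀ x, Integrable (F x) := fun x =>
    integrable_finsetSum _ fun a ha => integrable_finsetSum _ fun b hb =>
      (hi0 _ (hp a ha b hb)).const_mul _
  have h1 : ∀ x, ∑ a ∈ FA, ∑ b ∈ FB, α a * x.2 a * (β b * x.2 b) * (wt (a * b / X) : ℂ) =
      (2 * Real.pi : ℝ)⁻¹ * ∫ t, F x t := fun x => by
    simp only [hF]
    rw [integral_finsetSum _ fun a ha => integrable_finsetSum _ fun b hb =>
      (hi0 _ (hp a ha b hb)).const_mul _, mul_sum]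
    refine sum_congr rfl fun a ha => ?_
    rw [integral_finsetSum _ fun b hb => (hi0 _ (hp a ha b hb)).const_mul _, mul_sum]
    refine sum_congr rfl fun b hb => ?_
    rw [integral_const_mul, MF hc0 (hp a ha b hb), inv_div, wt]
    have : (Real.pi : ℂ) ≠ 0 := by simp [Real.pi_ne_zero]
    push_cast; field_simp
  set A : (Σ q : ℕ, DirichletCharacter ℂ q) → ℝ → ℂ := fun x t =>
    ∑ a ∈ FA, (α a * (a : ℂ) ^ (-(c + t * I))) * x.2 a with hAd
  set B : (Σ q : ℕ, DirichletCharacter ℂ q) → ℝ → ℂ := fun x t =>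
    ∑ b ∈ FB, (β b * (b : ℂ) ^ (-(c + t * I))) * x.2 b with hBd
  have hXc : X ^ c = Real.exp 1 := by
    rw [hc, Real.rpow_def_of_pos hX, ← hlX, mul_one_div_cancel (by linarith)]
  have h2 : ∀ x t, ‖F x t‖ = Real.exp 1 * ‖K t‖ * (‖A x t‖ * ‖B x t‖) := fun x t => by
    have : F x t = (X : ℂ) ^ (c + t * I) * K t * (A x t * B x t) := by
      simp only [hF, hAd, hBd]
      rw [sum_mul_sum, mul_sum]
      refine sum_congr rfl fun a ha => ?_
      rw [mul_sum]
      refine sum_congr rfl fun b hb => ?_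
      have e1 : ((X / (a * b) : ℝ) : ℂ) ^ (c + t * I) = (X : ℂ) ^ (c + t * I) *
          ((a : ℂ) ^ (-(c + t * I)) * (b : ℂ) ^ (-(c + t * I))) := by
        rw [div_eq_mul_inv, ofReal_mul, mul_cpow_ofReal_nonneg hX.le (by positivity), cpow_neg,
          cpow_neg, ← mul_inv, ofReal_inv, ofReal_mul, inv_cpow _ _ (by
            rw [← ofReal_mul, arg_ofReal_of_nonneg (by positivity)]; exact Real.pi_pos.ne),
          mul_cpow_ofReal_nonneg (by positivity) (by positivity)]
        simp
      rw [e1]; ring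
    rw [this, norm_mul, norm_mul, norm_mul, norm_cpow_eq_rpow_re_of_pos hX, ← hXc]; simp
  have hLS : ∀ (G : Finset ℕ) (γ : ℕ → ℂ) (M : ℝ) (t : ℝ), 1 ≤ M →
      (∀ a ∈ G, 0 < a ∧ (a : ℝ) ≤ M) →
      ∑ x ∈ S, (√((x.1 : ℝ) / x.1.totient) * ‖∑ a ∈ G, (γ a * (a : ℂ) ^ (-(c + t * I))) * x.2 a‖) ^ 2
        ≤ (Q ^ 2 + 13 * M) * ∑ a ∈ G, ‖γ a‖ ^ 2 := by
    intro G γ M t hM hG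
    have := LS_mul G (fun a => γ a * (a : ℂ) ^ (-(c + t * I))) hM (fun a ha => (hG a ha).2) hQ
    simp only [mul_pow]
    rw [hS, sum_sigma]
    refine le_trans (le_of_eq ?_) (this.trans ?_)
    · refine sum_congr rfl fun q _ => ?_
      rw [mul_sum]
      refine sum_congr rfl fun χ _ => ?_
      rw [Real.sq_sqrt (by positivity)]
    · gcongr with a ha
      rw [norm_mul, norm_natCast_cpow_of_pos (hG a ha).1]
      refine mul_le_of_le_one_right (norm_nonneg _) (Real.rpow_le_one_of_one_le_of_nonpos
        (by exact_mod_cast (hG a ha).1) ?_)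
      simpa using hc0.le
  have h3 : ∀ t, ∑ x ∈ S, (x.1 : ℝ) / x.1.totient * ‖F x t‖ ≤ Real.exp 1 * Z * ‖K t‖ := fun t => by
    have e : ∀ x ∈ S, (x.1 : ℝ) / x.1.totient * ‖F x t‖ = Real.exp 1 * ‖K t‖ *
        ((√((x.1 : ℝ) / x.1.totient) * ‖A x t‖) * (√((x.1 : ℝ) / x.1.totient) * ‖B x t‖)) :=
      fun x _ => by
        rw [h2, mul_mul_mul_comm (√_), Real.mul_self_sqrt (by positivity)]; ring
    rw [sum_congr rfl e, ← mul_sum, mul_right_comm]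
    gcongr
    refine (Real.sum_mul_le_sqrt_mul_sqrt S _ _).trans ?_
    rw [hZ]
    gcongr
    · exact hLS FA α MA t hMA hA
    · exact hLS FB β MB t hMB hB
  have h4 : ∑ x ∈ S, (x.1 : ℝ) / x.1.totient * ‖∫ t, F x t‖ ≤
      ∫ t, Real.exp 1 * Z * ‖K t‖ := by
    calc _ ≤ ∑ x ∈ S, ∫ t, (x.1 : ℝ) / x.1.totient * ‖F x t‖ := by
          refine sum_le_sum fun x _ => ?_
          rw [integral_const_mul]; gcongr; exact norm_integral_le_integral_norm _
      _ = ∫ t, ∑ x ∈ S, (x.1 : ℝ) / x.1.totient * ‖F x t‖ :=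
          (integral_finsetSum _ fun x _ => (hFi x).norm.const_mul _).symm
      _ ≤ _ := integral_mono (integrable_finsetSum _ fun x _ => (hFi x).norm.const_mul _)
          (hKi.norm.const_mul _) h3
  have h5 : ∑ q ∈ Icc 2 Q, (q : ℝ) / q.totient * ∑ χ ∈ PCs q, ‖∑ a ∈ FA, ∑ b ∈ FB,
      α a * χ a * (β b * χ b) * (wt (a * b / X) : ℂ)‖ = (2 * Real.pi)⁻¹ *
      ∑ x ∈ S, (x.1 : ℝ) / x.1.totient * ‖∫ t, F x t‖ := by
    rw [hS, sum_sigma, mul_sum]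
    refine sum_congr rfl fun q _ => ?_
    rw [mul_sum, mul_sum]
    refine sum_congr rfl fun χ _ => ?_
    rw [h1 ⟨q, χ⟩, norm_mul, norm_real, Real.norm_of_nonneg (by positivity)]
    ring
  have hZ0 : 0 ≤ Z := by positivity
  have h6 := ker_norm hc0 hc1
  rw [integral_const_mul] at h4
  rw [h5]
  calc _ ≤ (2 * Real.pi)⁻¹ * (Real.exp 1 * Z * (Real.pi / c)) := by
        gcongr; exact h4.trans (by gcongr)
    _ = Real.exp 1 / 2 * l * Z := by
        have := Real.pi_ne_zero
        rw [hc]; field_simp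
    _ ≤ 2 * l * Z := by
        have := Real.exp_one_lt_d9
        gcongr; linarith
end

section
open Complex Finset ArithmeticFunction
open scoped ArithmeticFunction.zeta ArithmeticFunction.Moebius

noncomputable def TT {q : ℕ} (χ : DirichletCharacter ℂ q) (X : ℝ) (f : ArithmeticFunction ℝ) : ℂ :=
  WS (fun n => χ n * (f n : ℝ)) X

lemma wt_nonneg (x : ℝ) : 0 ≤ wt x := le_max_left _ _
lemma wt_le {x : ℝ} (h : 0 ≤ x) : wt x ≤ 1 := max_le zero_le_one (by linarith)
lemma wt_anti : Antitone wt := fun x y h => max_le_max le_rfl (by linarith)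

lemma TT_mul {q : ℕ} (χ : DirichletCharacter ℂ q) {X : ℝ} (hX : 0 < X) (f g : ArithmeticFunction ℝ) :
    TT χ X (f * g) = ∑ a ∈ Icc 1 ⌊X⌋₊, ∑ b ∈ Icc 1 ⌊X⌋₊,
      (f a : ℂ) * χ a * (g b * χ b) * (wt (a * b / X) : ℂ) := by
  set K := ⌊X⌋₊
  rw [← sum_product', TT, WS]
  trans ∑ n ∈ Icc 1 K, ∑ x ∈ Icc 1 K ×ˢ Icc 1 K with x.1 * x.2 = n,
      (f x.1 : ℂ) * χ x.1 * (g x.2 * χ x.2) * (wt (x.1 * x.2 / X) : ℂ)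
  · refine sum_congr rfl fun n hn => ?_
    have hn' := mem_Icc.1 hn
    have := Nat.divisorsAntidiagonal_eq_prod_filter_of_le (show n ≠ 0 by omega) hn'.2
    rw [mul_apply, this, ofReal_sum, mul_sum, sum_mul]
    refine sum_congr rfl fun x hx => ?_
    have e := (mem_filter.1 hx).2
    rw [← e]; push_cast; rw [map_mul]; ring
  · simp_rw [sum_filter]
    rw [sum_comm]
    refine sum_congr rfl fun x hx => ?_
    rw [mem_product, mem_Icc, mem_Icc] at hx
    rw [sum_ite_eq]
    split_ifs with h
    · rfl
    · have h1 : K < x.1 * x.2 := by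
        by_contra h2
        exact h (mem_Icc.2 ⟨Nat.mul_pos hx.1.1 hx.2.1, by omega⟩)
      have h2 : X < x.1 * x.2 := by exact_mod_cast (Nat.floor_lt hX.le).1 h1
      have h3 := (one_lt_div hX).2 h2
      have : wt (x.1 * x.2 / X) = 0 := max_eq_left (by linarith)
      rw [this]; simp

lemma char_sum {q : ℕ} [NeZero q] {χ : DirichletCharacter ℂ q} (hχ : χ ≠ 1) (n : ℕ) :
    ‖∑ i ∈ range n, χ i‖ ≤ q := by
  have hz : ∑ i ∈ range q, χ i = 0 := by
    rw [sum_ZMod q (fun a => χ a)]; exact MulChar.sum_eq_zero_of_ne_one hχ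
  induction n using Nat.strong_induction_on with
  | _ n ih =>
    rcases lt_or_ge n q with h | h
    · refine (norm_sum_le_of_le _ fun (i : ℕ) _ => χ.norm_le_one (i : ZMod q)).trans ?_
      simpa using h.le
    · obtain ⟨m, rfl⟩ := Nat.exists_eq_add_of_le h
      rw [sum_range_add, hz, zero_add]
      simpa using ih m (by have := NeZero.pos q; omega)

lemma abel {q : ℕ} [NeZero q] {χ : DirichletCharacter ℂ q} (hχ : χ ≠ 1) {g w : ℕ → ℝ}
    (hg : Monotone g) (hg0 : ∀ n, 0 ≤ g n) (hw : Antitone w) (hw0 : ∀ n, 0 ≤ w n)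
    (hw1 : w 0 ≤ 1) (K : ℕ) :
    ‖∑ b ∈ range (K + 1), ((g b * w b : ℝ) : ℂ) * χ b‖ ≤ 3 * q * g K := by
  have hw1' : ∀ n, w n ≤ 1 := fun n => (hw (Nat.zero_le n)).trans hw1
  have := Finset.sum_range_by_parts (fun b => ((g b * w b : ℝ) : ℂ)) (fun b : ℕ => χ b) (K + 1)
  simp only [smul_eq_mul, Nat.add_sub_cancel] at this
  rw [this]
  have hb : ∀ i ∈ range K, ‖(((g (i + 1) * w (i + 1) : ℝ) : ℂ) - (g i * w i : ℝ)) *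
      ∑ j ∈ range (i + 1), χ j‖ ≤ (g K * (w i - w (i + 1)) + (g (i + 1) - g i)) * q := by
    intro i hi
    rw [norm_mul, ← ofReal_sub, norm_real, Real.norm_eq_abs]
    have h1 := hg (Nat.le_succ i)
    have h2 := hw (Nat.le_succ i)
    have h3 := hg (Nat.succ_le_of_lt (mem_range.1 hi))
    simp only [Nat.succ_eq_add_one] at h1 h2 h3
    have h4 := hw0 i
    have h5 := hw1' i
    have h6 := hg0 (i + 1)
    refine mul_le_mul (abs_le.2 ⟨?_, ?_⟩) (char_sum hχ _) (norm_nonneg _) ?_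
    · nlinarith [mul_le_mul_of_nonneg_right h3 (sub_nonneg.2 h2), mul_nonneg (sub_nonneg.2 h1) h4]
    · nlinarith [mul_nonneg h6 (sub_nonneg.2 h2), mul_nonneg (sub_nonneg.2 h1) (sub_nonneg.2 h5),
        mul_nonneg (hg0 K) (sub_nonneg.2 h2)]
    · nlinarith [mul_nonneg (hg0 K) (sub_nonneg.2 h2)]
  refine (norm_sub_le _ _).trans ?_
  have h1 : ‖((g K * w K : ℝ) : ℂ) * ∑ j ∈ range (K + 1), χ j‖ ≤ g K * q := by
    rw [norm_mul, norm_real, Real.norm_of_nonneg (mul_nonneg (hg0 _) (hw0 _))]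
    exact mul_le_mul (mul_le_of_le_one_right (hg0 _) (hw1' _)) (char_sum hχ _) (norm_nonneg _) (hg0 _)
  have h2 := norm_sum_le_of_le _ hb
  rw [← sum_mul, sum_add_distrib, ← mul_sum, sum_range_sub', sum_range_sub] at h2
  have : (g K * (w 0 - w K) + (g K - g 0)) * q ≤ (g K * 1 + g K) * q := by
    gcongr
    · exact hg0 _
    · linarith [hw0 K]
    · linarith [hg0 0]
  linarith

lemma typeI {q : ℕ} [NeZero q] {χ : DirichletCharacter ℂ q} (hχ : χ ≠ 1) {X L : ℝ} (hX : 0 < X)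
    (f g : ArithmeticFunction ℝ) (Y : ℕ) (hf : ∀ a, Y < a → f a = 0) (hL : ∀ a, |f a| ≤ L)
    (hg : Monotone g) : ‖TT χ X (f * g)‖ ≤ Y * (L * (3 * q * g ⌊X⌋₊)) := by
  set K := ⌊X⌋₊
  have hg0 : ∀ n, 0 ≤ g n := fun n => by rw [← g.map_zero]; exact hg (Nat.zero_le n)
  have hL0 : 0 ≤ L := (abs_nonneg _).trans (hL 0)
  have hgK := hg0 K
  rw [TT_mul χ hX]
  have h1 : ∀ a : ℕ, ‖∑ b ∈ Icc 1 K, (f a : ℂ) * χ a * (g b * χ b) * (wt (a * b / X) : ℂ)‖ ≤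
      if a ≤ Y then L * (3 * q * g K) else 0 := by
    intro a
    split_ifs with h
    · have e : ∑ b ∈ Icc 1 K, (f a : ℂ) * χ a * (g b * χ b) * (wt (a * b / X) : ℂ) =
          f a * χ a * ∑ b ∈ range (K + 1), ((g b * wt (a * b / X) : ℝ) : ℂ) * χ b := by
        rw [mul_sum, sum_range_succ', Nat.cast_zero, g.map_zero]
        simp only [zero_mul, ofReal_zero, mul_zero, add_zero]
        rw [range_eq_Ico, sum_Ico_add' (fun b : ℕ => (f a : ℂ) * χ a *
          (((g b * wt (a * b / X) : ℝ) : ℂ) * χ b)) 0 K 1]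
        refine sum_congr rfl fun b _ => ?_
        push_cast; ring
      rw [e, norm_mul, norm_mul]
      refine mul_le_mul ?_ (abel hχ hg hg0 (fun m n h => wt_anti (by gcongr))
        (fun n => wt_nonneg _) (wt_le (by positivity)) K) (norm_nonneg _) hL0
      rw [norm_real]
      exact (mul_le_of_le_one_right (norm_nonneg _) (χ.norm_le_one _)).trans (hL a)
    · rw [hf a (by omega)]; simp
  refine (norm_sum_le_of_le _ fun a _ => h1 a).trans ?_
  rw [← sum_filter, sum_const, nsmul_eq_mul]
  gcongr
  have : (filter (fun a => a ≤ Y) (Icc 1 K)) ⊆ Icc 1 Y := fun a ha => by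
    rw [mem_filter, mem_Icc] at ha; exact mem_Icc.2 ⟨ha.1.1, ha.2⟩
  simpa using card_le_card this

def lo (U : ℕ) (f : ArithmeticFunction ℝ) : ArithmeticFunction ℝ :=
  ⟨fun n => if n ≤ U then f n else 0, by simp⟩

lemma lo_apply (U : ℕ) (f : ArithmeticFunction ℝ) (n : ℕ) :
    lo U f n = if n ≤ U then f n else 0 := rfl

def mur : ArithmeticFunction ℝ := ((μ : ArithmeticFunction ℤ) : ArithmeticFunction ℝ)
def zer : ArithmeticFunction ℝ := ((ζ : ArithmeticFunction ℕ) : ArithmeticFunction ℝ)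

lemma mur_le (n : ℕ) : |mur n| ≤ 1 := by
  rw [mur, intCoe_apply]; exact_mod_cast abs_moebius_le_one

lemma vaughan_id (U : ℕ) : Λ = lo U Λ + lo U mur * ArithmeticFunction.log - lo U mur * lo U Λ * zer +
    (mur - lo U mur) * ((Λ - lo U Λ) * zer) := by
  have h1 : mur * zer = 1 := coe_moebius_mul_coe_zeta
  have h2 : Λ * zer = ArithmeticFunction.log := vonMangoldt_mul_zeta
  linear_combination (lo U Λ - Λ) * h1 + lo U mur * h2

lemma TT_add {q : ℕ} (χ : DirichletCharacter ℂ q) (X : ℝ) (f g : ArithmeticFunction ℝ) :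
    TT χ X (f + g) = TT χ X f + TT χ X g := by
  simp only [TT, WS, ← sum_add_distrib]
  refine sum_congr rfl fun n _ => ?_
  rw [ArithmeticFunction.add_apply]; push_cast; ring

lemma vaughan {q : ℕ} [NeZero q] {χ : DirichletCharacter ℂ q} (hχ : χ ≠ 1) {X : ℝ} {U : ℕ}
    (hU : 1 ≤ U) (hUX : U ≤ X) (hX : 1 ≤ Real.log X) :
    ‖TT χ X Λ‖ ≤ 10 * q * U ^ 2 * Real.log X +
      ‖TT χ X ((mur - lo U mur) * ((Λ - lo U Λ) * zer))‖ := by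
  have hU1 : (1 : ℝ) ≤ U := by exact_mod_cast hU
  have hX0 : 0 < X := by linarith
  have hq1 : (1 : ℝ) ≤ q := by exact_mod_cast NeZero.one_le
  set l := Real.log X
  have hUl : Real.log U ≤ l := Real.log_le_log (by linarith) hUX
  have hU0 : 0 ≤ Real.log U := Real.log_nonneg hU1
  set R := TT χ X ((mur - lo U mur) * ((Λ - lo U Λ) * zer))
  have e : TT χ X Λ + TT χ X (lo U mur * lo U Λ * zer) =
      TT χ X (lo U Λ) + TT χ X (lo U mur * ArithmeticFunction.log) + R := by
    simp only [R, ← TT_add]; congr 1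
    linear_combination vaughan_id U
  have h1 : ‖TT χ X (lo U Λ)‖ ≤ U * l := by
    have : ∀ n ∈ Icc 1 ⌊X⌋₊, ‖χ n * ((lo U Λ n : ℝ) : ℂ) * (wt (n / X) : ℂ)‖ ≤
        if n ≤ U then l else 0 := fun n hn => by
      rw [lo_apply]
      split_ifs with h
      · rw [norm_mul, norm_mul, norm_real, norm_real, Real.norm_of_nonneg vonMangoldt_nonneg,
          Real.norm_of_nonneg (wt_nonneg _)]
        have h1 : Λ n ≤ l := vonMangoldt_le_log.trans ((Real.log_le_log
          (by exact_mod_cast (mem_Icc.1 hn).1) (by exact_mod_cast h)).trans hUl)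
        calc _ ≤ 1 * l * 1 := by
              gcongr
              · exact wt_nonneg _
              · exact χ.norm_le_one _
              · exact wt_le (by positivity)
          _ = l := by ring
      · simp
    refine (norm_sum_le_of_le _ this).trans ?_
    rw [← sum_filter, sum_const, nsmul_eq_mul]
    gcongr
    have : (filter (fun a => a ≤ U) (Icc 1 ⌊X⌋₊)) ⊆ Icc 1 U := fun a ha => by
      rw [mem_filter, mem_Icc] at ha; exact mem_Icc.2 ⟨ha.1.1, ha.2⟩
    simpa using card_le_card this
  have hlm : ∀ a, |lo U mur a| ≤ 1 := fun a => by
    rw [lo_apply]; split_ifs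
    · exact mur_le a
    · simp
  have h2 : ‖TT χ X (lo U mur * ArithmeticFunction.log)‖ ≤ U * (1 * (3 * q * l)) := by
    refine (typeI hχ hX0 _ _ U (fun a h => by rw [lo_apply, if_neg (by omega)]) hlm ?_).trans ?_
    · intro m n h
      rw [log_apply, log_apply]
      rcases Nat.eq_zero_or_pos m with rfl | hm
      · simpa using Real.log_natCast_nonneg n
      · exact Real.log_le_log (by exact_mod_cast hm) (by exact_mod_cast h)
    · rw [log_apply]
      have : 0 < ⌊X⌋₊ := Nat.floor_pos.2 (by linarith)
      gcongr
      exact Real.log_le_log (by exact_mod_cast this) (Nat.floor_le hX0.le)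
  have h3 : ‖TT χ X (lo U mur * lo U Λ * zer)‖ ≤ (U * U : ℕ) * (2 * l * (3 * q * 1)) := by
    have hz : ∀ a, U * U < a → (lo U mur * lo U Λ) a = 0 := fun a ha => by
      rw [mul_apply]
      refine sum_eq_zero fun x hx => ?_
      have := (Nat.mem_divisorsAntidiagonal.1 hx).1
      rw [lo_apply, lo_apply]
      by_cases h1 : x.1 ≤ U
      · by_cases h2 : x.2 ≤ U
        · have := Nat.mul_le_mul h1 h2; omega
        · rw [if_neg h2, mul_zero]
      · rw [if_neg h1, zero_mul]
    refine (typeI hχ hX0 (L := 2 * l) _ zer (U * U) hz ?_ ?_).trans ?_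
    · intro a
      rcases lt_or_ge (U * U) a with h | h
      · rw [hz a h, abs_zero]; positivity
      rcases Nat.eq_zero_or_pos a with rfl | ha
      · simp; positivity
      have : |(lo U mur * lo U Λ) a| ≤ (zer * Λ) a := by
        rw [mul_apply, mul_apply]
        refine (abs_sum_le_sum_abs _ _).trans (sum_le_sum fun x hx => ?_)
        have h5 := (Nat.mem_divisorsAntidiagonal.1 hx)
        have hx1 : x.1 ≠ 0 := by rintro h6; rw [h6, zero_mul] at h5; exact h5.2 h5.1.symm
        rw [abs_mul, zer, natCoe_apply, zeta_apply, if_neg hx1]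
        refine mul_le_mul (by simpa using hlm x.1) ?_ (abs_nonneg _) (by simp)
        rw [lo_apply]; split_ifs
        · rw [abs_of_nonneg vonMangoldt_nonneg]
        · simpa using vonMangoldt_nonneg
      rw [mul_comm zer, zer, vonMangoldt_mul_zeta, log_apply] at this
      refine this.trans ?_
      have h7 : Real.log a ≤ Real.log (U * U) := Real.log_le_log (by exact_mod_cast ha)
        (by exact_mod_cast h)
      rw [Real.log_mul (by linarith) (by linarith)] at h7
      linarith
    · intro m n h
      rw [zer, natCoe_apply, natCoe_apply, zeta_apply, zeta_apply]
      split_ifs <;> simp; omega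
    · gcongr
      rw [zer, natCoe_apply, zeta_apply]; split_ifs <;> simp
  have e2 : TT χ X Λ = TT χ X (lo U Λ) + TT χ X (lo U mur * ArithmeticFunction.log) + R -
      TT χ X (lo U mur * lo U Λ * zer) := by rw [← e]; ring
  rw [e2]
  refine (norm_sub_le _ _).trans ?_
  have := norm_add_le (TT χ X (lo U Λ) + TT χ X (lo U mur * ArithmeticFunction.log)) R
  have := norm_add_le (TT χ X (lo U Λ)) (TT χ X (lo U mur * ArithmeticFunction.log))
  push_cast at h3
  have hl0 : (0 : ℝ) ≤ l := by linarith
  have a1 : U * l ≤ q * U ^ 2 * l := by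
    gcongr; nlinarith
  have a2 : U * (1 * (3 * q * l)) ≤ 3 * (q * U ^ 2 * l) := by
    have : (U : ℝ) * (q * l) ≤ U ^ 2 * (q * l) := by gcongr; nlinarith
    linarith
  nlinarith
end

section
open Complex Finset ArithmeticFunction
open scoped ArithmeticFunction.zeta ArithmeticFunction.Moebius

noncomputable def fV (U : ℕ) : ArithmeticFunction ℝ := mur - lo U mur
noncomputable def gV (U : ℕ) : ArithmeticFunction ℝ := (Λ - lo U Λ) * zer

lemma AF_sub (f g : ArithmeticFunction ℝ) (n : ℕ) : (f - g) n = f n - g n := by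
  have h : ((f - g) + g) n = f n := by rw [sub_add_cancel]
  rw [ArithmeticFunction.add_apply] at h; linarith

lemma fV_le (U a : ℕ) : |fV U a| ≤ 1 := by
  rw [fV, AF_sub, lo_apply]; split_ifs
  · simp
  · simpa using mur_le a

lemma fV_zero {U a : ℕ} (h : a ≤ U) : fV U a = 0 := by
  rw [fV, AF_sub, lo_apply, if_pos h, sub_self]

lemma lam_sub (U n : ℕ) : 0 ≤ (Λ - lo U Λ) n ∧ (Λ - lo U Λ) n ≤ Λ n ∧
    (n ≤ U → (Λ - lo U Λ) n = 0) := by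
  rw [AF_sub, lo_apply]; split_ifs with h
  · simp [vonMangoldt_nonneg]
  · simp [vonMangoldt_nonneg, h]

lemma zer_apply {n : ℕ} (h : n ≠ 0) : zer n = 1 := by
  rw [zer, natCoe_apply, zeta_apply, if_neg h]; simp

lemma gV_bd (U b : ℕ) : 0 ≤ gV U b ∧ gV U b ≤ Real.log b ∧ (b ≤ U → gV U b = 0) := by
  have hx2 : ∀ x ∈ b.divisorsAntidiagonal, zer x.2 = 1 ∧ x.1 ≤ b := fun x hx => by
    have h5 := Nat.mem_divisorsAntidiagonal.1 hx
    have h6 : x.2 ≠ 0 := by rintro h6; rw [h6, mul_zero] at h5; exact h5.2 h5.1.symm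
    exact ⟨zer_apply h6, by rw [← h5.1]; exact Nat.le_mul_of_pos_right _ (Nat.pos_of_ne_zero h6)⟩
  refine ⟨?_, ?_, fun h => ?_⟩
  · rw [gV, mul_apply]
    refine sum_nonneg fun x hx => ?_
    rw [(hx2 x hx).1, mul_one]; exact (lam_sub U _).1
  · rw [← log_apply, ← vonMangoldt_mul_zeta, gV, mul_apply, mul_apply]
    refine sum_le_sum fun x hx => ?_
    change _ ≤ Λ x.1 * zer x.2
    rw [(hx2 x hx).1, mul_one, mul_one]; exact (lam_sub U _).2.1
  · rw [gV, mul_apply]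
    refine sum_eq_zero fun x hx => ?_
    rw [(lam_sub U _).2.2 ((hx2 x hx).2.trans h), zero_mul]

noncomputable def SQ (Q : ℕ) (F : ∀ q, DirichletCharacter ℂ q → ℝ) : ℝ :=
  ∑ q ∈ Icc 2 Q, ((q : ℝ) / q.totient) * ∑ χ ∈ PCs q, F q χ

lemma SQ_mono {Q : ℕ} {F G : ∀ q, DirichletCharacter ℂ q → ℝ}
    (h : ∀ q χ, F q χ ≤ G q χ) : SQ Q F ≤ SQ Q G :=
  sum_le_sum fun q _ => mul_le_mul_of_nonneg_left (sum_le_sum fun χ _ => h q χ) (by positivity)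

lemma SQ_sum {Q : ℕ} {ι : Type*} (s : Finset ι) (F : ι → ∀ q, DirichletCharacter ℂ q → ℝ) :
    SQ Q (fun q χ => ∑ j ∈ s, F j q χ) = ∑ j ∈ s, SQ Q (F j) := by
  simp only [SQ]
  rw [sum_comm]
  refine sum_congr rfl fun q _ => ?_
  rw [sum_comm, mul_sum]

lemma typeII_j {X M : ℝ} {U Q : ℕ} (hU : 1 ≤ U) (hUX : U ≤ X) (hX : 1 ≤ Real.log X) (hQ : 1 ≤ Q)
    (hM : 1 ≤ M) (FA FB : Finset ℕ)
    (hA : ∀ a ∈ FA, M ≤ a ∧ a < 2 * M) (hB : ∀ b ∈ FB, U < b ∧ b * M ≤ X) (hMU : U ≤ 2 * M) :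
    SQ Q (fun q χ => ‖∑ a ∈ FA, ∑ b ∈ FB,
      (fV U a : ℂ) * χ a * (gV U b * χ b) * (wt (a * b / X) : ℂ)‖) ≤
      52 * Real.log X ^ 2 * (√X * Q ^ 2 + Q * X / √U + X) := by
  have hU1 : (1 : ℝ) ≤ U := by exact_mod_cast hU
  have hX0 : 0 < X := by linarith
  set l := Real.log X
  rcases FB.eq_empty_or_nonempty with rfl | ⟨b₀, hb₀⟩
  · simp [SQ]; positivity
  have hUM : U * M ≤ X := by
    refine le_trans ?_ (hB b₀ hb₀).2
    gcongr; exact_mod_cast (hB b₀ hb₀).1.le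
  have hMB : 1 ≤ X / M := (one_le_div (by linarith)).2 (by nlinarith)
  have hFB : ∀ b ∈ FB, 0 < b ∧ (b : ℝ) ≤ X / M := fun b hb => by
    refine ⟨by have := (hB b hb).1; omega, (le_div_iff₀ (by linarith)).2 (hB b hb).2⟩
  have hFA : ∀ a ∈ FA, 0 < a ∧ (a : ℝ) ≤ 2 * M := fun a ha => by
    refine ⟨?_, (hA a ha).2.le⟩
    have : (0 : ℝ) < a := by linarith [(hA a ha).1]
    exact_mod_cast this
  have hcard : ∀ (F : Finset ℕ) (Y : ℝ), 0 ≤ Y → (∀ a ∈ F, 0 < a ∧ (a : ℝ) ≤ Y) →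
      (F.card : ℝ) ≤ Y := fun F Y hY h => by
    have : F ⊆ Icc 1 ⌊Y⌋₊ := fun a ha => mem_Icc.2 ⟨(h a ha).1, Nat.le_floor (h a ha).2⟩
    have h2 := card_le_card this
    rw [Nat.card_Icc, Nat.add_sub_cancel] at h2
    exact (Nat.cast_le.2 h2).trans (Nat.floor_le hY)
  have key := typeII FA FB (fun a => (fV U a : ℂ)) (fun b => (gV U b : ℂ)) hQ hX0 hX
    (by linarith : 1 ≤ 2 * M) hMB hFA hFB
  have s1 : ∑ a ∈ FA, ‖(fV U a : ℂ)‖ ^ 2 ≤ 2 * M := by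
    refine le_trans (sum_le_card_nsmul _ _ 1 fun a _ => ?_) ?_
    · rw [norm_real]; exact pow_le_one₀ (norm_nonneg _) (fV_le U a)
    · simpa using hcard FA _ (by linarith) hFA
  have s2 : ∑ b ∈ FB, ‖(gV U b : ℂ)‖ ^ 2 ≤ X / M * l ^ 2 := by
    refine le_trans (sum_le_card_nsmul _ _ (l ^ 2) fun b hb => ?_) ?_
    · rw [norm_real, Real.norm_of_nonneg (gV_bd U b).1]
      refine pow_le_pow_left₀ (gV_bd U b).1 ((gV_bd U b).2.1.trans ?_) 2
      refine Real.log_le_log (by exact_mod_cast (hFB b hb).1) ((hFB b hb).2.trans ?_)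
      exact div_le_self hX0.le hM
    · rw [nsmul_eq_mul]; gcongr; exact hcard FB _ (by linarith) hFB
  refine key.trans ?_
  have h0 : (0 : ℝ) ≤ l := by linarith
  have hM0 : 0 < M := by linarith
  rw [← Real.sqrt_mul (by positivity)]
  have b1 : √(((Q ^ 2 + 13 * (2 * M)) * ∑ a ∈ FA, ‖(fV U a : ℂ)‖ ^ 2) *
      ((Q ^ 2 + 13 * (X / M)) * ∑ b ∈ FB, ‖(gV U b : ℂ)‖ ^ 2)) ≤
      l * (26 * (√X * Q ^ 2 + Q * X / √U + X)) := by
    refine Real.sqrt_le_iff.2 ⟨by positivity, ?_⟩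
    calc _ ≤ (Q ^ 2 + 13 * (2 * M)) * (2 * M) * ((Q ^ 2 + 13 * (X / M)) * (X / M * l ^ 2)) := by
          gcongr
      _ = l ^ 2 * (2 * X * (Q ^ 4 + Q ^ 2 * (13 * (X / M)) + Q ^ 2 * (26 * M) + 338 * X)) := by
          field_simp; ring
      _ ≤ l ^ 2 * (2 * X * (Q ^ 4 + Q ^ 2 * (26 * (X / U)) + Q ^ 2 * (26 * (X / U)) + 338 * X)) := by
          have e1 : 13 * (X / M) ≤ 26 * (X / U) := by
            rw [mul_div_assoc', mul_div_assoc', div_le_div_iff₀ hM0 (by linarith)]; nlinarith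
          have e2 : M ≤ X / U := (le_div_iff₀ (by linarith)).2 (by linarith)
          gcongr
      _ ≤ (l * (26 * (√X * Q ^ 2 + Q * X / √U + X))) ^ 2 := by
          rw [mul_pow]
          refine mul_le_mul_of_nonneg_left ?_ (by positivity)
          have r1 : √X ^ 2 = X := Real.sq_sqrt hX0.le
          have r2 : (Q * X / √U) ^ 2 = Q ^ 2 * X * (X / U) := by
            rw [div_pow, Real.sq_sqrt (by linarith)]; field_simp
          have p1 : 0 ≤ √X * Q ^ 2 := by positivity
          have p2 : 0 ≤ Q * X / √U := by positivity
          have r3 : (√X * Q ^ 2) ^ 2 = X * Q ^ 4 := by rw [mul_pow, r1]; ring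
          nlinarith [mul_nonneg p1 p2, mul_nonneg p1 hX0.le, mul_nonneg p2 hX0.le, sq_nonneg (√X * Q ^ 2),
            sq_nonneg (Q * X / √U)]
  calc _ ≤ 2 * l * (l * (26 * (√X * Q ^ 2 + Q * X / √U + X))) := by gcongr
    _ = _ := by ring

lemma typeII_sum {X : ℝ} {U Q : ℕ} (hU : 1 ≤ U) (hUX : U ≤ X) (hX : 1 ≤ Real.log X) (hQ : 1 ≤ Q) :
    SQ Q (fun q χ => ‖TT χ X (fV U * gV U)‖) ≤
      156 * Real.log X ^ 3 * (√X * Q ^ 2 + Q * X / √U + X) := by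
  have hU1 : (1 : ℝ) ≤ U := by exact_mod_cast hU
  have hX0 : 0 < X := by linarith
  set l := Real.log X with hl
  set K := ⌊X⌋₊ with hK
  have hK0 : K ≠ 0 := (Nat.floor_pos.2 (by linarith)).ne'
  set J := Nat.log 2 K
  have hJ : (J + 1 : ℝ) ≤ 3 * l := by
    have h1 : (2 : ℝ) ^ J ≤ X := by
      have : ((2 ^ J : ℕ) : ℝ) ≤ K := by exact_mod_cast Nat.pow_log_le_self 2 hK0
      push_cast at this
      exact this.trans (Nat.floor_le hX0.le)
    have h2 := Real.log_le_log (by positivity) h1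
    rw [Real.log_pow] at h2
    have := Real.log_two_gt_d9
    have h0 : (0 : ℝ) ≤ J := by positivity
    nlinarith
  set P := 52 * l ^ 2 * (√X * Q ^ 2 + Q * X / √U + X)
  have hP : 0 ≤ P := by positivity
  let FA : ℕ → Finset ℕ := fun j => (Icc 1 K).filter fun a => Nat.log 2 a = j
  let FB : ℕ → Finset ℕ := fun j => (Icc 1 K).filter fun b => U < b ∧ (b : ℝ) * 2 ^ j ≤ X
  have e : ∀ q (χ : DirichletCharacter ℂ q), TT χ X (fV U * gV U) = ∑ j ∈ range (J + 1),
      ∑ a ∈ FA j, ∑ b ∈ FB j, (fV U a : ℂ) * χ a * (gV U b * χ b) * (wt (a * b / X) : ℂ) := by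
    intro q χ
    rw [TT_mul χ hX0, ← sum_fiberwise_of_maps_to (t := range (J + 1)) (g := fun a => Nat.log 2 a)]
    · refine sum_congr rfl fun j _ => sum_congr rfl fun a ha => ?_
      rw [sum_filter]
      refine sum_congr rfl fun b hb => ?_
      split_ifs with h
      · rfl
      · rw [mem_filter, mem_Icc] at ha
        by_cases hb' : U < b
        · have h1 : X < b * 2 ^ j := by by_contra h3; exact h ⟨hb', not_lt.1 h3⟩
          have h2 : (2 : ℝ) ^ j ≤ a := by
            rw [← ha.2]; exact_mod_cast Nat.pow_log_le_self 2 (by omega)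
          have h3 : X ≤ a * b := h1.le.trans (by rw [mul_comm]; gcongr)
          have h4 := (one_le_div hX0).2 h3
          have : wt (a * b / X) = 0 := max_eq_left (by linarith)
          rw [this]; simp
        · rw [(gV_bd U b).2.2 (by omega)]; simp
    · intro a ha
      exact mem_range.2 (Nat.lt_succ_of_le (Nat.log_mono_right (mem_Icc.1 ha).2))
  calc _ ≤ SQ Q (fun q χ => ∑ j ∈ range (J + 1), ‖∑ a ∈ FA j, ∑ b ∈ FB j,
          (fV U a : ℂ) * χ a * (gV U b * χ b) * (wt (a * b / X) : ℂ)‖) :=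
        SQ_mono fun q χ => by rw [e]; exact norm_sum_le _ _
    _ = ∑ j ∈ range (J + 1), SQ Q (fun q χ => ‖∑ a ∈ FA j, ∑ b ∈ FB j,
          (fV U a : ℂ) * χ a * (gV U b * χ b) * (wt (a * b / X) : ℂ)‖) := SQ_sum _ _
    _ ≤ ∑ j ∈ range (J + 1), P := by
        refine sum_le_sum fun j _ => ?_
        have hA : ∀ a ∈ FA j, (2 : ℝ) ^ j ≤ a ∧ (a : ℝ) < 2 * 2 ^ j := fun a ha => by
          rw [mem_filter, mem_Icc] at ha
          rw [← ha.2]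
          refine ⟨by exact_mod_cast Nat.pow_log_le_self 2 (by omega), ?_⟩
          have := Nat.lt_pow_succ_log_self (b := 2) (by norm_num) a
          rw [pow_succ'] at this
          exact_mod_cast this
        by_cases hMU : (U : ℝ) ≤ 2 * 2 ^ j
        · exact typeII_j hU hUX hX hQ (one_le_pow₀ (by norm_num)) (FA j) (FB j) hA
            (fun b hb => (mem_filter.1 hb).2) hMU
        · have : ∀ q (χ : DirichletCharacter ℂ q), ‖∑ a ∈ FA j, ∑ b ∈ FB j,
              (fV U a : ℂ) * χ a * (gV U b * χ b) * (wt (a * b / X) : ℂ)‖ = 0 := fun q χ => by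
            rw [norm_eq_zero]
            refine sum_eq_zero fun a ha => sum_eq_zero fun b _ => ?_
            have h1 := (hA a ha).2.trans (not_le.1 hMU)
            rw [fV_zero (by exact_mod_cast h1.le)]; simp
          simp only [this, SQ, sum_const_zero, mul_zero]; exact hP
    _ = (J + 1) * P := by rw [sum_const, card_range]; simp
    _ ≤ 3 * l * P := by gcongr
    _ = _ := by simp only [P]; ring
end

section
open Complex Finset ArithmeticFunction Filter

lemma dyad {g : ℕ → ℝ} (hg : ∀ q, 0 ≤ g q) {c1 c2 c3 : ℝ} (h1 : 0 ≤ c1) (h2 : 0 ≤ c2) (h3 : 0 ≤ c3)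
    (Q0 : ℕ) (hG : ∀ Q : ℕ, 1 ≤ Q → ∑ q ∈ Ioc Q0 Q, g q ≤ c1 * Q ^ 2 + c2 * Q + c3) (D : ℕ) :
    ∑ q ∈ Ioc Q0 D, g q / q ≤ 2 * c1 * D + c2 * (1 + Real.log (D + 1)) + 2 * c3 / (Q0 + 1) := by
  rcases lt_or_ge D Q0 with hD | hD
  · rw [Ioc_eq_empty (by omega), sum_empty]
    have : 0 ≤ Real.log (D + 1) := Real.log_nonneg (by linarith [(Nat.cast_nonneg D : (0:ℝ) ≤ D)])
    positivity
  have key : ∑ q ∈ Ioc Q0 D, g q / q ≤ (∑ q ∈ Ioc Q0 D, g q) / (D + 1) + c1 * (D - Q0) +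
      c2 * (Real.log (D + 1) - Real.log (Q0 + 1)) + c3 * (1 / (Q0 + 1) - 1 / (D + 1)) := by
    induction D, hD using Nat.le_induction with
    | base => simp
    | succ D hD ih =>
      have e : Ioc Q0 (D + 1) = insert (D + 1) (Ioc Q0 D) := by
        ext x; simp only [mem_Ioc, mem_insert]; omega
      have hn : (D + 1) ∉ Ioc Q0 D := by simp
      have hb := hG (D + 1) (by omega)
      rw [e, sum_insert hn] at hb ⊢
      rw [sum_insert hn]
      set S := ∑ q ∈ Ioc Q0 D, g q
      push_cast at hb ⊢
      have hd : (0 : ℝ) ≤ D := Nat.cast_nonneg D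
      have hl := Real.one_sub_inv_le_log_of_pos (x := ((D : ℝ) + 1 + 1) / (D + 1)) (by positivity)
      rw [Real.log_div (by positivity) (by positivity)] at hl
      have hl2 : 1 - (((D : ℝ) + 1 + 1) / (D + 1))⁻¹ = 1 / (D + 1 + 1) := by field_simp; ring
      rw [hl2] at hl
      have hx := mul_le_mul_of_nonneg_left hl h2
      have hy : (g (D + 1) + S) / ((D + 1) * (D + 1 + 1)) ≤
          c1 + c2 * (1 / (D + 1 + 1)) + c3 * (1 / (D + 1) - 1 / (D + 1 + 1)) := by
        calc _ ≤ (c1 * (D + 1) ^ 2 + c2 * (D + 1) + c3) / ((D + 1) * (D + 1 + 1)) := by gcongr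
          _ = c1 * ((D + 1) / (D + 1 + 1)) + c2 * (1 / (D + 1 + 1)) +
              c3 * (1 / (D + 1) - 1 / (D + 1 + 1)) := by field_simp; ring
          _ ≤ _ := by
            gcongr
            exact mul_le_of_le_one_right h1 ((div_le_one (by positivity)).2 (by linarith))
      have hz : g (D + 1) / (D + 1) + S / (D + 1) = (g (D + 1) + S) / (D + 1 + 1) +
          (g (D + 1) + S) / ((D + 1) * (D + 1 + 1)) := by field_simp
      linarith
  refine key.trans ?_
  rcases Nat.eq_zero_or_pos D with rfl | hD0
  · have : Q0 = 0 := by omega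
    subst this; simp; linarith
  have h5 : (∑ q ∈ Ioc Q0 D, g q) / (D + 1) ≤ c1 * D + c2 + c3 / (Q0 + 1) := by
    calc _ ≤ (c1 * D ^ 2 + c2 * D + c3) / (D + 1) := by gcongr; exact hG D hD0
      _ ≤ c1 * D + c2 + c3 / (D + 1) := by
        rw [add_div, add_div]
        gcongr
        · rw [div_le_iff₀ (by positivity)]; nlinarith [mul_nonneg h1 (Nat.cast_nonneg (α := ℝ) D)]
        · rw [div_le_iff₀ (by positivity)]; nlinarith
      _ ≤ _ := by gcongr
  have h6 : 0 ≤ Real.log (Q0 + 1) := Real.log_nonneg (by linarith [(Nat.cast_nonneg Q0 : (0:ℝ) ≤ Q0)])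
  have h7 : c1 * (D - Q0 : ℝ) ≤ c1 * D := by gcongr; linarith [(Nat.cast_nonneg Q0 : (0:ℝ) ≤ Q0)]
  have h8 : 0 ≤ c3 / (D + 1 : ℝ) := by positivity
  have h9 := mul_nonneg h2 h6
  have e1 : c3 * (1 / (Q0 + 1 : ℝ) - 1 / (D + 1)) = c3 / (Q0 + 1) - c3 / (D + 1) := by ring
  have e2 : 2 * c3 / (Q0 + 1 : ℝ) = 2 * (c3 / (Q0 + 1)) := by ring
  rw [e1, e2]
  linarith

lemma PC_ne_one {q : ℕ} (hq : 2 ≤ q) {χ : DirichletCharacter ℂ q} (h : χ ∈ PCs q) : χ ≠ 1 := by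
  rintro rfl
  haveI : NeZero q := ⟨by omega⟩
  have h1 := mem_PCs.1 h
  have := DirichletCharacter.conductor_one (R := ℂ) (n := q)
  rw [DirichletCharacter.isPrimitive_def] at h1
  omega

lemma PC_card (q : ℕ) [NeZero q] : ((PCs q).card : ℝ) ≤ q.totient := by
  have := card_le_univ (PCs q)
  rw [← Nat.card_eq_fintype_card, DirichletCharacter.card_eq_totient_of_hasEnoughRootsOfUnity] at this
  exact_mod_cast this

lemma prim_BV (A : ℕ) : ∃ C X0 : ℝ, 0 < C ∧ ∀ X : ℝ, X0 ≤ X → ∀ D : ℕ,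
    (D : ℝ) * Real.log X ^ (3 * A + 9) ≤ √X →
    ∑ q ∈ Icc 2 D, (1 / (q.totient : ℝ)) * ∑ χ ∈ PCs q, ‖TT χ X Λ‖ ≤ C * X / Real.log X ^ A := by
  obtain ⟨C, hC, hSW⟩ := SW (2 * A + 3) (A + 3)
  have hlit : ∀ᶠ X : ℝ in atTop, ‖Real.log X ^ (2 * A + 8)‖ ≤ 1 / 2 * ‖id X‖ :=
    (Real.isLittleO_pow_log_id_atTop).bound (by norm_num)
  obtain ⟨X0, hX0⟩ := (hlit.and ((eventually_ge_atTop 2).and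
    (Real.tendsto_log_atTop.eventually_ge_atTop 2))).exists_forall_of_atTop
  refine ⟨C + 2000, X0, by positivity, fun X hX D hD => ?_⟩
  obtain ⟨a1, a2, a3⟩ := hX0 X hX
  set l := Real.log X with hl
  have hXp : 0 < X := by linarith
  rw [Real.norm_of_nonneg (by positivity), id, Real.norm_of_nonneg hXp.le] at a1
  set U := ⌈l ^ (2 * A + 8)⌉₊
  set Q0 := ⌊l ^ (A + 3)⌋₊
  have hl1 : 1 ≤ l := by linarith
  have hU1 : l ^ (2 * A + 8) ≤ U := Nat.le_ceil _
  have hU2 : (U : ℝ) ≤ 2 * l ^ (2 * A + 8) := by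
    have := Nat.ceil_lt_add_one (show 0 ≤ l ^ (2 * A + 8) by positivity)
    have := one_le_pow₀ hl1 (n := 2 * A + 8)
    linarith
  have hU3 : 1 ≤ U := Nat.one_le_iff_ne_zero.2 (Nat.ceil_pos.2 (by positivity)).ne'
  have hUX : U ≤ X := by linarith
  have hQ1 : (Q0 : ℝ) ≤ l ^ (A + 3) := Nat.floor_le (by positivity)
  have hQ2 : l ^ (A + 3) ≤ Q0 + 1 := (Nat.lt_floor_add_one _).le
  -- small
  have small : ∀ q ∈ Icc 2 Q0, (1 / (q.totient : ℝ)) * ∑ χ ∈ PCs q, ‖TT χ X Λ‖ ≤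
      C * X / l ^ (2 * A + 3) := by
    intro q hq
    rw [mem_Icc] at hq
    haveI : NeZero q := ⟨by omega⟩
    have ht : (0 : ℝ) < q.totient := by exact_mod_cast Nat.totient_pos.2 (by omega)
    have : ∑ χ ∈ PCs q, ‖TT χ X Λ‖ ≤ q.totient * (C * X / l ^ (2 * A + 3)) := by
      refine (sum_le_card_nsmul _ _ (C * X / l ^ (2 * A + 3)) fun χ hχ => ?_).trans ?_
      · exact hSW q χ X (mem_PCs.1 hχ) (PC_ne_one hq.1 hχ) a3 hXp
          (le_trans (by exact_mod_cast hq.2) hQ1)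
      · rw [nsmul_eq_mul]; gcongr; exact_mod_cast PC_card q
    calc _ ≤ (1 / (q.totient : ℝ)) * (q.totient * (C * X / l ^ (2 * A + 3))) := by gcongr
      _ = _ := by field_simp
  -- large
  let g : ℕ → ℝ := fun q => if 2 ≤ q then
    ((q : ℝ) / q.totient) * ∑ χ ∈ PCs q, ‖TT χ X (fV U * gV U)‖ else 0
  have hg : ∀ q, 0 ≤ g q := fun q => by simp only [g]; split_ifs <;> positivity
  have large : ∀ q ∈ Ioc Q0 D, 2 ≤ q → (1 / (q.totient : ℝ)) * ∑ χ ∈ PCs q, ‖TT χ X Λ‖ ≤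
      10 * D * U ^ 2 * l + g q / q := by
    intro q hq h2
    haveI : NeZero q := ⟨by omega⟩
    have hqD : (q : ℝ) ≤ D := by exact_mod_cast (mem_Ioc.1 hq).2
    have hq0 : (0 : ℝ) < q := by exact_mod_cast (by omega : 0 < q)
    have ht : (0 : ℝ) < q.totient := by exact_mod_cast Nat.totient_pos.2 (by omega)
    have : ∑ χ ∈ PCs q, ‖TT χ X Λ‖ ≤ q.totient * (10 * D * U ^ 2 * l) +
        ∑ χ ∈ PCs q, ‖TT χ X (fV U * gV U)‖ := by
      calc _ ≤ ∑ χ ∈ PCs q, (10 * D * U ^ 2 * l + ‖TT χ X (fV U * gV U)‖) := by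
            refine sum_le_sum fun χ hχ => ?_
            have := vaughan (PC_ne_one h2 hχ) hU3 hUX hl1
            refine this.trans ?_
            gcongr; rfl
        _ ≤ _ := by
            rw [sum_add_distrib, sum_const, nsmul_eq_mul]; gcongr; exact_mod_cast PC_card q
    calc _ ≤ (1 / (q.totient : ℝ)) * (q.totient * (10 * D * U ^ 2 * l) +
        ∑ χ ∈ PCs q, ‖TT χ X (fV U * gV U)‖) := by gcongr
      _ = _ := by simp only [g, if_pos h2]; field_simp
  have hG : ∀ Q : ℕ, 1 ≤ Q → ∑ q ∈ Ioc Q0 Q, g q ≤ (156 * l ^ 3 * √X) * Q ^ 2 +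
      (156 * l ^ 3 * (X / √U)) * Q + 156 * l ^ 3 * X := by
    intro Q hQ
    have h1 : ∑ q ∈ Ioc Q0 Q, g q ≤ ∑ q ∈ Icc 1 Q, g q :=
      sum_le_sum_of_subset_of_nonneg (fun x hx => by
        rw [mem_Ioc] at hx; exact mem_Icc.2 ⟨by omega, hx.2⟩) fun q _ _ => hg q
    have h2 : ∑ q ∈ Icc 1 Q, g q = SQ Q (fun q χ => ‖TT χ X (fV U * gV U)‖) := by
      have e : (Icc 1 Q).filter (fun q => 2 ≤ q) = Icc 2 Q := by
        ext x; simp only [mem_filter, mem_Icc]; omega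
      rw [← sum_filter, e]; rfl
    have h3 := typeII_sum hU3 hUX hl1 hQ
    rw [← h2] at h3
    refine h1.trans (h3.trans (le_of_eq ?_))
    ring
  have hS := dyad hg (by positivity) (by positivity) (by positivity) Q0 hG D
  have hsplit : ∑ q ∈ Icc 2 D, (1 / (q.totient : ℝ)) * ∑ χ ∈ PCs q, ‖TT χ X Λ‖ ≤
      ∑ q ∈ Icc 2 Q0, C * X / l ^ (2 * A + 3) + ∑ q ∈ Ioc Q0 D, (10 * D * U ^ 2 * l + g q / q) := by
    calc _ ≤ ∑ q ∈ Icc 2 Q0 ∪ (Ioc Q0 D).filter (fun q => 2 ≤ q),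
          (1 / (q.totient : ℝ)) * ∑ χ ∈ PCs q, ‖TT χ X Λ‖ :=
          sum_le_sum_of_subset_of_nonneg (fun x hx => by
            simp only [mem_union, mem_Icc, mem_filter, mem_Ioc] at hx ⊢; omega)
            fun q _ _ => by positivity
      _ ≤ _ := by
        rw [sum_union]
        · refine add_le_add (sum_le_sum small) ?_
          calc _ ≤ ∑ q ∈ (Ioc Q0 D).filter (fun q => 2 ≤ q), (10 * D * U ^ 2 * l + g q / q) :=
                sum_le_sum fun q hq => large q (mem_filter.1 hq).1 (mem_filter.1 hq).2
            _ ≤ _ := sum_le_sum_of_subset_of_nonneg (filter_subset _ _) fun q _ _ => by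
                have := hg q; positivity
        · rw [disjoint_left]; intro x hx hy
          simp only [mem_Icc, mem_filter, mem_Ioc] at hx hy; omega
  have hc1 : ((Icc 2 Q0).card : ℝ) ≤ l ^ (A + 3) := by
    refine le_trans ?_ hQ1; rw [Nat.card_Icc]; exact_mod_cast (by omega)
  have hc2 : ((Ioc Q0 D).card : ℝ) ≤ D := by rw [Nat.card_Ioc]; exact_mod_cast (by omega)
  rw [sum_const, sum_add_distrib, sum_const, nsmul_eq_mul, nsmul_eq_mul] at hsplit
  refine hsplit.trans ?_
  have hl0 : (0:ℝ) < l := by linarith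
  have hsq : √X ^ 2 = X := Real.sq_sqrt hXp.le
  have hlA : 0 < l ^ A := by positivity
  have hD' : (D : ℝ) ≤ √X / l ^ (3 * A + 9) := (le_div_iff₀ (by positivity)).2 hD
  have hsX : 1 ≤ √X := Real.one_le_sqrt.2 (by linarith)
  have t1 : ((Icc 2 Q0).card : ℝ) * (C * X / l ^ (2 * A + 3)) ≤ C * (X / l ^ A) := by
    calc _ ≤ l ^ (A + 3) * (C * X / l ^ (2 * A + 3)) := by gcongr
      _ = _ := by field_simp; ring
  have pw : ∀ {m n : ℕ} , m ≤ n → l ^ m ≤ l ^ n := fun h => pow_le_pow_right₀ hl1 h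
  have t2 : ((Ioc Q0 D).card : ℝ) * (10 * D * U ^ 2 * l) ≤ 40 * (X / l ^ A) := by
    calc _ ≤ (√X / l ^ (3 * A + 9)) * (10 * (√X / l ^ (3 * A + 9)) * (2 * l ^ (2 * A + 8)) ^ 2 * l) := by
          gcongr; exact hc2.trans hD'
      _ = 40 * √X ^ 2 * (l ^ (4 * A + 17) / l ^ (6 * A + 18)) := by ring
      _ ≤ 40 * X * (1 / l ^ A) := by
          rw [hsq]; refine mul_le_mul_of_nonneg_left ?_ (by positivity)
          rw [div_le_div_iff₀ (by positivity) hlA, ← pow_add, one_mul]; exact pw (by omega)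
      _ = _ := by ring
  have t3 : 2 * (156 * l ^ 3 * √X) * D ≤ 312 * (X / l ^ A) := by
    calc _ ≤ 2 * (156 * l ^ 3 * √X) * (√X / l ^ (3 * A + 9)) := by gcongr
      _ = 312 * √X ^ 2 * (l ^ 3 / l ^ (3 * A + 9)) := by ring
      _ ≤ 312 * X * (1 / l ^ A) := by
          rw [hsq]; refine mul_le_mul_of_nonneg_left ?_ (by positivity)
          rw [div_le_div_iff₀ (by positivity) hlA, ← pow_add, one_mul]; exact pw (by omega)
      _ = _ := by ring
  have hlogD : 1 + Real.log (D + 1) ≤ 3 * l := by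
    have h1 : (D : ℝ) ≤ √X := hD'.trans (div_le_self (by positivity) (one_le_pow₀ hl1))
    have h2 : √X ≤ X := by nlinarith
    have h3 : Real.log (D + 1) ≤ Real.log (2 * X) := Real.log_le_log (by positivity) (by linarith)
    rw [Real.log_mul (by norm_num) (by linarith)] at h3
    have := Real.log_two_lt_d9
    linarith
  have hsU : l ^ (A + 4) ≤ √U := by
    refine Real.le_sqrt_of_sq_le (le_trans (le_of_eq ?_) hU1); ring
  have t4 : (156 * l ^ 3 * (X / √U)) * (1 + Real.log (D + 1)) ≤ 468 * (X / l ^ A) := by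
    calc _ ≤ (156 * l ^ 3 * (X / l ^ (A + 4))) * (3 * l) := by
          have : 0 ≤ Real.log (D + 1 : ℝ) := Real.log_nonneg (by linarith [Nat.cast_nonneg (α := ℝ) D])
          gcongr
      _ = _ := by field_simp; ring
  have t5 : 2 * (156 * l ^ 3 * X) / (Q0 + 1) ≤ 312 * (X / l ^ A) := by
    calc _ ≤ 2 * (156 * l ^ 3 * X) / l ^ (A + 3) := by gcongr
      _ = _ := by field_simp; ring
  have e : (C + 2000) * X / l ^ A = C * (X / l ^ A) + 2000 * (X / l ^ A) := by ring
  rw [e]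
  have : 0 ≤ X / l ^ A := by positivity
  linarith
end

section
open Complex Finset ArithmeticFunction Filter DirichletCharacter

noncomputable def Psi (X : ℝ) : ℝ := ∑ n ∈ Icc 1 ⌊X⌋₊, Λ n * wt (n / X)
noncomputable def PsiAP (X : ℝ) (d N : ℕ) : ℝ :=
  ∑ n ∈ Icc 1 ⌊X⌋₊, if (N : ZMod d) = n then Λ n * wt (n / X) else 0
noncomputable def Ed (X : ℝ) (d : ℕ) : ℝ := ∑ n ∈ Icc 1 ⌊X⌋₊ with ¬ n.Coprime d, Λ n

lemma Ed_le {X : ℝ} (hX : 0 < X) (hl : 1 ≤ Real.log X) {d : ℕ} (hd : 1 ≤ d) :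
    Ed X d ≤ 3 * d * Real.log X ^ 2 := by
  set l := Real.log X
  set K := ⌊X⌋₊
  have hX1 : 1 ≤ X := by
    by_contra h; have := Real.log_nonpos hX.le (not_le.1 h).le; linarith
  have hK0 : K ≠ 0 := (Nat.floor_pos.2 hX1).ne'
  set J := Nat.log 2 K
  have hJ : (J + 1 : ℝ) ≤ 3 * l := by
    have h1 : (2 : ℝ) ^ J ≤ X := by
      have : ((2 ^ J : ℕ) : ℝ) ≤ K := by exact_mod_cast Nat.pow_log_le_self 2 hK0
      push_cast at this
      exact this.trans (Nat.floor_le hX.le)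
    have h2 := Real.log_le_log (by positivity) h1
    rw [Real.log_pow] at h2
    have := Real.log_two_gt_d9
    have h0 : (0 : ℝ) ≤ J := by positivity
    nlinarith
  set T := (d.primeFactors ×ˢ range (J + 1)).image (fun x => x.1 ^ x.2)
  have hT : (T.card : ℝ) ≤ d * (3 * l) := by
    have h1 : T.card ≤ d.primeFactors.card * (J + 1) := by
      refine card_image_le.trans ?_; rw [card_product, card_range]
    have h2 : d.primeFactors.card ≤ d := by
      have : d.primeFactors ⊆ Icc 1 d := fun p hp => mem_Icc.2
        ⟨(Nat.prime_of_mem_primeFactors hp).one_lt.le, Nat.le_of_mem_primeFactors hp⟩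
      simpa using card_le_card this
    calc (T.card : ℝ) ≤ (d.primeFactors.card * (J + 1) : ℕ) := by exact_mod_cast h1
      _ = d.primeFactors.card * (J + 1 : ℝ) := by push_cast; ring
      _ ≤ _ := by gcongr
  have hterm : ∀ n ∈ (Icc 1 K).filter (fun n => ¬ n.Coprime d), Λ n ≤ if n ∈ T then l else 0 := by
    intro n hn
    rw [mem_filter, mem_Icc] at hn
    split_ifs with h
    · refine vonMangoldt_le_log.trans (Real.log_le_log (by exact_mod_cast hn.1.1) ?_)
      exact (Nat.cast_le.2 hn.1.2).trans (Nat.floor_le hX.le)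
    · by_contra h1
      have h2 : Λ n ≠ 0 := fun h3 => h1 h3.le
      rw [vonMangoldt_ne_zero_iff] at h2
      obtain ⟨p, k, hp, hk, rfl⟩ := (isPrimePow_nat_iff _).1 h2
      refine h (mem_image.2 ⟨(p, k), mem_product.2 ⟨?_, mem_range.2 (Nat.lt_succ_of_le ?_)⟩, rfl⟩)
      · refine Nat.mem_primeFactors.2 ⟨hp, ?_, by omega⟩
        by_contra h4
        exact hn.2 (Nat.Coprime.pow_left _ ((Nat.Prime.coprime_iff_not_dvd hp).2 h4))
      · refine Nat.le_log_of_pow_le (by norm_num) (le_trans ?_ hn.1.2)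
        exact Nat.pow_le_pow_left hp.two_le k
  refine (sum_le_sum hterm).trans ?_
  rw [← sum_filter, sum_const, nsmul_eq_mul]
  have h5 : ((filter (fun n => n ∈ T) ((Icc 1 K).filter (fun n => ¬ n.Coprime d))).card : ℝ) ≤ T.card := by
    exact_mod_cast card_le_card fun x hx => (mem_filter.1 hx).2
  calc _ ≤ d * (3 * l) * l := by gcongr; exact h5.trans hT
    _ = _ := by ring

lemma TT_prim {d : ℕ} (χ : DirichletCharacter ℂ d) {X : ℝ} (hX : 0 < X) :
    ‖TT χ X Λ‖ ≤ ‖TT χ.primitiveCharacter X Λ‖ + Ed X d := by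
  rw [← sub_le_iff_le_add']
  refine (norm_sub_norm_le _ _).trans ?_
  rw [TT, TT, WS, WS, ← sum_sub_distrib, Ed, sum_filter]
  refine norm_sum_le_of_le _ fun n hn => ?_
  rw [← sub_mul, ← sub_mul]
  by_cases h : n.Coprime d
  · have := χ.primitiveCharacter_apply_of_isCoprime (a := n) (Nat.isCoprime_iff_coprime.2 h)
    push_cast at this
    rw [this, sub_self]; simp [h]
  · rw [if_pos h]
    have h0 : χ (n : ZMod d) = 0 := by
      apply χ.map_nonunit; rwa [ZMod.isUnit_iff_coprime]
    rw [h0, zero_sub, norm_mul, norm_mul, norm_neg, norm_real, norm_real,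
      Real.norm_of_nonneg vonMangoldt_nonneg, Real.norm_of_nonneg (wt_nonneg _)]
    calc _ ≤ 1 * Λ n * 1 := by
          gcongr
          · exact wt_nonneg _
          · exact DirichletCharacter.norm_le_one _ _
          · exact wt_le (by positivity)
      _ = Λ n := by ring

lemma cond_sum {d : ℕ} [NeZero d] (F : (Σ q, DirichletCharacter ℂ q) → ℝ) (hF : ∀ x, 0 ≤ F x) :
    ∑ χ ∈ (univ : Finset (DirichletCharacter ℂ d)).erase 1, F ⟨χ.conductor, χ.primitiveCharacter⟩ ≤
      ∑ q ∈ d.divisors.erase 1, ∑ ψ ∈ PCs q, F ⟨q, ψ⟩ := by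
  classical
  rw [sum_sigma']
  let i : DirichletCharacter ℂ d → Σ q, DirichletCharacter ℂ q :=
    fun χ => ⟨χ.conductor, χ.primitiveCharacter⟩
  let j : (Σ q, DirichletCharacter ℂ q) → DirichletCharacter ℂ d :=
    fun x => if h : x.1 ∣ d then changeLevel h x.2 else 1
  have hji : Function.LeftInverse j i := fun χ => by
    simp only [i, j, dif_pos χ.conductor_dvd_level, changeLevel_primitiveCharacter]
  rw [← sum_image (f := fun x => F x) (g := i) (hji.injective.injOn)]
  refine sum_le_sum_of_subset_of_nonneg ?_ fun x _ _ => hF x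
  intro x hx
  obtain ⟨χ, hχ, rfl⟩ := mem_image.1 hx
  refine mem_sigma.2 ⟨mem_erase.2 ⟨?_, Nat.mem_divisors.2 ⟨χ.conductor_dvd_level, NeZero.ne d⟩⟩,
    mem_PCs.2 χ.primitiveCharacter_isPrimitive⟩
  exact fun h => (mem_erase.1 hχ).1 (χ.eq_one_iff_conductor_eq_one.2 h)

lemma AP_bd {d N : ℕ} [NeZero d] (h : N.Coprime d) {X : ℝ} (hX : 0 < X) :
    |PsiAP X d N - Psi X / d.totient| ≤ (1 / (d.totient : ℝ)) *
      (∑ q ∈ d.divisors.erase 1, ∑ ψ ∈ PCs q, ‖TT ψ X Λ‖) + Ed X d := by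
  have hu : IsUnit (N : ZMod d) := (ZMod.isUnit_iff_coprime N d).2 h
  have ht : (0 : ℝ) < d.totient := by exact_mod_cast Nat.totient_pos.2 (NeZero.pos d)
  have e1 : ((d.totient * PsiAP X d N : ℝ) : ℂ) =
      ∑ χ : DirichletCharacter ℂ d, χ (N : ZMod d)⁻¹ * TT χ X Λ := by
    simp only [TT, WS, mul_sum]
    rw [sum_comm, PsiAP, ofReal_mul, ofReal_sum, mul_sum]
    refine sum_congr rfl fun n _ => ?_
    have := sum_char_inv_mul_char_eq ℂ hu (n : ZMod d)
    calc _ = (if (N : ZMod d) = n then (d.totient : ℂ) else 0) * ((Λ n : ℝ) * (wt (n / X) : ℝ)) := by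
          split_ifs <;> push_cast <;> ring
      _ = _ := by rw [← this, sum_mul]; refine sum_congr rfl fun χ _ => by ring
  have e2 : ‖(TT (1 : DirichletCharacter ℂ d) X Λ) - (Psi X : ℝ)‖ ≤ Ed X d := by
    rw [TT, WS, Psi, ofReal_sum, ← sum_sub_distrib, Ed, sum_filter]
    refine norm_sum_le_of_le _ fun n _ => ?_
    by_cases hc : n.Coprime d
    · rw [MulChar.one_apply ((ZMod.isUnit_iff_coprime _ _).2 hc)]; simp [hc]
    · rw [if_pos hc, MulChar.map_nonunit _ (by rwa [ZMod.isUnit_iff_coprime])]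
      rw [zero_mul, zero_mul, zero_sub, norm_neg, norm_real, Real.norm_of_nonneg
        (mul_nonneg vonMangoldt_nonneg (wt_nonneg _))]
      exact mul_le_of_le_one_right vonMangoldt_nonneg (wt_le (by positivity))
  have hE : 0 ≤ Ed X d := sum_nonneg fun n _ => vonMangoldt_nonneg
  have hun : ‖(1 : DirichletCharacter ℂ d) (N : ZMod d)⁻¹‖ ≤ 1 := DirichletCharacter.norm_le_one _ _
  have h1i : (1 : DirichletCharacter ℂ d) (N : ZMod d)⁻¹ = 1 := by
    apply MulChar.one_apply
    rw [← ZMod.coe_unitOfCoprime N h, ZMod.inv_coe_unit]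
    exact Units.isUnit _
  have key : ‖((d.totient * PsiAP X d N - Psi X : ℝ) : ℂ)‖ ≤
      (∑ q ∈ d.divisors.erase 1, ∑ ψ ∈ PCs q, ‖TT ψ X Λ‖) + d.totient * Ed X d := by
    rw [ofReal_sub, e1, ← add_sum_erase _ _ (mem_univ (1 : DirichletCharacter ℂ d)), h1i, one_mul,
      add_comm, add_sub_assoc]
    have hc : (((univ : Finset (DirichletCharacter ℂ d)).erase 1).card : ℝ) = d.totient - 1 := by
      have h2 := card_erase_add_one (mem_univ (1 : DirichletCharacter ℂ d))
      rw [card_univ, ← Nat.card_eq_fintype_card, card_eq_totient_of_hasEnoughRootsOfUnity] at h2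
      rw [← h2]; push_cast; ring
    have h3 : ‖∑ χ ∈ (univ : Finset (DirichletCharacter ℂ d)).erase 1, χ (N : ZMod d)⁻¹ * TT χ X Λ‖ ≤
        (∑ q ∈ d.divisors.erase 1, ∑ ψ ∈ PCs q, ‖TT ψ X Λ‖) + (d.totient - 1) * Ed X d := by
      calc _ ≤ ∑ χ ∈ (univ : Finset (DirichletCharacter ℂ d)).erase 1,
            (‖TT χ.primitiveCharacter X Λ‖ + Ed X d) := by
            refine norm_sum_le_of_le _ fun χ _ => ?_
            rw [norm_mul]
            exact (mul_le_of_le_one_left (norm_nonneg _) (χ.norm_le_one _)).trans (TT_prim χ hX)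
        _ ≤ _ := by
            rw [sum_add_distrib, sum_const, nsmul_eq_mul, hc]
            gcongr
            exact cond_sum (fun x => ‖TT x.2 X Λ‖) fun _ => norm_nonneg _
    refine (norm_add_le _ _).trans ?_
    linarith
  rw [norm_real, Real.norm_eq_abs] at key
  have e3 : PsiAP X d N - Psi X / d.totient = (d.totient * PsiAP X d N - Psi X) / d.totient := by
    field_simp
  rw [e3, abs_div, abs_of_pos ht, div_le_iff₀ ht]
  refine key.trans (le_of_eq ?_)
  field_simp

lemma inv_tot_sum (D : ℕ) : ∑ m ∈ Icc 1 D, 1 / (m.totient : ℝ) ≤ (1 + Real.log D) ^ 2 := by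
  have h1 : ∀ m ∈ Icc 1 D, 1 / (m.totient : ℝ) ≤
      ∑ x ∈ Icc 1 D ×ˢ Icc 1 D with x.1 * x.2 = m, ((x.1 : ℝ)⁻¹ * (x.2 : ℝ)⁻¹) := by
    intro m hm
    rw [mem_Icc] at hm
    rw [show (Icc 1 D ×ˢ Icc 1 D).filter (fun x => x.1 * x.2 = m) = m.divisorsAntidiagonal from
      (Nat.divisorsAntidiagonal_eq_prod_filter_of_le (show m ≠ 0 by omega) hm.2).symm]
    have e : ∀ x ∈ m.divisorsAntidiagonal, ((x.1 : ℝ)⁻¹ * (x.2 : ℝ)⁻¹) = (m : ℝ)⁻¹ := fun x hx => by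
      rw [← (Nat.mem_divisorsAntidiagonal.1 hx).1]; push_cast; rw [mul_inv]
    rw [sum_congr rfl e, sum_const, nsmul_eq_mul, ← Nat.map_div_right_divisors, card_map]
    have hm0 : (0 : ℝ) < m := by exact_mod_cast hm.1
    have ht : (0 : ℝ) < m.totient := by exact_mod_cast Nat.totient_pos.2 hm.1
    rw [← div_eq_mul_inv, div_le_div_iff₀ ht hm0, one_mul]
    have : m ≤ m.divisors.card * m.totient := by
      conv_lhs => rw [← Nat.sum_totient m]
      refine sum_le_card_nsmul _ _ _ fun e he => Nat.le_of_dvd (Nat.totient_pos.2 hm.1)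
        (Nat.totient_dvd_of_dvd (Nat.mem_divisors.1 he).1)
    exact_mod_cast this
  have hh : ∑ a ∈ Icc 1 D, (a : ℝ)⁻¹ ≤ 1 + Real.log D := by
    have := harmonic_le_one_add_log D
    rwa [harmonic_eq_sum_Icc, Rat.cast_sum, sum_congr rfl (fun i _ => by
      rw [Rat.cast_inv, Rat.cast_natCast])] at this
  calc _ ≤ _ := sum_le_sum h1
    _ ≤ ∑ x ∈ Icc 1 D ×ˢ Icc 1 D, ((x.1 : ℝ)⁻¹ * (x.2 : ℝ)⁻¹) := by
        simp_rw [sum_filter]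
        rw [sum_comm]
        refine sum_le_sum fun x _ => ?_
        rw [sum_ite_eq]
        split_ifs
        · rfl
        · positivity
    _ = (∑ a ∈ Icc 1 D, (a : ℝ)⁻¹) ^ 2 := by rw [sum_product, sq, sum_mul_sum]
    _ ≤ _ := pow_le_pow_left₀ (sum_nonneg fun _ _ => by positivity) hh 2

lemma BV (A : ℕ) : ∃ C X0 : ℝ, 0 < C ∧ ∀ X : ℝ, X0 ≤ X → ∀ N D : ℕ,
    (D : ℝ) * Real.log X ^ (3 * A + 15) ≤ √X →
    ∑ d ∈ Icc 1 D with N.Coprime d, |PsiAP X d N - Psi X / d.totient| ≤ C * X / Real.log X ^ A := by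
  obtain ⟨C, X0, hC, hp⟩ := prim_BV (A + 2)
  refine ⟨9 * C + 3, max X0 (Real.exp 2), by positivity, fun X hX N D hD => ?_⟩
  have hX1 : X0 ≤ X := (le_max_left _ _).trans hX
  have hX2 : Real.exp 2 ≤ X := (le_max_right _ _).trans hX
  have hXp : 0 < X := (Real.exp_pos _).trans_le hX2
  have hl2 : 2 ≤ Real.log X := (Real.le_log_iff_exp_le hXp).2 hX2
  have hP := hp X hX1 D (by convert hD using 3; ring)
  set l := Real.log X
  set H : ℕ → ℝ := fun q => ∑ ψ ∈ PCs q, ‖TT ψ X Λ‖ with hH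
  have hH0 : ∀ q, 0 ≤ H q := fun q => sum_nonneg fun _ _ => norm_nonneg _
  have hl1 : 1 ≤ l := by linarith
  have hl0 : 0 < l := by linarith
  have hsX : 1 ≤ √X := Real.one_le_sqrt.2 (by have := Real.add_one_le_exp (2:ℝ); linarith)
  have hD' : (D : ℝ) ≤ √X / l ^ (3 * A + 15) := (le_div_iff₀ (by positivity)).2 hD
  have hsq : √X ^ 2 = X := Real.sq_sqrt hXp.le
  have hlogD : 1 + Real.log D ≤ 2 * l ∧ 0 ≤ 1 + Real.log D := by
    have h1 : (D : ℝ) ≤ √X := hD'.trans (div_le_self (by positivity) (one_le_pow₀ hl1))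
    have h2 : √X ≤ X := by nlinarith
    have h3 : 0 ≤ Real.log D := Real.log_natCast_nonneg _
    rcases Nat.eq_zero_or_pos D with rfl | h
    · simp; linarith
    have h4 : Real.log D ≤ l := Real.log_le_log (by exact_mod_cast h) (by linarith)
    constructor <;> linarith
  have hEs : ∑ d ∈ Icc 1 D, Ed X d ≤ 3 * X / l ^ A := by
    calc _ ≤ ∑ d ∈ Icc 1 D, 3 * (D : ℝ) * l ^ 2 := by
          refine sum_le_sum fun d hd => (Ed_le hXp hl1 (mem_Icc.1 hd).1).trans ?_
          gcongr; exact_mod_cast (mem_Icc.1 hd).2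
      _ = 3 * (D : ℝ) ^ 2 * l ^ 2 := by rw [sum_const, Nat.card_Icc]; simp; ring
      _ ≤ 3 * (√X / l ^ (3 * A + 15)) ^ 2 * l ^ 2 := by gcongr
      _ = 3 * X * (l ^ 2 / l ^ (6 * A + 30)) := by rw [div_pow, hsq]; ring
      _ ≤ 3 * X * (1 / l ^ A) := by
          refine mul_le_mul_of_nonneg_left ?_ (by positivity)
          rw [div_le_div_iff₀ (by positivity) (by positivity), ← pow_add, one_mul]
          exact pow_le_pow_right₀ hl1 (by omega)
      _ = _ := by ring
  have hm : ∑ d ∈ Icc 1 D, (1 / (d.totient : ℝ)) * ∑ q ∈ d.divisors.erase 1, H q ≤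
      (∑ q ∈ Icc 2 D, (1 / (q.totient : ℝ)) * H q) * ∑ m ∈ Icc 1 D, 1 / (m.totient : ℝ) := by
    have h1 : ∀ d ∈ Icc 1 D, (1 / (d.totient : ℝ)) * ∑ q ∈ d.divisors.erase 1, H q ≤
        ∑ x ∈ Icc 2 D ×ˢ Icc 1 D with x.1 * x.2 = d,
          ((1 / (x.1.totient : ℝ)) * H x.1 * (1 / (x.2.totient : ℝ))) := by
      intro d hd
      rw [mem_Icc] at hd
      rw [mul_sum]
      let i : ℕ → ℕ × ℕ := fun q => (q, d / q)
      have hi : Function.Injective i := fun a b h => (Prod.ext_iff.1 h).1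
      have hq' : ∀ q ∈ d.divisors.erase 1, 2 ≤ q ∧ q ≤ D ∧ 1 ≤ d / q ∧ d / q ≤ D ∧ q * (d / q) = d := by
        intro q hq
        rw [mem_erase, Nat.mem_divisors] at hq
        have h3 := Nat.pos_of_dvd_of_pos hq.2.1 hd.1
        have h4 := Nat.le_of_dvd hd.1 hq.2.1
        exact ⟨by omega, by omega, Nat.div_pos h4 h3, (Nat.div_le_self _ _).trans hd.2,
          Nat.mul_div_cancel' hq.2.1⟩
      calc _ ≤ ∑ q ∈ d.divisors.erase 1, ((1 / ((i q).1.totient : ℝ)) * H (i q).1 *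
            (1 / ((i q).2.totient : ℝ))) := by
            refine sum_le_sum fun q hq => ?_
            obtain ⟨a1, a2, a3, a4, a5⟩ := hq' q hq
            have t1 : (0 : ℝ) < q.totient := by exact_mod_cast Nat.totient_pos.2 (by omega)
            have t2 : (0 : ℝ) < (d / q).totient := by exact_mod_cast Nat.totient_pos.2 (by omega)
            have t3 : (q.totient * (d / q).totient : ℝ) ≤ d.totient := by
              have := Nat.totient_super_multiplicative q (d / q)
              rw [a5] at this; exact_mod_cast this
            calc _ ≤ 1 / (q.totient * (d / q).totient : ℝ) * H q := by
                  have := hH0 q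
                  gcongr
              _ = _ := by simp only [i]; field_simp
        _ = ∑ x ∈ (d.divisors.erase 1).image i, ((1 / (x.1.totient : ℝ)) * H x.1 *
            (1 / (x.2.totient : ℝ))) := by rw [sum_image hi.injOn]
        _ ≤ _ := by
            refine sum_le_sum_of_subset_of_nonneg ?_ fun x _ _ => by
              have := hH0 x.1; positivity
            intro x hx
            obtain ⟨q, hq, rfl⟩ := mem_image.1 hx
            obtain ⟨a1, a2, a3, a4, a5⟩ := hq' q hq
            exact mem_filter.2 ⟨mem_product.2 ⟨mem_Icc.2 ⟨a1, a2⟩, mem_Icc.2 ⟨a3, a4⟩⟩, a5⟩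
    refine (sum_le_sum h1).trans ?_
    simp_rw [sum_filter]
    rw [sum_comm, sum_mul_sum, sum_product]
    refine sum_le_sum fun x _ => sum_le_sum fun y _ => ?_
    rw [sum_ite_eq]
    split_ifs
    · rfl
    · have := hH0 x; positivity
  have hP0 : 0 ≤ ∑ q ∈ Icc 2 D, (1 / (q.totient : ℝ)) * H q :=
    sum_nonneg fun q _ => mul_nonneg (by positivity) (hH0 q)
  calc _ ≤ ∑ d ∈ Icc 1 D with N.Coprime d, ((1 / (d.totient : ℝ)) *
        (∑ q ∈ d.divisors.erase 1, H q) + Ed X d) := by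
        refine sum_le_sum fun d hd => ?_
        rw [mem_filter, mem_Icc] at hd
        haveI : NeZero d := ⟨by omega⟩
        exact AP_bd hd.2 hXp
    _ ≤ ∑ d ∈ Icc 1 D, ((1 / (d.totient : ℝ)) * (∑ q ∈ d.divisors.erase 1, H q) + Ed X d) := by
        refine sum_le_sum_of_subset_of_nonneg (filter_subset _ _) fun d _ _ => ?_
        have : 0 ≤ Ed X d := sum_nonneg fun n _ => vonMangoldt_nonneg
        have := sum_nonneg fun q (_ : q ∈ d.divisors.erase 1) => hH0 q
        positivity
    _ ≤ (C * X / l ^ (A + 2)) * (2 * l) ^ 2 + 3 * X / l ^ A := by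
        rw [sum_add_distrib]
        refine add_le_add (hm.trans ?_) hEs
        gcongr
        exact (inv_tot_sum D).trans (pow_le_pow_left₀ hlogD.2 hlogD.1 2)
    _ = (4 * C + 3) * X / l ^ A := by field_simp; ring
    _ ≤ _ := by gcongr; linarith
end

section
open Finset ArithmeticFunction Filter

lemma mert1 (n : ℕ) (hn : 1 ≤ n) : |∑ k ∈ Ioc 0 n, Λ k / k - Real.log n| ≤ 6 := by
  have hn' : (0:ℝ) < n := by exact_mod_cast hn
  have h1 : ∑ k ∈ Ioc 0 n, Λ k * ((n / k : ℕ) : ℝ) = Real.log (n.factorial) := by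
    rw [← sum_Ioc_mul_zeta_eq_sum, vonMangoldt_mul_zeta]
    clear hn hn'
    induction n with
    | zero => simp
    | succ m ih =>
      rw [← Finset.insert_Ioc_right_eq_Ioc_add_one (Nat.zero_le m), sum_insert (by simp), ih,
        Nat.factorial_succ]
      push_cast
      rw [Real.log_mul (by positivity) (by positivity)]; simp [ArithmeticFunction.log_apply]
  have h2 := Stirling.le_log_factorial_stirling (n := n) (by omega)
  have h2a : 0 ≤ Real.log n := Real.log_natCast_nonneg n
  have h2b : 0 ≤ Real.log (2 * Real.pi) := Real.log_nonneg (by linarith [Real.two_le_pi])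
  have h3 : Real.log (n.factorial) ≤ n * Real.log n := by
    rw [← Real.log_pow]; apply Real.log_le_log (by positivity); exact_mod_cast Nat.factorial_le_pow n
  have h4 : ∑ k ∈ Ioc 0 n, Λ k ≤ 6 * n := by
    have := Chebyshev.psi_le_const_mul_self hn'.le
    have h5 : Real.log 4 ≤ 2 := by
      rw [show (4:ℝ) = 2 ^ 2 by norm_num, Real.log_pow]; push_cast; linarith [Real.log_two_lt_d9]
    rw [Chebyshev.psi, Nat.floor_natCast] at this
    nlinarith
  have h6 : ∑ k ∈ Ioc 0 n, Λ k * ((n / k : ℕ) : ℝ) ≤ n * ∑ k ∈ Ioc 0 n, Λ k / k := by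
    rw [mul_sum]; refine sum_le_sum fun k hk => ?_
    have := @Nat.cast_div_le ℝ _ _ _ n k
    calc _ ≤ Λ k * ((n:ℝ) / k) := by gcongr
      _ = _ := by ring
  have h7 : n * ∑ k ∈ Ioc 0 n, Λ k / k ≤ ∑ k ∈ Ioc 0 n, Λ k * ((n / k : ℕ) : ℝ) + ∑ k ∈ Ioc 0 n, Λ k := by
    rw [mul_sum, ← sum_add_distrib]; refine sum_le_sum fun k hk => ?_
    have hk0 : 0 < k := (mem_Ioc.1 hk).1
    have : (n:ℝ) / k ≤ ((n / k : ℕ) : ℝ) + 1 := by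
      rw [div_le_iff₀ (by exact_mod_cast hk0)]
      exact_mod_cast (Nat.lt_div_mul_add hk0 (a := n)).le.trans (by rw [add_mul, one_mul])
    calc _ = Λ k * ((n:ℝ) / k) := by ring
      _ ≤ Λ k * (((n / k : ℕ) : ℝ) + 1) := by gcongr
      _ = _ := by ring
  rw [abs_le]; constructor <;> refine le_of_mul_le_mul_left ?_ hn' <;> nlinarith

noncomputable def nu (N n : ℕ) : ℝ := if n.Prime ∧ ¬ n ∣ N then 1 / ((n:ℝ) - 1) else 0

lemma nu_nonneg (N n : ℕ) : 0 ≤ nu N n := by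
  unfold nu; split_ifs with h
  · have : (1:ℝ) ≤ n := by exact_mod_cast h.1.one_lt.le
    exact div_nonneg zero_le_one (by linarith)
  · rfl

lemma mert2 : ∃ A : ℝ, 0 < A ∧ ∀ N w z : ℕ, 2 ≤ w → w ≤ z →
    ∑ n ∈ Ico w z, nu N n * Real.log n ≤ Real.log z - Real.log w + A := by
  have hs : Summable fun n : ℕ => 4 * ((n:ℝ) ^ (3/2:ℝ))⁻¹ :=
    (Real.summable_nat_rpow_inv.2 (by norm_num)).mul_left 4
  refine ⟨13 + ∑' n : ℕ, 4 * ((n:ℝ) ^ (3/2:ℝ))⁻¹, by positivity, fun N w z hw hwz => ?_⟩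
  have h1 : ∑ n ∈ Ico w z, nu N n * Real.log n ≤
      ∑ n ∈ Ico w z, (Λ n / n + 4 * ((n:ℝ) ^ (3/2:ℝ))⁻¹) := by
    refine sum_le_sum fun n hn => ?_
    have hn2 : 2 ≤ n := hw.trans (mem_Ico.1 hn).1
    have hn2' : (2:ℝ) ≤ n := by exact_mod_cast hn2
    have hL : 0 ≤ Λ n / n := div_nonneg vonMangoldt_nonneg (by positivity)
    unfold nu; split_ifs with h
    · rw [vonMangoldt_apply_prime h.1]
      have h3 : Real.log n ≤ 2 * (n:ℝ) ^ (1/2:ℝ) := by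
        have := Real.log_le_rpow_div (x := n) (by positivity) (ε := 1/2) (by norm_num)
        linarith
      have h4 : ((n:ℝ) ^ (3/2:ℝ))⁻¹ = (n:ℝ) ^ (1/2:ℝ) / n ^ 2 := by
        rw [← Real.rpow_neg (by positivity), ← Real.rpow_natCast, ← Real.rpow_sub (by positivity)]
        norm_num
      rw [h4]
      have h5 : 1 / ((n:ℝ) - 1) * Real.log n = Real.log n / n + Real.log n / (n * (n - 1)) := by
        have : (n:ℝ) - 1 ≠ 0 := by linarith
        field_simp; ring
      rw [h5, ← mul_div_assoc, add_le_add_iff_left]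
      have h6 : (n:ℝ) ^ 2 / 2 ≤ n * (n - 1) := by nlinarith
      calc _ ≤ 2 * (n:ℝ) ^ (1/2:ℝ) / ((n:ℝ) ^ 2 / 2) := by gcongr
        _ = _ := by field_simp; ring
    · rw [zero_mul]; positivity
  rw [sum_add_distrib] at h1
  have h2 := hs.sum_le_tsum (Ico w z) (fun n _ => by positivity)
  obtain ⟨w', rfl⟩ : ∃ w', w = w' + 1 := ⟨w - 1, by omega⟩
  obtain ⟨z', rfl⟩ : ∃ z', z = z' + 1 := ⟨z - 1, by omega⟩
  have h3 := abs_le.1 (mert1 w' (by omega))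
  have h4 := abs_le.1 (mert1 z' (by omega))
  have h5 : ∑ n ∈ Ioc 0 z', Λ n / n = ∑ n ∈ Ioc 0 w', Λ n / n + ∑ n ∈ Ico (w' + 1) (z' + 1), Λ n / n := by
    rw [← sum_Ioc_consecutive _ (Nat.zero_le w') (by omega : w' ≤ z')]; congr 2; ext x; simp [Nat.succ_le_iff, Nat.lt_succ_iff]
  have h6 : Real.log z' ≤ Real.log ((z' + 1 : ℕ)) := by
    apply Real.log_le_log (by exact_mod_cast (by omega : 0 < z')); push_cast; linarith
  have h7 : Real.log ((w' + 1 : ℕ)) ≤ Real.log w' + 1 := by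
    have hw0 : (1:ℝ) ≤ w' := by exact_mod_cast (by omega : 1 ≤ w')
    have : Real.log ((w' + 1 : ℕ)) ≤ Real.log (2 * w') := by
      apply Real.log_le_log <;> push_cast <;> linarith
    rw [Real.log_mul (by norm_num) (by linarith)] at this
    linarith [Real.log_two_lt_d9]
  linarith

lemma mert3 : ∃ A : ℝ, 0 < A ∧ ∀ N w z : ℕ, 2 ≤ w → w ≤ z →
    ∑ n ∈ Ico w z, nu N n ≤ Real.log (Real.log z / Real.log w) + A / Real.log w := by
  obtain ⟨A, hA, h⟩ := mert2
  refine ⟨A + 1, by linarith, fun N w z hw hwz => ?_⟩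
  have key : ∀ z, w ≤ z → ∑ n ∈ Ico w z, nu N n - (∑ n ∈ Ico w z, nu N n * Real.log n
      - (Real.log z - Real.log w + A)) * (1 / Real.log z) ≤
      Real.log (Real.log z / Real.log w) + (1 / Real.log w - 1 / Real.log z) + A / Real.log w := by
    have hlw : 0 < Real.log w := Real.log_pos (by exact_mod_cast hw)
    intro z hz
    induction z, hz using Nat.le_induction with
    | base => simp [div_self hlw.ne', div_eq_mul_inv]
    | succ z hz ih =>
      have hG := h N w (z + 1) hw (by omega)
      rw [sum_Ico_succ_top hz, sum_Ico_succ_top hz] at *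
      have hz2 : (2:ℝ) ≤ z := by exact_mod_cast hw.trans hz
      have hl0 : 0 < Real.log z := Real.log_pos (by linarith)
      have hl1 : Real.log z ≤ Real.log ((z + 1 : ℕ)) := by
        apply Real.log_le_log <;> push_cast <;> linarith
      have hl2 : Real.log ((z + 1 : ℕ)) ≤ Real.log z + 1 := by
        have : Real.log ((z + 1 : ℕ)) ≤ Real.log (2 * z) := by
          apply Real.log_le_log <;> push_cast <;> linarith
        rw [Real.log_mul (by norm_num) (by linarith)] at this
        linarith [Real.log_two_lt_d9]
      set a := Real.log z
      set b := Real.log ((z + 1 : ℕ))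
      have hb : 0 < b := by linarith
      have h1 : Real.log (b / Real.log w) = Real.log (a / Real.log w) + Real.log (b / a) := by
        rw [← Real.log_mul (by positivity) (by positivity)]; congr 1; field_simp
      have h2 : 1 - a / b ≤ Real.log (b / a) := by
        have := Real.one_sub_inv_le_log_of_pos (x := b / a) (by positivity)
        rwa [inv_div] at this
      have h3 : 1 / b ≤ 1 / a := one_div_le_one_div_of_le hl0 hl1
      rw [h1]
      have e1 : (b - a) * (1 / b) = 1 - a / b := by field_simp
      have e2 : a * (1 / a) = 1 := by field_simp
      set f := 1 / a
      set g := 1 / b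
      set S := ∑ n ∈ Ico w z, nu N n * Real.log n
      have h5 : (S + nu N z * a - (b - Real.log w + A)) * (f - g) ≤ 0 :=
        mul_nonpos_of_nonpos_of_nonneg (by linarith) (by linarith)
      have h6 : (b - a) * (f - g) ≤ f - g := by
        have := mul_le_mul_of_nonneg_right (by linarith : b - a ≤ 1) (by linarith : 0 ≤ f - g)
        linarith
      have h7 : nu N z * a * f = nu N z := by rw [mul_assoc, e2, mul_one]
      linarith
  have h1 := key z hwz
  have h2 := h N w z hw hwz
  have h3 : 0 ≤ 1 / Real.log z := one_div_nonneg.2 (Real.log_natCast_nonneg z)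
  have h4 := mul_nonpos_of_nonpos_of_nonneg (sub_nonpos.2 h2) h3
  rw [add_div]; linarith

noncomputable def Vp (ν : ℕ → ℝ) (z : ℕ) : ℝ := ∏ n ∈ range z, (1 - ν n)

lemma nu_lt {N n : ℕ} (hN : 2 ∣ N) : nu N n ≤ 1 / 2 := by
  unfold nu; split_ifs with h
  · have h3 : 3 ≤ n := by
      have := h.1.two_le
      rcases this.lt_or_eq with h2 | h2
      · exact h2
      · exact absurd (h2 ▸ hN) h.2
    have : (3:ℝ) ≤ n := by exact_mod_cast h3
    rw [div_le_div_iff₀ (by linarith) (by norm_num)]; linarith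
  · norm_num

lemma mert4 : ∃ A : ℝ, 0 < A ∧ ∀ N w z : ℕ, 2 ∣ N → 3 ≤ w → w ≤ z →
    ∑ n ∈ Ico w z, nu N n ≤ Real.log (Real.log z / Real.log w) + A / Real.log w ∧
    Vp (nu N) w ≤ Vp (nu N) z * (Real.log z / Real.log w * Real.exp (A / Real.log w)) := by
  obtain ⟨A, hA, h⟩ := mert3
  refine ⟨A + 3, by linarith, fun N w z hN hw hwz => ?_⟩
  have hw3 : (3:ℝ) ≤ w := by exact_mod_cast hw
  have hlw : 0 < Real.log w := Real.log_pos (by linarith)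
  have hlz : 0 < Real.log z := hlw.trans_le (Real.log_le_log (by linarith) (by exact_mod_cast hwz))
  have h1 := h N w z (by omega) hwz
  refine ⟨h1.trans (by gcongr; linarith), ?_⟩
  have key : ∀ z, w ≤ z → Vp (nu N) w ≤ Vp (nu N) z *
      Real.exp (∑ n ∈ Ico w z, nu N n + (1 / ((w:ℝ) - 2) - 1 / (z - 2))) := by
    intro z hz
    induction z, hz using Nat.le_induction with
    | base => simp
    | succ z hz ih =>
      refine ih.trans ?_
      rw [Vp, Vp, prod_range_succ, sum_Ico_succ_top hz, mul_assoc]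
      have hz3 : (3:ℝ) ≤ z := hw3.trans (by exact_mod_cast hz)
      refine mul_le_mul_of_nonneg_left ?_ (prod_nonneg fun n _ => by linarith [nu_lt (n := n) hN])
      have h2 : 1 - nu N z ≥ Real.exp (-(nu N z + (1 / ((z:ℝ) - 2) - 1 / (z - 1)))) := by
        have hx : 0 < 1 - nu N z := by linarith [nu_lt (n := z) hN]
        rw [ge_iff_le, ← Real.le_log_iff_exp_le hx]
        have := Real.one_sub_inv_le_log_of_pos hx
        refine le_trans ?_ this
        unfold nu; split_ifs
        · have e1 : 1 - 1 / ((z:ℝ) - 1) = (z - 2) / (z - 1) := by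
            rw [eq_div_iff (by linarith), sub_mul, div_mul_cancel₀ _ (by linarith)]; ring
          rw [e1, inv_div]
          have : ((z:ℝ) - 1) / (z - 2) = 1 + 1 / (z - 2) := by
            rw [div_eq_iff (by linarith), add_mul, div_mul_cancel₀ _ (by linarith)]; ring
          linarith
        · simp only [sub_zero, inv_one, sub_self, zero_add]
          have := one_div_le_one_div_of_le (by linarith : (0:ℝ) < z - 2) (by linarith : (z:ℝ) - 2 ≤ z - 1)
          linarith
      calc _ = Real.exp (-(nu N z + (1 / ((z:ℝ) - 2) - 1 / (z - 1)))) * Real.exp (∑ n ∈ Ico w z, nu N n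
            + nu N z + (1 / ((w:ℝ) - 2) - 1 / ((z + 1 : ℕ) - 2))) := by
              rw [← Real.exp_add]; congr 1; push_cast; ring_nf
        _ ≤ _ := by gcongr
  have hz3 : (3:ℝ) ≤ z := hw3.trans (by exact_mod_cast hwz)
  refine (key z hwz).trans (mul_le_mul_of_nonneg_left ?_
    (prod_nonneg fun n _ => by linarith [nu_lt (n := n) hN]))
  have h5 : 1 / ((w:ℝ) - 2) ≤ 3 / Real.log w := by
    rw [div_le_div_iff₀ (by linarith) hlw]
    linarith [Real.log_le_sub_one_of_pos (show (0:ℝ) < w by linarith)]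
  have h6 : 0 ≤ 1 / ((z:ℝ) - 2) := one_div_nonneg.2 (by linarith)
  rw [← Real.exp_log (show 0 < Real.log z / Real.log w by positivity), ← Real.exp_add]
  apply Real.exp_le_exp.2; rw [add_div]; linarith
end

section
open Finset

noncomputable def Bs (T : ℕ → ℕ) (N : ℕ) (g : ℕ → ℝ) : ℕ → ℕ → ℕ → ℝ
  | 0, _, d => g d
  | z + 1, j, d => Bs T N g z j d -
      if (z.Prime ∧ ¬ z ∣ N) ∧ z < T j then Bs T N g z (j + 1) (d * z) else 0

noncomputable def Ms (T : ℕ → ℕ) (ν : ℕ → ℝ) : ℕ → ℕ → ℝ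
  | 0, _ => 1
  | z + 1, j => Ms T ν z j - if z < T j then ν z * Ms T ν z (j + 1) else 0

lemma Bs_add (T : ℕ → ℕ) (N : ℕ) (g h : ℕ → ℝ) (c : ℝ) : ∀ z j d : ℕ,
    Bs T N (fun d => c * g d + h d) z j d = c * Bs T N g z j d + Bs T N h z j d
  | 0, _, _ => rfl
  | z + 1, j, d => by
    simp only [Bs]; rw [Bs_add T N g h c z j d, Bs_add T N g h c z (j + 1) (d * z)]
    split_ifs <;> ring

lemma Bs_sum (T : ℕ → ℕ) (N : ℕ) (s : Finset ℕ) (a : ℕ → ℝ) (g : ℕ → ℕ → ℝ) : ∀ z j d : ℕ,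
    Bs T N (fun d => ∑ n ∈ s, a n * g n d) z j d = ∑ n ∈ s, a n * Bs T N (g n) z j d
  | 0, _, _ => rfl
  | z + 1, j, d => by
    simp only [Bs]; rw [Bs_sum T N s a g z j d, Bs_sum T N s a g z (j + 1) (d * z)]
    split_ifs <;> simp [mul_sub, sum_sub_distrib]

open Classical in
noncomputable def Sf (N m z d : ℕ) : ℝ :=
  if d ∣ m ∧ ∀ p < z, p.Prime → ¬ p ∣ N → ¬ p ∣ m then 1 else 0

lemma Sf_nonneg (N m z d : ℕ) : 0 ≤ Sf N m z d := by unfold Sf; split_ifs <;> norm_num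

lemma Sf_succ {N m z d : ℕ} (h : (z.Prime ∧ ¬ z ∣ N) → d.Coprime z) :
    Sf N m (z + 1) d = Sf N m z d - if z.Prime ∧ ¬ z ∣ N then Sf N m z (d * z) else 0 := by
  have key : (∀ p < z + 1, p.Prime → ¬ p ∣ N → ¬ p ∣ m) ↔
      (∀ p < z, p.Prime → ¬ p ∣ N → ¬ p ∣ m) ∧ ((z.Prime ∧ ¬ z ∣ N) → ¬ z ∣ m) := by
    constructor
    · exact fun h => ⟨fun p hp => h p (by omega), fun hz => h z (by omega) hz.1 hz.2⟩
    · rintro ⟨h1, h2⟩ p hp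
      rcases (Nat.lt_succ_iff_lt_or_eq.1 hp) with h | h
      · exact h1 p h
      · subst h; exact fun a b => h2 ⟨a, b⟩
  unfold Sf; simp only [key]
  by_cases hz : z.Prime ∧ ¬ z ∣ N
  · have hd : d * z ∣ m ↔ d ∣ m ∧ z ∣ m :=
      ⟨fun h => ⟨(Dvd.intro _ rfl).trans h, (Dvd.intro_left _ rfl).trans h⟩,
        fun h' => (h hz).mul_dvd_of_dvd_of_dvd h'.1 h'.2⟩
    simp only [hz, hd, not_false_eq_true, and_self, if_true, forall_const]
    by_cases h1 : d ∣ m <;> by_cases h2 : z ∣ m <;> simp [h1, h2]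
  · simp [hz]

lemma sandwich (T : ℕ → ℕ) (N m : ℕ) (Q : ℕ → Prop) (hQ : ∀ j, Q (j + 1) ↔ ¬ Q j) : ∀ z j d : ℕ,
    (∀ j, ¬ Q j → z ≤ T j) → (∀ p < z, p.Prime → d.Coprime p) →
    (Q j → Sf N m z d ≤ Bs T N (fun d => if d ∣ m then 1 else 0) z j d) ∧
    (¬ Q j → Bs T N (fun d => if d ∣ m then 1 else 0) z j d ≤ Sf N m z d)
  | 0, j, d, _, _ => by simp [Bs, Sf]
  | z + 1, j, d, hT, hd => by
    have ih1 := sandwich T N m Q hQ z j d (fun j h => by have := hT j h; omega)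
      (fun p hp => hd p (by omega))
    rw [Sf_succ (fun h => hd z (by omega) h.1)]
    simp only [Bs]
    by_cases hz : z.Prime ∧ ¬ z ∣ N
    · have ih2 := sandwich T N m Q hQ z (j + 1) (d * z) (fun j h => by have := hT j h; omega)
        (fun p hp hpp => Nat.Coprime.mul_left (hd p (by omega) hpp)
          ((Nat.coprime_primes hz.1 hpp).2 (by omega)))
      rw [hQ] at ih2
      simp only [hz, not_false_eq_true, and_self, if_true, true_and]
      have := Sf_nonneg N m z (d * z)
      refine ⟨fun hj => ?_, fun hj => ?_⟩
      · have h1 := ih1.1 hj; have h2 := ih2.2 (not_not.2 hj)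
        split_ifs <;> linarith
      · have h1 := ih1.2 hj; have h2 := ih2.1 hj
        rw [if_pos (by have := hT j hj; omega)]; linarith
    · simpa [hz] using ih1

lemma Bs_main (T : ℕ → ℕ) (N : ℕ) : ∀ z j d : ℕ, (∀ p < z, p.Prime → d.Coprime p) →
    Bs T N (fun d => 1 / (d.totient : ℝ)) z j d = 1 / (d.totient : ℝ) * Ms T (nu N) z j
  | 0, j, d, _ => by simp [Bs, Ms]
  | z + 1, j, d, hd => by
    simp only [Bs, Ms]
    rw [Bs_main T N z j d (fun p hp => hd p (by omega))]
    by_cases hz : z.Prime ∧ ¬ z ∣ N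
    · rw [Bs_main T N z (j + 1) (d * z) (fun p hp hpp => Nat.Coprime.mul_left (hd p (by omega) hpp)
          ((Nat.coprime_primes hz.1 hpp).2 (by omega)))]
      rw [Nat.totient_mul (hd z (by omega) hz.1), Nat.totient_prime hz.1]
      have : nu N z = 1 / ((z - 1 : ℕ) : ℝ) := by
        rw [nu, if_pos hz, Nat.cast_sub hz.1.one_lt.le, Nat.cast_one]
      rw [this]; push_cast; simp only [hz, not_false_eq_true, and_self, true_and]
      split_ifs
      · simp only [one_div, mul_inv]; ring
      · ring
    · have : nu N z = 0 := by rw [nu, if_neg hz]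
      simp [hz, this]

lemma Ms_err {T : ℕ → ℕ} {ν : ℕ → ℝ} (h0 : ∀ n, 0 ≤ ν n) (h1 : ∀ n, ν n ≤ 1) (K : ℕ) : ∀ z j : ℕ,
    j + z ≤ K → |Ms T ν z j - Vp ν z| ≤ ∑ k ∈ Ico j K,
      Vp ν (T k) * ((∑ i ∈ Ico (T k) z, ν i) ^ (k - j + 1) / (k - j + 1).factorial)
  | 0, j, _ => by simp [Ms, Vp]
  | z + 1, j, hK => by
    have ih1 := Ms_err (T := T) h0 h1 K z j (by omega)
    have ih2 := Ms_err (T := T) h0 h1 K z (j + 1) (by omega)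
    have V0 : ∀ n, 0 ≤ Vp ν n := fun n => prod_nonneg fun i _ => by linarith [h1 i]
    have s0 : ∀ a b, 0 ≤ ∑ i ∈ Ico a b, ν i := fun a b => sum_nonneg fun i _ => h0 i
    have hV : Vp ν (z + 1) = Vp ν z - ν z * Vp ν z := by simp only [Vp]; rw [prod_range_succ]; ring
    have step : ∀ k n : ℕ, (∑ i ∈ Ico (T k) z, ν i) ^ (n + 1) / (n + 1).factorial +
        (if z < T k then 0 else ν z * ((∑ i ∈ Ico (T k) z, ν i) ^ n / n.factorial)) ≤
        (∑ i ∈ Ico (T k) (z + 1), ν i) ^ (n + 1) / (n + 1).factorial := by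
      intro k n
      split_ifs with h
      · rw [Ico_eq_empty (by omega), Ico_eq_empty (by omega)]; simp
      · rw [sum_Ico_succ_top (by omega)]
        set s := ∑ i ∈ Ico (T k) z, ν i
        have hs : 0 ≤ s := s0 _ _
        have : s ^ (n + 1) + (n + 1) * (ν z * s ^ n) ≤ (s + ν z) ^ (n + 1) := by
          clear_value s
          induction n with
          | zero => simp
          | succ n ih =>
            rw [pow_succ (s + ν z)]
            have := mul_le_mul_of_nonneg_right ih (add_nonneg hs (h0 z))
            refine le_trans ?_ this
            have : 0 ≤ (n + 1 : ℝ) * (ν z * s ^ n) * ν z := by have := h0 z; positivity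
            push_cast; ring_nf; ring_nf at this; linarith
        rw [Nat.factorial_succ]; push_cast
        rw [div_add' _ _ _ (by positivity)]; gcongr
        refine le_trans (le_of_eq ?_) this; field_simp
    rw [hV]; simp only [Ms]
    have hjK : j < K := by omega
    rw [sum_eq_sum_Ico_succ_bot hjK] at ih1 ⊢
    have e1 : ∑ k ∈ Ico (j + 1) K, Vp ν (T k) * ((∑ i ∈ Ico (T k) z, ν i) ^ (k - j + 1) / (k - j + 1).factorial)
       + ν z * ∑ k ∈ Ico (j + 1) K, Vp ν (T k) * ((∑ i ∈ Ico (T k) z, ν i) ^ (k - (j + 1) + 1) / (k - (j + 1) + 1).factorial)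
       ≤ ∑ k ∈ Ico (j + 1) K, Vp ν (T k) * ((∑ i ∈ Ico (T k) (z + 1), ν i) ^ (k - j + 1) / (k - j + 1).factorial) := by
      rw [mul_sum, ← sum_add_distrib]
      refine sum_le_sum fun k hk => ?_
      have := mem_Ico.1 hk
      have e : k - (j + 1) + 1 = k - j := by omega
      rw [e]
      refine le_trans (le_of_eq ?_) (mul_le_mul_of_nonneg_left (step k (k - j)) (V0 _))
      split_ifs with h
      · rw [Ico_eq_empty (by omega)]; simp [show k - j ≠ 0 by omega]
      · ring
    have e2 := mul_le_mul_of_nonneg_left (step j 0) (V0 (T j))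
    simp only [Nat.sub_self, zero_add, pow_one, Nat.factorial_one, Nat.cast_one, div_one, pow_zero,
      Nat.factorial_zero, mul_one] at *
    split_ifs at e2 ⊢ with h
    · have : Ms T ν z j - ν z * Ms T ν z (j + 1) - (Vp ν z - ν z * Vp ν z) =
          (Ms T ν z j - Vp ν z) - ν z * (Ms T ν z (j + 1) - Vp ν z) := by ring
      rw [this]
      refine (abs_sub _ _).trans ?_
      rw [abs_mul, abs_of_nonneg (h0 z)]
      have := mul_le_mul_of_nonneg_left ih2 (h0 z)
      linarith
    · have : Ms T ν z j - 0 - (Vp ν z - ν z * Vp ν z) = (Ms T ν z j - Vp ν z) + ν z * Vp ν z := by ring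
      rw [this]
      refine (abs_add_le _ _).trans ?_
      rw [abs_of_nonneg (mul_nonneg (h0 z) (V0 z))]
      have hm : Vp ν z ≤ Vp ν (T j) := by
        obtain ⟨c, rfl⟩ := Nat.exists_eq_add_of_le (not_lt.1 h)
        simp only [Vp]; rw [prod_range_add]
        refine mul_le_of_le_one_right (V0 _) (prod_le_one (fun i _ => by linarith [h1 (T j + i)])
          (fun i _ => by linarith [h0 (T j + i)]))
      have h5 := mul_le_mul_of_nonneg_left hm (h0 z)
      have h6 : 0 ≤ ν z * ∑ k ∈ Ico (j + 1) K, Vp ν (T k) * ((∑ i ∈ Ico (T k) z, ν i) ^ (k - (j + 1) + 1) / (k - (j + 1) + 1).factorial) :=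
        mul_nonneg (h0 z) (sum_nonneg fun k _ => mul_nonneg (V0 _) (div_nonneg (pow_nonneg (s0 _ _) _) (by positivity)))
      linarith

open Classical in
noncomputable def Es (N z : ℕ) (L : ℝ) : Finset ℕ :=
  {e ∈ Icc 1 ⌊L⌋₊ | ∀ q : ℕ, q.Prime → q ∣ e → q < z ∧ ¬ q ∣ N}

lemma mem_Es {N z e : ℕ} {L : ℝ} : e ∈ Es N z L ↔
    (1 ≤ e ∧ (e:ℝ) ≤ L) ∧ ∀ q : ℕ, q.Prime → q ∣ e → q < z ∧ ¬ q ∣ N := by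
  simp only [Es, mem_filter, mem_Icc]
  refine and_congr_left fun _ => and_congr_right fun h => ?_
  rw [Nat.le_floor_iff' (by omega)]

lemma Bs_rem (T : ℕ → ℕ) (N : ℕ) (r : ℕ → ℝ) (Lev : ℕ → ℕ → ℝ) (h1 : ∀ j z, 1 ≤ Lev j z)
    (hm : ∀ j z, Lev j z ≤ Lev j (z + 1))
    (hs : ∀ j z, z < T j → z * Lev (j + 1) z ≤ Lev j (z + 1)) : ∀ z j d : ℕ,
    |Bs T N r z j d| ≤ ∑ e ∈ Es N z (Lev j z), |r (d * e)|
  | 0, j, d => by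
    simp only [Bs]
    have : 1 ∈ Es N 0 (Lev j 0) := mem_Es.2 ⟨⟨le_rfl, by simpa using h1 j 0⟩, fun q hq h =>
      absurd (Nat.dvd_one.1 h) hq.ne_one⟩
    calc _ = |r (d * 1)| := by rw [mul_one]
      _ ≤ _ := single_le_sum (f := fun e => |r (d * e)|) (fun _ _ => abs_nonneg _) this
  | z + 1, j, d => by
    have ih1 := Bs_rem T N r Lev h1 hm hs z j d
    have ih2 := Bs_rem T N r Lev h1 hm hs z (j + 1) (d * z)
    simp only [Bs]
    have sub1 : Es N z (Lev j z) ⊆ Es N (z + 1) (Lev j (z + 1)) := fun e he => by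
      rw [mem_Es] at he ⊢
      exact ⟨⟨he.1.1, he.1.2.trans (hm j z)⟩, fun q h1 h2 =>
        ⟨(he.2 q h1 h2).1.trans (by omega), (he.2 q h1 h2).2⟩⟩
    split_ifs with hz
    · have sub2 : (Es N z (Lev (j + 1) z)).image (fun e => z * e) ⊆ Es N (z + 1) (Lev j (z + 1)) := by
        intro x hx
        obtain ⟨e, he, rfl⟩ := mem_image.1 hx
        rw [mem_Es] at he ⊢
        refine ⟨⟨Nat.mul_pos hz.1.1.pos he.1.1, ?_⟩, fun q hq hd => ?_⟩
        · push_cast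
          exact (mul_le_mul_of_nonneg_left he.1.2 (by positivity)).trans (hs j z hz.2)
        · rcases hq.dvd_mul.1 hd with h | h
          · rw [(Nat.prime_dvd_prime_iff_eq hq hz.1.1).1 h]; exact ⟨by omega, hz.1.2⟩
          · exact ⟨(he.2 q hq h).1.trans (by omega), (he.2 q hq h).2⟩
      have disj : Disjoint (Es N z (Lev j z)) ((Es N z (Lev (j + 1) z)).image (fun e => z * e)) := by
        rw [disjoint_left]; rintro x hx hx2
        obtain ⟨e, he, rfl⟩ := mem_image.1 hx2
        have := ((mem_Es.1 hx).2 z hz.1.1 (Dvd.intro _ rfl)).1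
        omega
      calc _ ≤ _ := abs_sub _ _
        _ ≤ _ := add_le_add ih1 ih2
        _ = ∑ e ∈ Es N z (Lev j z) ∪ (Es N z (Lev (j + 1) z)).image (fun e => z * e), |r (d * e)| := by
          rw [sum_union disj, sum_image (fun a _ b _ h => Nat.eq_of_mul_eq_mul_left hz.1.1.pos h)]
          simp only [mul_assoc]
        _ ≤ _ := sum_le_sum_of_subset_of_nonneg (union_subset sub1 sub2) fun _ _ _ => abs_nonneg _
    · rw [sub_zero]
      exact ih1.trans (sum_le_sum_of_subset_of_nonneg sub1 fun _ _ _ => abs_nonneg _)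
end

section
open Finset Filter Topology

noncomputable def zt (i : ℕ) : ℝ := if i = 0 then 1 else 2 / 3 * (5 / 8) ^ (i - 1)

lemma zt_pos (i : ℕ) : 0 < zt i := by unfold zt; split_ifs <;> positivity
lemma zt_le (i : ℕ) : zt i ≤ 1 := by
  unfold zt; split_ifs
  · rfl
  · have : ((5:ℝ) / 8) ^ (i - 1) ≤ 1 := pow_le_one₀ (by norm_num) (by norm_num)
    linarith

noncomputable def fz (b : ℕ) (a : ℝ) (i : ℕ) : ℝ :=
  1 / zt i * Real.exp a * ((Real.log (1 / zt i) + a) ^ (2 * i + b) / (2 * i + b).factorial)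

lemma lzt_nonneg (i : ℕ) : 0 ≤ Real.log (1 / zt i) :=
  Real.log_nonneg ((one_le_div (zt_pos i)).2 (zt_le i))

lemma fz_nonneg (b : ℕ) {a : ℝ} (ha : 0 ≤ a) (i : ℕ) : 0 ≤ fz b a i := by
  have := zt_pos i; have := lzt_nonneg i; unfold fz; positivity

lemma fz_le (b : ℕ) {a : ℝ} (ha : 0 ≤ a) (i : ℕ) :
    fz b a i ≤ Real.exp (5 * a) * ((1 / zt i) ^ 5 / 4 ^ (2 * i + b)) := by
  have h0 := lzt_nonneg i
  have hz : 0 < 1 / zt i := one_div_pos.2 (zt_pos i)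
  have h := Real.pow_div_factorial_le_exp (x := 4 * (Real.log (1 / zt i) + a)) (by positivity) (2 * i + b)
  have e : Real.exp (4 * (Real.log (1 / zt i) + a)) = (1 / zt i) ^ 4 * Real.exp (4 * a) := by
    rw [mul_add, Real.exp_add, show (4:ℝ) = ((4:ℕ):ℝ) by norm_num, Real.exp_nat_mul, Real.exp_log hz]
  rw [e, mul_pow, mul_div_assoc] at h
  have h2 : (Real.log (1 / zt i) + a) ^ (2 * i + b) / (2 * i + b).factorial ≤
      (1 / zt i) ^ 4 * Real.exp (4 * a) / 4 ^ (2 * i + b) := by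
    rw [le_div_iff₀ (by positivity)]; linarith
  calc fz b a i ≤ 1 / zt i * Real.exp a * ((1 / zt i) ^ 4 * Real.exp (4 * a) / 4 ^ (2 * i + b)) := by
        unfold fz; gcongr
    _ = (Real.exp a * Real.exp (4 * a)) * ((1 / zt i) ^ 5 / 4 ^ (2 * i + b)) := by ring
    _ = _ := by rw [← Real.exp_add]; ring_nf

lemma zt5 (b i : ℕ) : (1 / zt (i + 1)) ^ 5 / 4 ^ (2 * (i + 1) + b) =
    (3 / 2) ^ 5 / 4 ^ (2 + b) * (2048 / 3125 : ℝ) ^ i := by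
  have : zt (i + 1) = 2 / 3 * (5 / 8) ^ i := by simp [zt]
  rw [this, show 2 * (i + 1) + b = (2 + b) + 2 * i by ring, pow_add, pow_mul, one_div, mul_inv, mul_pow,
    ← inv_pow, ← pow_mul, mul_comm i 5, pow_mul, mul_div_mul_comm, ← div_pow]
  norm_num

lemma summ_dom (b : ℕ) : Summable fun i => (1 / zt i) ^ 5 / (4:ℝ) ^ (2 * i + b) := by
  rw [← summable_nat_add_iff 1]; simp only [zt5]
  exact (summable_geometric_of_lt_one (by norm_num) (by norm_num)).mul_left _

lemma fz_tendsto (b : ℕ) (A : ℝ) (hA : 0 < A) :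
    Tendsto (fun Z : ℕ => ∑' i, fz b (A / max 1 (zt i * Real.log Z)) i) atTop (𝓝 (∑' i, fz b 0 i)) := by
  refine tendsto_tsum_of_dominated_convergence ((summ_dom b).mul_left (Real.exp (5 * A))) ?_ ?_
  · intro i
    have h1 : Tendsto (fun Z : ℕ => A / max 1 (zt i * Real.log Z)) atTop (𝓝 0) := by
      refine tendsto_const_nhds.div_atTop ?_
      refine tendsto_atTop_mono (fun Z => le_max_right _ _) ?_
      exact (Real.tendsto_log_atTop.comp tendsto_natCast_atTop_atTop).const_mul_atTop (zt_pos i)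
    have hc : Continuous fun a => fz b a i := by unfold fz; fun_prop
    exact (hc.tendsto 0).comp h1
  · refine Eventually.of_forall fun Z i => ?_
    have h1 : 0 ≤ A / max 1 (zt i * Real.log Z) := by positivity
    rw [Real.norm_of_nonneg (fz_nonneg b h1 i)]
    refine (fz_le b h1 i).trans ?_
    have := zt_pos i
    gcongr
    exact div_le_self hA.le (le_max_left _ _)

lemma log15 : Real.log (3 / 2) ≤ 0.4055 := by
  rw [Real.log_le_iff_le_exp (by norm_num)]
  refine le_trans ?_ (Real.sum_le_exp_of_nonneg (by norm_num) 8)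
  norm_num [sum_range_succ, Nat.factorial]
lemma log16 : Real.log (8 / 5) ≤ 0.4701 := by
  rw [Real.log_le_iff_le_exp (by norm_num)]
  refine le_trans ?_ (Real.sum_le_exp_of_nonneg (by norm_num) 8)
  norm_num [sum_range_succ, Nat.factorial]

def qz (b i : ℕ) : ℚ := if i = 0 then 0 else 3 / 2 * (8 / 5) ^ (i - 1) *
    ((4055 / 10000 + 4701 / 10000 * (i - 1)) ^ (2 * i + b) / (2 * i + b).factorial)

lemma fz0_le (b : ℕ) (hb : b ≠ 0) (i : ℕ) : fz b 0 i ≤ qz b i := by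
  unfold qz
  rcases Nat.eq_zero_or_pos i with rfl | hi
  · simp [fz, zt, hb]
  obtain ⟨i, rfl⟩ : ∃ k, i = k + 1 := ⟨i - 1, by omega⟩
  have e : 1 / zt (i + 1) = 3 / 2 * (8 / 5) ^ i := by
    simp only [zt]; rw [if_neg (by omega), one_div, mul_inv, ← inv_pow]; norm_num
  have hl := lzt_nonneg (i + 1)
  simp only [fz, add_zero, Real.exp_zero, mul_one]
  rw [if_neg (by omega)]
  push_cast
  rw [e] at *
  simp only [Nat.add_sub_cancel, add_sub_cancel_right]
  gcongr
  rw [Real.log_mul (by norm_num) (by positivity), Real.log_pow]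
  have := mul_le_mul_of_nonneg_left log16 (Nat.cast_nonneg (α := ℝ) i)
  linarith [log15]

lemma fz_num (b : ℕ) (hb : b ≠ 0) (c : ℚ) (hc : (∑ i ∈ range 16, qz b i : ℚ) +
    (3 / 2) ^ 5 / 4 ^ (2 + b) * (2048 / 3125) ^ 15 / (1 - 2048 / 3125) < c) :
    ∑' i, fz b 0 i < c := by
  have hd : ∀ i, fz b 0 i ≤ (1 / zt i) ^ 5 / 4 ^ (2 * i + b) := fun i => by
    simpa using fz_le b le_rfl i
  have hs : Summable (fz b 0) := (summ_dom b).of_nonneg_of_le (fz_nonneg b le_rfl) hd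
  rw [← hs.sum_add_tsum_nat_add 16]
  have h1 : ∑ i ∈ range 16, fz b 0 i ≤ ((∑ i ∈ range 16, qz b i : ℚ) : ℝ) := by
    rw [Rat.cast_sum]; exact sum_le_sum fun i _ => fz0_le b hb i
  have h2 : ∑' i, fz b 0 (i + 16) ≤ (3 / 2) ^ 5 / 4 ^ (2 + b) * (2048 / 3125) ^ 15 / (1 - 2048 / 3125) := by
    have hg : HasSum (fun i : ℕ => (3 / 2) ^ 5 / 4 ^ (2 + b) * (2048 / 3125) ^ 15 * (2048 / 3125 : ℝ) ^ i)
        ((3 / 2) ^ 5 / 4 ^ (2 + b) * (2048 / 3125) ^ 15 * (1 - 2048 / 3125)⁻¹) :=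
      (hasSum_geometric_of_lt_one (by norm_num) (by norm_num)).mul_left _
    rw [div_eq_mul_inv _ ((1:ℝ) - 2048 / 3125), ← hg.tsum_eq]
    refine ((summable_nat_add_iff 16).2 hs).tsum_le_tsum (fun i => ?_) hg.summable
    refine (hd _).trans (le_of_eq ?_)
    rw [show i + 16 = (i + 15) + 1 by ring, zt5, pow_add]; ring
  have h3 : ((∑ i ∈ range 16, qz b i : ℚ) : ℝ) +
    (3 / 2) ^ 5 / 4 ^ (2 + b) * (2048 / 3125) ^ 15 / (1 - 2048 / 3125) < c := by
    have := (Rat.cast_lt (K := ℝ)).2 hc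
    push_cast at this ⊢; exact this
  linarith

lemma fz_num1 : ∑' i, fz 1 0 i < (0.043 : ℚ) := fz_num 1 (by norm_num) _ (by decide +kernel)
lemma fz_num2 : ∑' i, fz 2 0 i < (0.0063 : ℚ) := fz_num 2 (by norm_num) _ (by decide +kernel)
end

section
open Finset Filter Topology ArithmeticFunction

noncomputable def Tu (Z j : ℕ) : ℕ := if Even j then ⌈(Z:ℝ) ^ zt (j / 2)⌉₊ else Z
noncomputable def Tl (Z j : ℕ) : ℕ := if j = 0 then Z else Tu Z (j - 1)

lemma Tu_even (Z i : ℕ) : Tu Z (2 * i) = ⌈(Z:ℝ) ^ zt i⌉₊ := by simp [Tu]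
lemma Tu_odd (Z i : ℕ) : Tu Z (2 * i + 1) = Z := by simp [Tu]

lemma Vp_nonneg {N : ℕ} (hN : 2 ∣ N) (z : ℕ) : 0 < Vp (nu N) z :=
  prod_pos fun i _ => by linarith [nu_lt (n := i) hN]
lemma nu_small {N n : ℕ} (hN : 2 ∣ N) (hn : n < 3) : nu N n = 0 := by
  rw [nu, if_neg]; rintro ⟨h1, h2⟩
  have := h1.two_le
  exact h2 ((by omega : n = 2) ▸ hN)

lemma term_bd : ∃ A : ℝ, 0 < A ∧ ∀ N Z i n : ℕ, 2 ∣ N → 3 ≤ Z →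
    Vp (nu N) ⌈(Z:ℝ) ^ zt i⌉₊ * ((∑ k ∈ Ico ⌈(Z:ℝ) ^ zt i⌉₊ Z, nu N k) ^ n / n.factorial) ≤
    Vp (nu N) Z * (1 / zt i * Real.exp (A / max 1 (zt i * Real.log Z)) *
      ((Real.log (1 / zt i) + A / max 1 (zt i * Real.log Z)) ^ n / n.factorial)) := by
  obtain ⟨A, hA, h⟩ := mert4
  refine ⟨A, hA, fun N Z i n hN hZ => ?_⟩
  have hZ3 : (3:ℝ) ≤ Z := by exact_mod_cast hZ
  have hlZ : 0 < Real.log Z := Real.log_pos (by linarith)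
  set T := ⌈(Z:ℝ) ^ zt i⌉₊
  have hTZ : T ≤ Z := by
    rw [Nat.ceil_le]
    exact (Real.rpow_le_rpow_of_exponent_le (by linarith) (zt_le i)).trans (by rw [Real.rpow_one])
  set w := max 3 T
  have hw3 : 3 ≤ w := le_max_left _ _
  have hw3' : (3:ℝ) ≤ w := by exact_mod_cast hw3
  have hwl : max 1 (zt i * Real.log Z) ≤ Real.log w := by
    apply max_le
    · rw [Real.le_log_iff_exp_le (by linarith)]; linarith [Real.exp_one_lt_d9]
    · rw [← Real.log_rpow (by linarith)]
      apply Real.log_le_log (by positivity)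
      exact (Nat.le_ceil _).trans (by exact_mod_cast le_max_right 3 T)
  have hm : (0:ℝ) < max 1 (zt i * Real.log Z) := by positivity
  obtain ⟨h1, h2⟩ := h N w Z hN hw3 (max_le hZ hTZ)
  have hzt := zt_pos i
  have hr : Real.log Z / Real.log w ≤ 1 / zt i := by
    rw [div_le_div_iff₀ (hm.trans_le hwl) hzt]; linarith [(le_max_right _ _).trans hwl]
  have ha : A / Real.log w ≤ A / max 1 (zt i * Real.log Z) := by gcongr
  have s1 : ∑ k ∈ Ico T Z, nu N k ≤ Real.log (1 / zt i) + A / max 1 (zt i * Real.log Z) := by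
    have : ∑ k ∈ Ico T Z, nu N k ≤ ∑ k ∈ Ico w Z, nu N k := by
      refine le_of_eq (sum_subset (Ico_subset_Ico_left (le_max_right _ _)) fun k hk hk0 => ?_).symm
      rw [mem_Ico] at hk hk0
      refine nu_small hN ?_
      by_contra h
      exact hk0 ⟨max_le (by omega) hk.1, hk.2⟩
    refine this.trans (h1.trans (add_le_add (Real.log_le_log ?_ hr) ha))
    exact div_pos hlZ (hm.trans_le hwl)
  have v1 : Vp (nu N) T ≤ Vp (nu N) Z * (1 / zt i * Real.exp (A / max 1 (zt i * Real.log Z))) := by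
    have : Vp (nu N) T ≤ Vp (nu N) w := by
      rcases le_total 3 T with h | h
      · rw [show w = T from max_eq_right h]
      · have h3 : Vp (nu N) w = 1 := by
          rw [show w = 3 from max_eq_left h]
          exact prod_eq_one fun i hi => by rw [nu_small hN (mem_range.1 hi), sub_zero]
        rw [h3]
        exact prod_le_one (fun i _ => by linarith [nu_lt (n := i) hN]) fun i _ => by linarith [nu_nonneg N i]
    refine this.trans (h2.trans (mul_le_mul_of_nonneg_left ?_ (Vp_nonneg hN Z).le))
    gcongr
  have := (Vp_nonneg hN T).le
  have := (Vp_nonneg hN Z).le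
  have : 0 ≤ ∑ k ∈ Ico T Z, nu N k := sum_nonneg fun k _ => nu_nonneg N k
  rw [← mul_assoc]; gcongr

lemma sum_par (g f : ℕ → ℝ) (c : ℝ) (h : ∀ i, g (2 * i) + g (2 * i + 1) ≤ c * f i) (K : ℕ) :
    ∑ k ∈ Ico 0 (2 * K), g k ≤ c * ∑ i ∈ range K, f i := by
  rw [← range_eq_Ico]
  induction K with
  | zero => simp
  | succ K ih =>
    rw [show 2 * (K + 1) = 2 * K + 1 + 1 by ring, sum_range_succ, sum_range_succ, sum_range_succ, mul_add]
    linarith [h K]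

lemma sieve_main : ∃ Z0 : ℕ, ∀ Z ≥ Z0, ∀ N, 2 ∣ N →
    Ms (Tu Z) (nu N) Z 0 ≤ 1.043 * Vp (nu N) Z ∧ 0.9937 * Vp (nu N) Z ≤ Ms (Tl Z) (nu N) Z 0 := by
  obtain ⟨A, hA, h⟩ := term_bd
  have t1 := (fz_tendsto 1 A hA).eventually (eventually_lt_nhds fz_num1)
  have t2 := (fz_tendsto 2 A hA).eventually (eventually_lt_nhds fz_num2)
  obtain ⟨Z0, hZ0⟩ := eventually_atTop.1 (t1.and t2)
  have pf : ∀ (Z b K : ℕ), ∑ i ∈ range K, fz b (A / max 1 (zt i * Real.log Z)) i ≤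
      ∑' i, fz b (A / max 1 (zt i * Real.log Z)) i := fun Z b K => by
    have a0 : ∀ i, 0 ≤ A / max 1 (zt i * Real.log Z) := fun i => by positivity
    refine Summable.sum_le_tsum _ (fun i _ => fz_nonneg b (a0 i) i) ?_
    refine ((summ_dom b).mul_left (Real.exp (5 * A))).of_nonneg_of_le (fun i => fz_nonneg b (a0 i) i)
      fun i => (fz_le b (a0 i) i).trans ?_
    have := zt_pos i
    gcongr
    exact div_le_self hA.le (le_max_left _ _)
  refine ⟨max 3 Z0, fun Z hZ N hN => ?_⟩
  have hZ3 : 3 ≤ Z := (le_max_left _ _).trans hZ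
  obtain ⟨b1, b2⟩ := hZ0 Z ((le_max_right _ _).trans hZ)
  have V0 := Vp_nonneg hN Z
  have e1 := Ms_err (T := Tu Z) (nu_nonneg N) (fun n => (nu_lt (n := n) hN).trans (by norm_num)) (2 * Z) Z 0 (by omega)
  have e2 := Ms_err (T := Tl Z) (nu_nonneg N) (fun n => (nu_lt (n := n) hN).trans (by norm_num)) (2 * Z) Z 0 (by omega)
  have e1' := e1.trans (sum_par _ (fun i => fz 1 (A / max 1 (zt i * Real.log Z)) i) (Vp (nu N) Z) (fun i => by
    rw [Tu_even, Tu_odd, Ico_self]; simpa [fz] using h N Z i (2 * i + 1) hN hZ3) Z)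
  have e2' := e2.trans (sum_par _ (fun i => fz 2 (A / max 1 (zt i * Real.log Z)) i) (Vp (nu N) Z) (fun i => by
    have x1 : Tl Z (2 * i) = Z := by
      rcases i with _ | i
      · rfl
      · rw [Tl, if_neg (by omega), show 2 * (i + 1) - 1 = 2 * i + 1 by omega, Tu_odd]
    have x2 : Tl Z (2 * i + 1) = ⌈(Z:ℝ) ^ zt i⌉₊ := by
      rw [Tl, if_neg (by omega), Nat.add_sub_cancel, Tu_even]
    rw [x1, x2, Ico_self]; simpa [fz] using h N Z i (2 * i + 2) hN hZ3) Z)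
  have c1 := mul_le_mul_of_nonneg_left ((pf Z 1 Z).trans b1.le) V0.le
  have c2 := mul_le_mul_of_nonneg_left ((pf Z 2 Z).trans b2.le) V0.le
  have d1 := abs_le.1 (e1'.trans c1)
  have d2 := abs_le.1 (e2'.trans c2)
  norm_num at d1 d2 ⊢
  constructor <;> linarith

noncomputable def rz (i : ℕ) : ℝ := if i = 0 then 50 / 9 else 16 / 3 * zt i
noncomputable def Lu (Z j n : ℕ) : ℝ :=
  if Even j then (Z:ℝ) ^ rz (j / 2) else max 1 (n:ℝ) * (Z:ℝ) ^ rz ((j + 1) / 2)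

lemma rz_succ (i : ℕ) : rz i = 2 * zt i + rz (i + 1) := by
  rcases i with _ | i
  · norm_num [rz, zt]
  · simp only [rz, zt, Nat.add_sub_cancel, if_neg (Nat.succ_ne_zero _), pow_succ]; ring

lemma Lu_facts {Z : ℕ} (hZ : 1 ≤ Z) : (∀ j n, 1 ≤ Lu Z j n) ∧ (∀ j n, Lu Z j n ≤ Lu Z j (n + 1)) ∧
    ∀ j n, n < Tu Z j → n * Lu Z (j + 1) n ≤ Lu Z j (n + 1) := by
  have hZ' : (1:ℝ) ≤ Z := by exact_mod_cast hZ
  have hr : ∀ i, 1 ≤ (Z:ℝ) ^ rz i := fun i => Real.one_le_rpow hZ' (by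
    have := zt_pos i; unfold rz; split_ifs <;> positivity)
  refine ⟨fun j n => ?_, fun j n => ?_, fun j n hn => ?_⟩
  · unfold Lu; split_ifs
    · exact hr _
    · exact one_le_mul_of_one_le_of_one_le (le_max_left _ _) (hr _)
  · unfold Lu; split_ifs
    · rfl
    · push_cast; gcongr; linarith
  · rcases Nat.even_or_odd' j with ⟨i, rfl | rfl⟩
    · rw [Tu_even, Nat.lt_ceil] at hn
      simp only [Lu, Nat.not_even_bit1, if_false, even_two_mul, if_true]
      rw [show (2 * i + 1 + 1) / 2 = i + 1 by omega, show 2 * i / 2 = i by omega, rz_succ i,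
        Real.rpow_add (by linarith), ← mul_assoc]
      gcongr
      have h1 : (Z:ℝ) ^ (2 * zt i) = (Z:ℝ) ^ zt i * (Z:ℝ) ^ zt i := by
        rw [two_mul, Real.rpow_add (by linarith)]
      rw [h1]
      have : (1:ℝ) ≤ (Z:ℝ) ^ zt i := Real.one_le_rpow hZ' (zt_pos i).le
      gcongr
      exact max_le this hn.le
    · simp only [Lu, Nat.not_even_bit1, if_false]
      rw [if_pos (by simp [Nat.even_add_one])]
      gcongr
      push_cast; exact (le_max_right _ _).trans' (by linarith)

lemma rem_u {Z : ℕ} (hZ : 1 ≤ Z) (N d : ℕ) (r : ℕ → ℝ) :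
    |Bs (Tu Z) N r Z 0 d| ≤ ∑ e ∈ Es N Z ((Z:ℝ) ^ (50/9:ℝ)), |r (d * e)| := by
  obtain ⟨h1, h2, h3⟩ := Lu_facts hZ
  have := Bs_rem (Tu Z) N r (Lu Z) h1 h2 h3 Z 0 d
  simpa [Lu, rz] using this

lemma rem_l {Z : ℕ} (hZ : 1 ≤ Z) (N d : ℕ) (r : ℕ → ℝ) :
    |Bs (Tl Z) N r Z 0 d| ≤ ∑ e ∈ Es N Z (Z * (Z:ℝ) ^ (50/9:ℝ)), |r (d * e)| := by
  obtain ⟨h1, h2, h3⟩ := Lu_facts hZ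
  have hZ' : (1:ℝ) ≤ Z := by exact_mod_cast hZ
  have hz : (1:ℝ) ≤ (Z:ℝ) ^ (50/9:ℝ) := Real.one_le_rpow hZ' (by norm_num)
  have := Bs_rem (Tl Z) N r (fun j n => if j = 0 then max 1 (n:ℝ) * (Z:ℝ) ^ (50/9:ℝ) else Lu Z (j - 1) n)
    (fun j n => ?_) (fun j n => ?_) (fun j n hn => ?_) Z 0 d
  · simpa [hZ'] using this
  · split_ifs
    · exact one_le_mul_of_one_le_of_one_le (le_max_left _ _) hz
    · exact h1 _ _
  · split_ifs
    · push_cast; gcongr; linarith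
    · exact h2 _ _
  · rcases j with _ | j
    · simp only [if_true, if_neg (Nat.succ_ne_zero _), Nat.add_sub_cancel, Nat.cast_add, Nat.cast_one]
      have : Lu Z 0 n = (Z:ℝ) ^ (50/9:ℝ) := by simp [Lu, rz]
      rw [this]; gcongr; exact (le_max_right _ _).trans' (by linarith)
    · simp only [if_neg (Nat.succ_ne_zero _), Nat.add_sub_cancel, Tl] at hn ⊢
      exact h3 j n hn

noncomputable def Rm (X : ℝ) (N d : ℕ) : ℝ := PsiAP X d N - Psi X / d.totient

lemma Bs_psi (T : ℕ → ℕ) {X : ℝ} {N : ℕ} (hX : X ≤ N) (z j d : ℕ) (hd : ∀ p < z, p.Prime → d.Coprime p) :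
    ∑ n ∈ Icc 1 ⌊X⌋₊, Λ n * wt (n / X) * Bs T N (fun d => if d ∣ N - n then 1 else 0) z j d =
    Psi X * (1 / (d.totient : ℝ) * Ms T (nu N) z j) + Bs T N (Rm X N) z j d := by
  rw [← Bs_main T N z j d hd, ← Bs_add, ← Bs_sum]
  congr 1; ext d
  rw [Rm, PsiAP]
  have : ∀ n ∈ Icc 1 ⌊X⌋₊, Λ n * wt (n / X) * (if d ∣ N - n then (1:ℝ) else 0) =
      if (N : ZMod d) = n then Λ n * wt (n / X) else 0 := fun n hn => by
    have hnN : n ≤ N := by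
      have := (Nat.le_floor_iff' (by have := (mem_Icc.1 hn).1; omega)).1 (mem_Icc.1 hn).2
      exact_mod_cast this.trans hX
    have : (N : ZMod d) = n ↔ d ∣ N - n := by
      rw [← ZMod.natCast_eq_zero_iff, Nat.cast_sub hnN, sub_eq_zero]
    simp [this]
  rw [sum_congr rfl this]; ring

lemma sieve_apply : ∃ Z0 : ℕ, ∀ Z ≥ Z0, ∀ (N : ℕ) (X : ℝ), 2 ∣ N → X ≤ N → 0 < X →
    (∀ d : ℕ, 1 ≤ d → (∀ p < Z, p.Prime → d.Coprime p) →
    ∑ n ∈ Icc 1 ⌊X⌋₊, Λ n * wt (n / X) * Sf N (N - n) Z d ≤ Psi X * (1 / d.totient * (1.043 * Vp (nu N) Z)) +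
      ∑ e ∈ Es N Z ((Z:ℝ) ^ (50/9:ℝ)), |Rm X N (d * e)|) ∧
    Psi X * (0.9937 * Vp (nu N) Z) - ∑ e ∈ Es N Z (Z * (Z:ℝ) ^ (50/9:ℝ)), |Rm X N e| ≤
      ∑ n ∈ Icc 1 ⌊X⌋₊, Λ n * wt (n / X) * Sf N (N - n) Z 1 := by
  obtain ⟨Z0, h0⟩ := sieve_main
  refine ⟨max 1 Z0, fun Z hZ N X hN hXN hX => ?_⟩
  obtain ⟨h1, h2⟩ := h0 Z ((le_max_right _ _).trans hZ) N hN
  have hZ1 := (le_max_left _ _).trans hZ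
  have a0 : ∀ n : ℕ, 0 ≤ Λ n * wt (n / X) := fun n => mul_nonneg vonMangoldt_nonneg (wt_nonneg _)
  have hP : 0 ≤ Psi X := sum_nonneg fun n _ => a0 n
  constructor
  · intro d hd hc
    have s := fun n => (sandwich (Tu Z) N (N - n) Even (fun j => Nat.even_add_one) Z 0 d (fun j hj => by
      rw [Tu, if_neg hj]) hc).1 (by simp)
    refine (sum_le_sum fun n _ => mul_le_mul_of_nonneg_left (s n) (a0 n)).trans ?_
    rw [Bs_psi _ hXN _ _ _ hc]
    exact add_le_add (by gcongr) ((le_abs_self _).trans (rem_u hZ1 N d _))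
  · have hc : ∀ p < Z, p.Prime → Nat.Coprime 1 p := fun p _ _ => Nat.coprime_one_left p
    have s := fun n => (sandwich (Tl Z) N (N - n) (fun j => ¬ Even j) (fun j => by rw [Nat.even_add_one]) Z 0 1
      (fun j hj => by
        rw [not_not] at hj
        rw [Tl]; split_ifs with h
        · rfl
        · rw [Tu, if_neg]
          obtain ⟨j, rfl⟩ : ∃ k, j = k + 1 := ⟨j - 1, by omega⟩
          rw [Nat.add_sub_cancel]; exact Nat.even_add_one.1 hj) hc).2 (by simp)
    refine le_trans ?_ (sum_le_sum fun n _ => mul_le_mul_of_nonneg_left (s n) (a0 n))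
    rw [Bs_psi _ hXN _ _ _ hc]
    have := abs_le.1 (rem_l hZ1 N 1 (Rm X N))
    simp only [one_mul, Nat.totient_one, Nat.cast_one, div_one] at this ⊢
    have := mul_le_mul_of_nonneg_left h2 hP
    linarith
end

section
open Finset Filter Topology ArithmeticFunction

noncomputable def GG (N : ℕ) : ℝ := ∏ p ∈ N.primeFactors with 2 < p, ((p : ℝ) - 1) / ((p : ℝ) - 2)

lemma GG_fac {p : ℕ} (hp : 2 < p) : 1 ≤ ((p : ℝ) - 1) / ((p : ℝ) - 2) := by
  have : (3:ℝ) ≤ p := by exact_mod_cast hp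
  rw [one_le_div (by linarith)]; linarith

lemma GG_ge (N : ℕ) : 1 ≤ GG N := by
  unfold GG
  refine Finset.prod_induction _ (fun x : ℝ => 1 ≤ x) (fun a b => one_le_mul_of_one_le_of_one_le) le_rfl fun p hp => GG_fac (mem_filter.1 hp).2

lemma CN_le (N : ℕ) : CN N ≤ GG N := by
  have h0 := GG_ge N
  unfold CN
  refine mul_le_of_le_one_right (by unfold GG at h0; linarith) ?_
  have hf : ∀ p : {p : ℕ // p.Prime ∧ 2 < p}, 0 ≤ 1 - 1 / (((p : ℕ) : ℝ) - 1) ^ 2 ∧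
      1 - 1 / (((p : ℕ) : ℝ) - 1) ^ 2 ≤ 1 := fun p => by
    have : (3:ℝ) ≤ (p:ℕ) := by exact_mod_cast p.2.2
    have h1 : (1:ℝ) ≤ ((p:ℕ) - 1) ^ 2 := by nlinarith
    exact ⟨by rw [sub_nonneg]; exact div_le_one_of_le₀ h1 (by positivity),
      by linarith [show 0 ≤ 1 / (((p:ℕ) : ℝ) - 1) ^ 2 by positivity]⟩
  by_cases hm : Multipliable fun p : {p : ℕ // p.Prime ∧ 2 < p} => 1 - 1 / (((p : ℕ) : ℝ) - 1) ^ 2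
  · exact le_of_tendsto' hm.hasProd fun s => prod_le_one (fun p _ => (hf p).1) fun p _ => (hf p).2
  · rw [tprod_eq_one_of_not_multipliable hm]

lemma Vp_lower : ∃ c : ℝ, 0 < c ∧ ∀ N z : ℕ, 2 ∣ N → N ≠ 0 → 38 ≤ z → N ≤ z ^ 18 →
    c * GG N / Real.log z ≤ Vp (nu N) z := by
  obtain ⟨A, hA, h⟩ := mert4
  have l3 : 0 < Real.log 3 := Real.log_pos (by norm_num)
  refine ⟨Real.log 3 / Real.exp (A / Real.log 3) / 3, by positivity, fun N z hN hN0 hz hNz => ?_⟩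
  have hz' : (38:ℝ) ≤ z := by exact_mod_cast hz
  have lz : 0 < Real.log z := Real.log_pos (by linarith)
  have h1 := (h 2 3 z (dvd_refl _) le_rfl (by omega)).2
  have h2 : Vp (nu 2) 3 = 1 :=
    prod_eq_one fun i hi => by rw [nu_small (dvd_refl 2) (mem_range.1 hi), sub_zero]
  rw [h2] at h1
  set s1 := {p ∈ N.primeFactors | 2 < p ∧ p < z}
  set s2 := {p ∈ N.primeFactors | 2 < p ∧ z ≤ p}
  have hG : GG N = (∏ p ∈ s1, ((p : ℝ) - 1) / ((p : ℝ) - 2)) * ∏ p ∈ s2, ((p : ℝ) - 1) / ((p : ℝ) - 2) := by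
    rw [GG, ← prod_filter_mul_prod_filter_not _ (fun p => p < z)]
    simp only [filter_filter, not_lt, s1, s2]
  have hV : Vp (nu 2) z * ∏ p ∈ s1, ((p : ℝ) - 1) / ((p : ℝ) - 2) = Vp (nu N) z := by
    have e1 : ∏ p ∈ s1, ((p : ℝ) - 1) / ((p : ℝ) - 2) =
        ∏ p ∈ range z, if p ∈ s1 then ((p : ℝ) - 1) / ((p : ℝ) - 2) else 1 := by
      rw [prod_ite_mem, inter_eq_right.2]
      intro p hp; exact mem_range.2 (mem_filter.1 hp).2.2
    rw [e1, Vp, Vp, ← prod_mul_distrib]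
    refine prod_congr rfl fun p hp => ?_
    have hpz := mem_range.1 hp
    simp only [s1, mem_filter, Nat.mem_primeFactors, nu]
    by_cases hpp : p.Prime
    · by_cases h2 : p = 2
      · subst h2; simp [hN]
      have h2' : 2 < p := lt_of_le_of_ne hpp.two_le (Ne.symm h2)
      have h3 : ¬ p ∣ 2 := fun h => by have := Nat.le_of_dvd (by norm_num) h; omega
      have : (3:ℝ) ≤ p := by exact_mod_cast h2'
      have p1 : (p:ℝ) - 1 ≠ 0 := by linarith
      have p2 : (p:ℝ) - 2 ≠ 0 := by linarith
      by_cases hd : p ∣ N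
      · simp only [hpp, h3, hd, hN0, h2', hpz, not_false_eq_true, and_self, if_true, ne_eq, not_true_eq_false, and_false, if_false]
        field_simp; ring
      · simp [hpp, h3, hd]
    · simp [hpp]
  have hP2 : ∏ p ∈ s2, ((p : ℝ) - 1) / ((p : ℝ) - 2) ≤ 3 := by
    have hcard : s2.card ≤ 18 := by
      have h5 : z ^ s2.card ≤ N := by
        calc z ^ s2.card ≤ ∏ p ∈ s2, p := by
              rw [← prod_const]; exact prod_le_prod' fun p hp => (mem_filter.1 hp).2.2
          _ ≤ ∏ p ∈ N.primeFactors, p := prod_le_prod_of_subset_of_one_le' (filter_subset _ _)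
              fun p hp _ => (Nat.prime_of_mem_primeFactors hp).pos
          _ ≤ N := Nat.le_of_dvd (Nat.pos_of_ne_zero hN0) (Nat.prod_primeFactors_dvd N)
      exact (Nat.pow_le_pow_iff_right (by omega)).1 (h5.trans hNz)
    calc _ ≤ ∏ p ∈ s2, Real.exp (1 / 36) := by
          refine prod_le_prod (fun p hp => (zero_le_one.trans (GG_fac (mem_filter.1 hp).2.1))) fun p hp => ?_
          have : (38:ℝ) ≤ p := hz'.trans (by exact_mod_cast (mem_filter.1 hp).2.2)
          refine le_trans ?_ (Real.add_one_le_exp _)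
          rw [div_le_iff₀ (by linarith)]; linarith
      _ = Real.exp (s2.card * (1 / 36)) := by rw [prod_const, ← Real.exp_nat_mul]
      _ ≤ Real.exp 1 := by
        apply Real.exp_le_exp.2
        have : (s2.card : ℝ) ≤ 18 := by exact_mod_cast hcard
        linarith
      _ ≤ 3 := by linarith [Real.exp_one_lt_d9]
  have hP1 : 0 ≤ ∏ p ∈ s1, ((p : ℝ) - 1) / ((p : ℝ) - 2) :=
    prod_nonneg fun p hp => (zero_le_one.trans (GG_fac (mem_filter.1 hp).2.1))
  rw [← hV, hG, div_le_iff₀ lz]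
  have e := Real.exp_pos (A / Real.log 3)
  have h5 : Real.log 3 / Real.exp (A / Real.log 3) ≤ Vp (nu 2) z * Real.log z := by
    rw [div_le_iff₀ e]
    push_cast at h1
    calc Real.log 3 = 1 * Real.log 3 := (one_mul _).symm
      _ ≤ _ := mul_le_mul_of_nonneg_right h1 l3.le
      _ = _ := by field_simp
  set P1 := ∏ p ∈ s1, ((p : ℝ) - 1) / ((p : ℝ) - 2)
  set P2 := ∏ p ∈ s2, ((p : ℝ) - 1) / ((p : ℝ) - 2)
  calc _ ≤ Real.log 3 / Real.exp (A / Real.log 3) / 3 * (P1 * 3) := by gcongr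
    _ = Real.log 3 / Real.exp (A / Real.log 3) * P1 := by ring
    _ ≤ Vp (nu 2) z * Real.log z * P1 := by gcongr
    _ = _ := by ring

lemma Psi_lower : ∃ X0 : ℝ, ∀ X ≥ X0, X / 10 ≤ Psi X := by
  have h1 : ∀ᶠ X : ℝ in atTop, Real.log (X + 2) ≤ 0.01 * (X + 2) := by
    have := (Real.isLittleO_log_id_atTop.bound (c := 0.01) (by norm_num))
    have := (tendsto_atTop_add_const_right atTop (2:ℝ) tendsto_id).eventually this
    filter_upwards [this, eventually_ge_atTop 1] with X hX h0
    simp only [id, Real.norm_eq_abs] at hX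
    rwa [abs_of_nonneg (Real.log_nonneg (by linarith)), abs_of_nonneg (by linarith)] at hX
  obtain ⟨X1, h1⟩ := eventually_atTop.1 h1
  refine ⟨max (2 * X1) 100, fun X hX => ?_⟩
  have hX1 : X1 ≤ X / 2 := by linarith [(le_max_left _ _).trans hX]
  have hX2 : 100 ≤ X := (le_max_right _ _).trans hX
  have h2 := h1 (X / 2) hX1
  have h3 := Chebyshev.psi_ge' (x := X / 2) (by linarith)
  have h4 : Chebyshev.psi (X / 2) * (1 / 2) ≤ Psi X := by
    rw [Chebyshev.psi, Psi, sum_mul]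
    refine (sum_le_sum fun n hn => ?_).trans (sum_le_sum_of_subset_of_nonneg (fun n hn => ?_) fun n _ _ =>
      mul_nonneg vonMangoldt_nonneg (wt_nonneg _))
    · have hn2 := (Nat.le_floor_iff' (by have := (mem_Ioc.1 hn).1; omega)).1 (mem_Ioc.1 hn).2
      refine mul_le_mul_of_nonneg_left ?_ vonMangoldt_nonneg
      refine (le_max_right _ _).trans' ?_
      have : (n:ℝ) / X ≤ 1 / 2 := by rw [div_le_iff₀ (by linarith)]; linarith
      linarith
    · rw [mem_Ioc] at hn; rw [mem_Icc]
      exact ⟨hn.1, hn.2.trans (Nat.floor_mono (by linarith))⟩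
  nlinarith [Real.log_two_gt_d9]
end

section
open Finset Filter Topology ArithmeticFunction

noncomputable def wp (N p : ℕ) : ℝ := 2 / 3 * (1 - 5 / 2 * (Real.log p / Real.log N))

def PP (N z y : ℕ) : Finset ℕ := {p ∈ Ico z y | p.Prime ∧ ¬ p ∣ N}

lemma richert {N n z y : ℕ} (hn : n.Prime) (hnN : ¬ n ∣ N) (hlt : n < N) (hS : Sf N (N - n) z 1 ≠ 0)
    (hsq : ∀ q, q.Prime → z ≤ q → ¬ q ^ 2 ∣ N - n) (hy : ∀ p, y ≤ p → wp N p ≤ 0)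
    (hW : 0 < 1 - ∑ p ∈ PP N z y with p ∣ N - n, wp N p) : (N - n).primeFactorsList.length ≤ 3 := by
  set m := N - n with hm
  have hm0 : m ≠ 0 := by omega
  have hN1 : (2:ℝ) ≤ N := by exact_mod_cast hn.two_le.trans hlt.le
  have lN : 0 < Real.log N := Real.log_pos (by linarith)
  have hcop : ∀ q, q.Prime → q ∣ m → ¬ q ∣ N := fun q hq h1 h2 => by
    have h3 : q ∣ n := by
      have : N - m = n := by omega
      rw [← this]; exact Nat.dvd_sub h2 h1
    rw [(Nat.prime_dvd_prime_iff_eq hq hn).1 h3] at h2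
    exact hnN h2
  have hS' : ∀ p < z, p.Prime → ¬ p ∣ N → ¬ p ∣ m := by
    unfold Sf at hS; by_contra h
    exact hS (if_neg fun h' => h h'.2)
  have hz : ∀ q, q.Prime → q ∣ m → z ≤ q := fun q hq h1 => by
    by_contra h; exact hS' q (not_le.1 h) hq (hcop q hq h1) h1
  have hsf : Squarefree m := by
    rw [Nat.squarefree_iff_prime_squarefree]
    intro q hq h; exact hsq q hq (hz q hq (dvd_of_mul_left_dvd h)) (by rwa [sq])
  have hk : m.primeFactorsList.length = m.primeFactors.card :=
    (List.toFinset_card_of_nodup ((Nat.squarefree_iff_nodup_primeFactorsList hm0).1 hsf)).symm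
  have h1 : ∑ p ∈ m.primeFactors, wp N p ≤ ∑ p ∈ PP N z y with p ∣ m, wp N p := by
    rw [← sum_filter_add_sum_filter_not _ (fun p => p < y)]
    have e : {p ∈ m.primeFactors | p < y} = {p ∈ PP N z y | p ∣ m} := by
      ext p
      simp only [PP, mem_filter, mem_Ico, Nat.mem_primeFactors]
      exact ⟨fun ⟨⟨a, b, _⟩, d⟩ => ⟨⟨⟨hz p a b, d⟩, a, hcop p a b⟩, b⟩, fun ⟨⟨⟨_, b⟩, c, _⟩, e⟩ => ⟨⟨c, e, hm0⟩, b⟩⟩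
    rw [e]
    have : ∑ p ∈ m.primeFactors with ¬ p < y, wp N p ≤ 0 :=
      sum_nonpos fun p hp => hy p (not_lt.1 (mem_filter.1 hp).2)
    linarith
  have h2 : ∑ p ∈ m.primeFactors, Real.log p = Real.log m := by
    rw [← Real.log_prod fun p hp => by exact_mod_cast (Nat.prime_of_mem_primeFactors hp).ne_zero]
    rw [← Nat.cast_prod, Nat.prod_primeFactors_of_squarefree hsf]
  have h3 : ∑ p ∈ m.primeFactors, wp N p = 2 / 3 * (m.primeFactors.card - 5 / 2 * (Real.log m / Real.log N)) := by
    simp only [wp]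
    rw [← mul_sum, sum_sub_distrib, ← mul_sum, ← sum_div, h2]; simp
  have h4 : Real.log m / Real.log N ≤ 1 := by
    rw [div_le_one lN]
    exact Real.log_le_log (by exact_mod_cast Nat.pos_of_ne_zero hm0) (by exact_mod_cast Nat.sub_le N n)
  have h5 : (m.primeFactors.card : ℝ) < 4 := by linarith
  have : m.primeFactors.card < 4 := by exact_mod_cast h5
  omega

noncomputable def good (N : ℕ) (X : ℝ) : Finset ℕ :=
  {n ∈ Icc 1 ⌊X⌋₊ | n.Prime ∧ n < N ∧ (N - n).primeFactorsList.length ≤ 3}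

noncomputable def SS (N z y : ℕ) (X : ℝ) : ℝ :=
  ∑ n ∈ Icc 1 ⌊X⌋₊, Λ n * wt (n / X) * (Sf N (N - n) z 1 * (1 - ∑ p ∈ PP N z y with p ∣ N - n, wp N p))

lemma cnt_sq {N q : ℕ} {X : ℝ} (hX : 0 ≤ X) (hXN : X ≤ N) (hq : 0 < q) :
    ((#{n ∈ Icc 1 ⌊X⌋₊ | q ^ 2 ∣ N - n} : ℕ) : ℝ) ≤ X * ((q:ℝ) ^ 2)⁻¹ + 1 := by
  have h1 : {n ∈ Icc 1 ⌊X⌋₊ | q ^ 2 ∣ N - n} ⊆ {n ∈ Ioc 0 ⌊X⌋₊ | n ≡ N [MOD q ^ 2]} := by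
    intro n hn
    simp only [mem_filter, mem_Icc, mem_Ioc] at hn ⊢
    have h3 : n ≤ N := hn.1.2.trans (Nat.floor_le_of_le hXN)
    exact ⟨hn.1, (Nat.modEq_iff_dvd' h3).2 hn.2⟩
  have h2 := Nat.Ioc_filter_modEq_card 0 ⌊X⌋₊ (r := q ^ 2) (by positivity) N
  have hr : (0:ℝ) < ((q ^ 2 : ℕ) : ℝ) := by positivity
  have h3 : ((#{n ∈ Ioc 0 ⌊X⌋₊ | n ≡ N [MOD q ^ 2]} : ℕ) : ℝ) ≤ X / ((q ^ 2 : ℕ) : ℝ) + 1 := by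
    have e : ((#{n ∈ Ioc 0 ⌊X⌋₊ | n ≡ N [MOD q ^ 2]} : ℕ) : ℚ) ≤ (⌊X⌋₊ : ℚ) / ((q ^ 2 : ℕ) : ℚ) + 1 := by
      rw [← Int.cast_natCast (R := ℚ) (#_), h2, Int.cast_max, max_le_iff]
      have a1 := Int.floor_le (((⌊X⌋₊ : ℚ) - N) / ((q ^ 2 : ℕ) : ℚ))
      have a2 := Int.lt_floor_add_one ((((0:ℕ) : ℚ) - N) / ((q ^ 2 : ℕ) : ℚ))
      rw [sub_div] at a1 a2
      rw [sub_div, sub_div]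
      refine ⟨?_, by positivity⟩
      push_cast at a1 a2 ⊢
      simp only [zero_div] at *
      linarith
    have e' : ((#{n ∈ Ioc 0 ⌊X⌋₊ | n ≡ N [MOD q ^ 2]} : ℕ) : ℝ) ≤ (⌊X⌋₊ : ℝ) / ((q ^ 2 : ℕ) : ℝ) + 1 := by
      have := (Rat.cast_le (K := ℝ)).2 e
      push_cast at this ⊢; exact this
    have := div_le_div_of_nonneg_right (Nat.floor_le hX) hr.le
    linarith
  calc _ ≤ ((#{n ∈ Ioc 0 ⌊X⌋₊ | n ≡ N [MOD q ^ 2]} : ℕ) : ℝ) := by exact_mod_cast card_le_card h1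
    _ ≤ _ := h3
    _ = _ := by push_cast; rw [div_eq_mul_inv]

open Classical in
lemma SS_upper {N z y : ℕ} {X : ℝ} (hX : 1 ≤ X) (hXN : X ≤ N) (hz : 2 ≤ z)
    (hy : ∀ p, y ≤ p → wp N p ≤ 0) (hy' : ∀ p < y, 0 ≤ wp N p) :
    SS N z y X ≤ Real.log N * #(good N X) +
      (2 * √X * Real.log X + Real.log N + Real.log N * (X * (2 / z) + √N)) := by
  have hL : ∀ n ∈ Icc 1 ⌊X⌋₊, Λ n ≤ Real.log N := fun n hn => by
    refine vonMangoldt_le_log.trans (Real.log_le_log (by exact_mod_cast (mem_Icc.1 hn).1) ?_)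
    exact_mod_cast (mem_Icc.1 hn).2.trans (Nat.floor_le_of_le hXN)
  have lN : 0 ≤ Real.log N := Real.log_nonneg (hX.trans hXN)
  have hpt : ∀ n ∈ Icc 1 ⌊X⌋₊, Λ n * wt (n / X) * (Sf N (N - n) z 1 * (1 - ∑ p ∈ PP N z y with p ∣ N - n, wp N p))
      ≤ (if n.Prime ∧ n < N ∧ (N - n).primeFactorsList.length ≤ 3 then Real.log N else 0) + (if ¬ n.Prime then Λ n else 0) +
        (if n.Prime ∧ n ∣ N then Λ n else 0) +
        if n < N ∧ ∃ q, q.Prime ∧ z ≤ q ∧ q ^ 2 ∣ N - n then Real.log N else 0 := fun n hn => by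
    have hΛ : 0 ≤ Λ n := vonMangoldt_nonneg
    have hw : Λ n * wt (n / X) ≤ Λ n := mul_le_of_le_one_right hΛ (wt_le (by positivity))
    have hw0 : 0 ≤ Λ n * wt (n / X) := mul_nonneg hΛ (wt_nonneg _)
    have hln := hL n hn
    have hs0 : 0 ≤ ∑ p ∈ PP N z y with p ∣ N - n, wp N p := sum_nonneg fun p hp => by
      simp only [PP, mem_filter, mem_Ico] at hp; exact hy' p hp.1.1.2
    have hS1 : Sf N (N - n) z 1 ≤ 1 := by unfold Sf; split_ifs <;> norm_num
    have hS0 := Sf_nonneg N (N - n) z 1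
    have i1 : (0:ℝ) ≤ (if n.Prime ∧ n < N ∧ (N - n).primeFactorsList.length ≤ 3 then Real.log N else 0) := by split_ifs <;> linarith
    have i2 : (0:ℝ) ≤ (if ¬ n.Prime then Λ n else 0) := by split_ifs <;> linarith
    have i3 : (0:ℝ) ≤ (if n.Prime ∧ n ∣ N then Λ n else 0) := by split_ifs <;> linarith
    have i4 : (0:ℝ) ≤ (if n < N ∧ ∃ q, q.Prime ∧ z ≤ q ∧ q ^ 2 ∣ N - n then Real.log N else 0) := by split_ifs <;> linarith
    by_cases h0 : Sf N (N - n) z 1 * (1 - ∑ p ∈ PP N z y with p ∣ N - n, wp N p) ≤ 0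
    · linarith [mul_nonpos_of_nonneg_of_nonpos hw0 h0]
    rw [not_le] at h0
    have hle : Sf N (N - n) z 1 * (1 - ∑ p ∈ PP N z y with p ∣ N - n, wp N p) ≤ 1 := by nlinarith
    have hle2 : Λ n * wt (n / X) * (Sf N (N - n) z 1 * (1 - ∑ p ∈ PP N z y with p ∣ N - n, wp N p)) ≤ Λ n :=
      (mul_le_of_le_one_right hw0 hle).trans hw
    by_cases c1 : n.Prime
    swap
    · rw [if_pos c1] at i2 ⊢; linarith
    by_cases c2 : n ∣ N
    · rw [if_pos (c := n.Prime ∧ n ∣ N) ⟨c1, c2⟩] at i3 ⊢; linarith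
    have hlt : n < N := lt_of_le_of_ne ((mem_Icc.1 hn).2.trans (Nat.floor_le_of_le hXN)) fun h => c2 (h ▸ dvd_refl _)
    by_cases c3 : ∃ q, q.Prime ∧ z ≤ q ∧ q ^ 2 ∣ N - n
    · rw [if_pos (c := n < N ∧ _) ⟨hlt, c3⟩] at i4 ⊢; linarith
    have := richert c1 c2 hlt (fun h => by rw [h, zero_mul] at h0; exact lt_irrefl _ h0)
      (fun q a b c => c3 ⟨q, a, b, c⟩) hy (pos_of_mul_pos_right h0 hS0)
    rw [if_pos (c := n.Prime ∧ n < N ∧ _) ⟨c1, hlt, this⟩] at i1 ⊢; linarith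
  refine (sum_le_sum hpt).trans ?_
  rw [sum_add_distrib, sum_add_distrib, sum_add_distrib]
  have b1 : ∑ n ∈ Icc 1 ⌊X⌋₊, (if n.Prime ∧ n < N ∧ (N - n).primeFactorsList.length ≤ 3 then Real.log N else 0) = Real.log N * #(good N X) := by
    rw [← sum_filter, sum_const, nsmul_eq_mul, mul_comm, good]
  have b2 : ∑ n ∈ Icc 1 ⌊X⌋₊, (if ¬ n.Prime then Λ n else 0) ≤ 2 * √X * Real.log X := by
    rw [← sum_filter]
    refine le_trans (le_of_eq ?_) (Chebyshev.psi_sub_theta_le hX)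
    rw [Chebyshev.psi_sub_theta_eq_sum_not_prime]; rfl
  have b3 : ∑ n ∈ Icc 1 ⌊X⌋₊, (if n.Prime ∧ n ∣ N then Λ n else 0) ≤ Real.log N := by
    rw [← sum_filter, ← vonMangoldt_sum]
    refine sum_le_sum_of_subset_of_nonneg (fun n hn => ?_) fun _ _ _ => vonMangoldt_nonneg
    have hN0 : N ≠ 0 := by rintro rfl; norm_num at hXN; linarith
    exact Nat.mem_divisors.2 ⟨(mem_filter.1 hn).2.2, hN0⟩
  have b4 : ∑ n ∈ Icc 1 ⌊X⌋₊, (if n < N ∧ ∃ q, q.Prime ∧ z ≤ q ∧ q ^ 2 ∣ N - n then Real.log N else 0) ≤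
      Real.log N * (X * (2 / z) + √N) := by
    rw [← sum_filter, sum_const, nsmul_eq_mul, mul_comm]
    refine mul_le_mul_of_nonneg_left ?_ lN
    have hsub : {n ∈ Icc 1 ⌊X⌋₊ | n < N ∧ ∃ q, q.Prime ∧ z ≤ q ∧ q ^ 2 ∣ N - n} ⊆
        (Ioo (z - 1) (N.sqrt + 1)).biUnion fun q => {n ∈ Icc 1 ⌊X⌋₊ | q ^ 2 ∣ N - n} := by
      intro n hn
      simp only [mem_filter, mem_biUnion, mem_Ioo] at hn ⊢
      obtain ⟨h1, h2, q, h3, h4, h5⟩ := hn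
      have : q ≤ N.sqrt := Nat.le_sqrt'.2 ((Nat.le_of_dvd (by omega) h5).trans (Nat.sub_le _ _))
      exact ⟨q, by omega, h1, h5⟩
    calc _ ≤ ((∑ q ∈ Ioo (z - 1) (N.sqrt + 1), #{n ∈ Icc 1 ⌊X⌋₊ | q ^ 2 ∣ N - n} : ℕ) : ℝ) := by
          exact_mod_cast (card_le_card hsub).trans card_biUnion_le
      _ ≤ ∑ q ∈ Ioo (z - 1) (N.sqrt + 1), (X * ((q:ℝ) ^ 2)⁻¹ + 1) := by
          push_cast
          exact sum_le_sum fun q hq => cnt_sq (by linarith) hXN (by have := (mem_Ioo.1 hq).1; omega)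
      _ ≤ _ := by
        rw [sum_add_distrib, ← mul_sum]
        refine add_le_add (mul_le_mul_of_nonneg_left ?_ (by linarith)) ?_
        · have := sum_Ioo_inv_sq_le (α := ℝ) (z - 1) (N.sqrt + 1)
          rw [Nat.cast_sub (by omega)] at this
          simpa using this
        · rw [sum_const, Nat.card_Ioo, nsmul_eq_mul, mul_one]
          refine le_trans ?_ Real.nat_sqrt_le_real_sqrt
          exact_mod_cast (by omega)
  linarith
end

section
open Finset Filter Topology ArithmeticFunction

lemma Es_cop {N z e : ℕ} {L : ℝ} (h : e ∈ Es N z L) : N.Coprime e :=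
  Nat.coprime_of_dvd fun q hq h1 h2 => (((mem_Es.1 h).2 q hq h2).2 h1)

lemma Rm_sum {N z y : ℕ} {X D : ℝ} (zp : ℕ → ℕ) (hzp : ∀ p ∈ PP N z y, zp p ≤ z)
    (hD : ∀ p ∈ PP N z y, p * ((zp p : ℝ) ^ (50 / 9 : ℝ)) ≤ D) :
    ∑ p ∈ PP N z y, ∑ e ∈ Es N (zp p) ((zp p : ℝ) ^ (50 / 9 : ℝ)), |Rm X N (p * e)| ≤
      ∑ d ∈ Icc 1 ⌊D⌋₊ with N.Coprime d, |Rm X N d| := by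
  have hP : ∀ p ∈ PP N z y, z ≤ p ∧ p.Prime ∧ ¬ p ∣ N := fun p hp => by
    simp only [PP, mem_filter, mem_Ico] at hp; tauto
  rw [sum_sigma']
  rw [← sum_image (g := fun x : (_ : ℕ) × ℕ => x.1 * x.2) (f := fun d => |Rm X N d|)]
  · refine sum_le_sum_of_subset_of_nonneg (fun d hd => ?_) fun _ _ _ => abs_nonneg _
    obtain ⟨⟨p, e⟩, h1, rfl⟩ := mem_image.1 hd
    obtain ⟨h1, h2⟩ := mem_sigma.1 h1
    simp only at h1 h2
    have h3 := mem_Es.1 h2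
    obtain ⟨_, pp, pN⟩ := hP p h1
    refine mem_filter.2 ⟨mem_Icc.2 ⟨Nat.mul_pos pp.pos h3.1.1, Nat.le_floor ?_⟩,
      Nat.Coprime.mul_right ((Nat.Prime.coprime_iff_not_dvd pp).2 pN).symm (Es_cop h2)⟩
    push_cast
    exact (mul_le_mul_of_nonneg_left h3.1.2 (Nat.cast_nonneg _)).trans (hD p h1)
  · rintro ⟨p, e⟩ h1 ⟨p', e'⟩ h1' heq
    simp only [coe_sigma, Set.mem_sigma_iff, mem_coe] at h1 h1' heq
    obtain ⟨a1, a2, a3⟩ := hP p h1.1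
    obtain ⟨b1, b2, b3⟩ := hP p' h1'.1
    have hpp : p = p' := by
      have : p ∣ p' * e' := heq ▸ dvd_mul_right p e
      rcases (Nat.Prime.dvd_mul a2).1 this with h | h
      · exact (Nat.prime_dvd_prime_iff_eq a2 b2).1 h
      · have := ((mem_Es.1 h1'.2).2 p a2 h).1
        have := hzp p' h1'.1
        omega
    subst hpp
    rw [Nat.eq_of_mul_eq_mul_left a2.pos heq]

lemma SS_lower : ∃ Z0 : ℕ, ∀ (N z y : ℕ) (X D : ℝ) (zp : ℕ → ℕ), 2 ∣ N → X ≤ N → 0 < X → Z0 ≤ z →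
    (∀ p ∈ PP N z y, Z0 ≤ zp p ∧ zp p ≤ z ∧ p * ((zp p : ℝ) ^ (50 / 9 : ℝ)) ≤ D ∧ 0 ≤ wp N p ∧ wp N p ≤ 1) →
    z * (z : ℝ) ^ (50 / 9 : ℝ) ≤ D →
    Psi X * (0.9937 * Vp (nu N) z - 1.043 * ∑ p ∈ PP N z y, wp N p * (nu N p * Vp (nu N) (zp p))) -
      2 * ∑ d ∈ Icc 1 ⌊D⌋₊ with N.Coprime d, |Rm X N d| ≤ SS N z y X := by
  obtain ⟨Z0, H⟩ := sieve_apply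
  refine ⟨Z0, fun N z y X D zp hN hXN hX hz hp hD => ?_⟩
  have hP : ∀ p ∈ PP N z y, z ≤ p ∧ p.Prime ∧ ¬ p ∣ N := fun p hp => by
    simp only [PP, mem_filter, mem_Ico] at hp; tauto
  have h1 := (H z hz N X hN hXN hX).2
  have hR1 : ∑ e ∈ Es N z (z * (z : ℝ) ^ (50 / 9 : ℝ)), |Rm X N e| ≤ ∑ d ∈ Icc 1 ⌊D⌋₊ with N.Coprime d, |Rm X N d| := by
    refine sum_le_sum_of_subset_of_nonneg (fun e he => ?_) fun _ _ _ => abs_nonneg _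
    have h3 := mem_Es.1 he
    exact mem_filter.2 ⟨mem_Icc.2 ⟨h3.1.1, Nat.le_floor (h3.1.2.trans hD)⟩, Es_cop he⟩
  have hR2 := Rm_sum (X := X) zp (fun p h => (hp p h).2.1) fun p h => (hp p h).2.2.1
  have h2 : ∀ p ∈ PP N z y, wp N p * ∑ n ∈ Icc 1 ⌊X⌋₊, Λ n * wt (n / X) * Sf N (N - n) z p ≤
      Psi X * 1.043 * (wp N p * (nu N p * Vp (nu N) (zp p))) +
        ∑ e ∈ Es N (zp p) ((zp p : ℝ) ^ (50 / 9 : ℝ)), |Rm X N (p * e)| := fun p hpp => by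
    obtain ⟨a1, a2, a3, a4, a5⟩ := hp p hpp
    obtain ⟨b1, b2, b3⟩ := hP p hpp
    have h3 := (H (zp p) a1 N X hN hXN hX).1 p b2.one_le fun q hq hqp =>
      (Nat.coprime_primes b2 hqp).2 (by omega)
    have h4 : ∑ n ∈ Icc 1 ⌊X⌋₊, Λ n * wt (n / X) * Sf N (N - n) z p ≤
        ∑ n ∈ Icc 1 ⌊X⌋₊, Λ n * wt (n / X) * Sf N (N - n) (zp p) p := by
      refine sum_le_sum fun n _ => mul_le_mul_of_nonneg_left ?_ (mul_nonneg vonMangoldt_nonneg (wt_nonneg _))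
      unfold Sf
      split_ifs with u v
      · rfl
      · exact absurd ⟨u.1, fun q hq => u.2 q (hq.trans_le a2)⟩ v
      · exact zero_le_one
      · rfl
    have h5 : (1:ℝ) / p.totient = nu N p := by
      rw [nu, if_pos ⟨b2, b3⟩, Nat.totient_prime b2, Nat.cast_sub b2.one_le, Nat.cast_one]
    rw [h5] at h3
    have h6 : 0 ≤ ∑ e ∈ Es N (zp p) ((zp p : ℝ) ^ (50 / 9 : ℝ)), |Rm X N (p * e)| := sum_nonneg fun _ _ => abs_nonneg _
    calc _ ≤ wp N p * (Psi X * (nu N p * (1.043 * Vp (nu N) (zp p))) + ∑ e ∈ Es N (zp p) ((zp p : ℝ) ^ (50 / 9 : ℝ)), |Rm X N (p * e)|) :=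
          mul_le_mul_of_nonneg_left (h4.trans h3) a4
      _ ≤ _ := by nlinarith [mul_le_of_le_one_left h6 a5]
  have h3 := sum_le_sum h2
  rw [sum_add_distrib, ← mul_sum] at h3
  have h4 : SS N z y X = ∑ n ∈ Icc 1 ⌊X⌋₊, Λ n * wt (n / X) * Sf N (N - n) z 1 -
      ∑ p ∈ PP N z y, wp N p * ∑ n ∈ Icc 1 ⌊X⌋₊, Λ n * wt (n / X) * Sf N (N - n) z p := by
    simp only [mul_sum]
    rw [sum_comm, ← sum_sub_distrib, SS]
    refine sum_congr rfl fun n _ => ?_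
    rw [mul_sub, mul_one, mul_sub]
    congr 1
    rw [sum_filter, mul_sum, mul_sum]
    refine sum_congr rfl fun p _ => ?_
    unfold Sf
    by_cases u : p ∣ N - n
    · simp only [u, if_true, one_dvd]; ring
    · simp [u]
  rw [h4]
  linarith
end

section
open Finset Filter Topology ArithmeticFunction

def hq (t : ℚ) : ℚ := (1 - 5 / 2 * t) * max 1 (25 / 81 / (4189 / 10000 - t))
noncomputable def hh (t : ℝ) : ℝ := (1 - 5 / 2 * t) * max 1 (25 / 81 / (4189 / 10000 - t))
noncomputable def tt (i : ℕ) : ℝ := 1 / 18 * (51 / 50) ^ i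

lemma hq_sum : ∑ i ∈ range 100, hq (1 / 18 * (51 / 50) ^ i) ≤ 71.2 := by decide +kernel

lemma hh_sum : ∑ i ∈ range 100, hh (tt i) ≤ 71.2 := by
  have := (Rat.cast_le (K := ℝ)).2 hq_sum
  unfold hq at this
  push_cast at this
  unfold hh tt
  convert this using 1

lemma hh_nonneg {t : ℝ} (h : t ≤ 0.4) : 0 ≤ hh t :=
  mul_nonneg (by linarith) (zero_le_one.trans (le_max_left _ _))

lemma hh_anti {s t : ℝ} (h : s ≤ t) (ht : t ≤ 0.4) : hh t ≤ hh s := by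
  unfold hh
  have h1 : 0 < 4189 / 10000 - t := by linarith
  have h2 : 0 < 4189 / 10000 - s := by linarith
  have h3 : 0 ≤ 1 - 5 / 2 * t := by linarith
  rw [mul_max_of_nonneg _ _ h3, mul_max_of_nonneg _ _ (by linarith)]
  refine max_le_max (by linarith) ?_
  rw [← mul_div_assoc _ _ (4189 / 10000 - t), ← mul_div_assoc _ _ (4189 / 10000 - s), div_le_div_iff₀ h1 h2]
  nlinarith

lemma ceil_log {u : ℝ} (hu : 1 ≤ u) : Real.log u ≤ Real.log ⌈u⌉₊ ∧ Real.log ⌈u⌉₊ ≤ Real.log u + 0.7 := by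
  have h1 := Nat.le_ceil u
  refine ⟨Real.log_le_log (by linarith) h1, ?_⟩
  have h2 := Nat.ceil_lt_add_one (show 0 ≤ u by linarith)
  calc _ ≤ Real.log (u * 2) := Real.log_le_log (by linarith) (by linarith)
    _ ≤ _ := by rw [Real.log_mul (by linarith) (by norm_num)]; linarith [Real.log_two_lt_d9]

lemma floor_log {u : ℝ} (hu : 1 ≤ u) : Real.log u - 0.7 ≤ Real.log ⌊u⌋₊ := by
  have h1 := Nat.lt_floor_add_one u
  have h3 : (1:ℝ) ≤ ⌊u⌋₊ := by exact_mod_cast Nat.le_floor (by simpa using hu)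
  have := Real.log_le_log (by linarith) (show u ≤ ⌊u⌋₊ * 2 by linarith)
  rw [Real.log_mul (by linarith) (by norm_num)] at this
  linarith [Real.log_two_lt_d9]

noncomputable def zN (N : ℕ) : ℕ := ⌈(N:ℝ) ^ (1 / 18 : ℝ)⌉₊
noncomputable def yN (N : ℕ) : ℕ := ⌈(N:ℝ) ^ (0.4 : ℝ)⌉₊
noncomputable def uN (N p : ℕ) : ℝ := ((N:ℝ) ^ (0.4189 : ℝ) / p) ^ (9 / 50 : ℝ)
noncomputable def zpN (N p : ℕ) : ℕ := min (zN N) ⌊uN N p⌋₊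
noncomputable def xN (N i : ℕ) : ℕ := ⌈(N:ℝ) ^ tt i⌉₊

lemma tt_pos (i : ℕ) : 0 < tt i := by unfold tt; positivity
lemma tt_ge (i : ℕ) : 1 / 18 ≤ tt i := by
  unfold tt; have := one_le_pow₀ (show (1:ℝ) ≤ 51 / 50 by norm_num) (n := i); linarith
lemma tt_succ (i : ℕ) : tt (i + 1) = 51 / 50 * tt i := by unfold tt; rw [pow_succ]; ring

lemma mem_PPN {N p : ℕ} (hN : 1 ≤ Real.log N) (hp : p < yN N) : wp N p ≥ 0 := by
  have h := Nat.lt_ceil.1 hp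
  rcases Nat.eq_zero_or_pos p with rfl | hp0
  · norm_num [wp]
  have : Real.log p < 0.4 * Real.log N := by
    have hN0 : (0:ℝ) < N := Nat.cast_pos.2 (Nat.pos_of_ne_zero (by rintro rfl; norm_num at hN))
    rw [← Real.log_rpow hN0]; exact Real.log_lt_log (by exact_mod_cast hp0) h
  have : Real.log p / Real.log N ≤ 0.4 := by rw [div_le_iff₀ (by linarith)]; exact this.le
  unfold wp; linarith

lemma wp_nonpos {N p : ℕ} (hN : 1 ≤ Real.log N) (hp : yN N ≤ p) : wp N p ≤ 0 := by
  have h := (Nat.le_ceil _).trans (Nat.cast_le (α := ℝ).2 hp)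
  have hN0 : (0:ℝ) < N := Nat.cast_pos.2 (Nat.pos_of_ne_zero (by rintro rfl; norm_num at hN))
  have := Real.log_le_log (by positivity) h
  rw [Real.log_rpow hN0] at this
  have : 0.4 ≤ Real.log p / Real.log N := by rw [le_div_iff₀ (by linarith)]; exact this
  unfold wp; linarith

lemma setup (Z0 : ℕ) : ∃ L0 : ℝ, 1 ≤ L0 ∧ ∀ N : ℕ, L0 ≤ Real.log N → 2 ∣ N →
    Z0 ≤ zN N ∧ (∀ p ∈ PP N (zN N) (yN N), Z0 ≤ zpN N p ∧ zpN N p ≤ zN N ∧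
      p * ((zpN N p : ℝ) ^ (50 / 9 : ℝ)) ≤ (N:ℝ) ^ (0.4189 : ℝ) ∧ 0 ≤ wp N p ∧ wp N p ≤ 1) ∧
    zN N * (zN N : ℝ) ^ (50 / 9 : ℝ) ≤ (N:ℝ) ^ (0.4189 : ℝ) ∧
    1.043 * ∑ p ∈ PP N (zN N) (yN N), wp N p * (nu N p * Vp (nu N) (zpN N p)) ≤ 0.9837 * Vp (nu N) (zN N) := by
  obtain ⟨A, hA, mert⟩ := mert4
  have l4 : 0 < Real.log 1.0003 := Real.log_pos (by norm_num)
  refine ⟨max (max 1000000 (A / (0.003 * Real.log 1.0003))) (max (1000000 * A) (1000 * Real.log (Z0 + 3))),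
    le_max_of_le_left (le_max_of_le_left (by norm_num)), fun N hL hN => ?_⟩
  simp only [max_le_iff] at hL
  obtain ⟨⟨hL1, hL2⟩, hL3, hL4⟩ := hL
  set L := Real.log N with hLdef
  have hN0 : (0:ℝ) < N := Nat.cast_pos.2 (Nat.pos_of_ne_zero (by rintro rfl; norm_num [hLdef] at hL1))
  have hN1 : (1:ℝ) ≤ N := by
    have : 0 < N := by exact_mod_cast hN0
    exact_mod_cast this
  have lp : ∀ a : ℝ, Real.log ((N:ℝ) ^ a) = a * L := fun a => Real.log_rpow hN0 a
  have cl : ∀ a : ℝ, 0 ≤ a → a * L ≤ Real.log ⌈(N:ℝ) ^ a⌉₊ ∧ Real.log ⌈(N:ℝ) ^ a⌉₊ ≤ a * L + 0.7 := fun a ha => by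
    rw [← lp]; exact ceil_log (Real.one_le_rpow hN1 ha)
  have hz := cl (1 / 18) (by norm_num)
  change _ ≤ Real.log (zN N) ∧ Real.log (zN N) ≤ _ at hz
  have big : ∀ k : ℕ, 0.003 * L ≤ Real.log k → 0 < k → Z0 + 3 ≤ k := fun k hk h0 => by
    have : Real.log (Z0 + 3) ≤ Real.log k := by linarith
    have := (Real.log_le_log_iff (by positivity) (by exact_mod_cast h0)).1 this
    exact_mod_cast this
  have hz0 : 0 < zN N := Nat.ceil_pos.2 (by positivity)
  have hzZ := big (zN N) (by linarith) hz0
  have hpp : ∀ p ∈ PP N (zN N) (yN N), zN N ≤ p ∧ p < yN N ∧ p.Prime ∧ ¬ p ∣ N := fun p hp => by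
    simp only [PP, mem_filter, mem_Ico] at hp; tauto
  -- per-prime facts
  have key : ∀ p ∈ PP N (zN N) (yN N), 1 / 18 ≤ Real.log p / L ∧ Real.log p / L ≤ 0.4 ∧ 1 ≤ uN N p ∧
      Z0 + 3 ≤ zpN N p ∧ 0.003 * L ≤ Real.log (zpN N p) ∧
      Real.log (zN N) ≤ 1.0003 * max 1 (25 / 81 / (4189 / 10000 - Real.log p / L)) * Real.log (zpN N p) := fun p hp => by
    obtain ⟨p1, p2, p3, p4⟩ := hpp p hp
    have hp0 : (0:ℝ) < p := by exact_mod_cast p3.pos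
    have q1 : 1 / 18 * L ≤ Real.log p := hz.1.trans (Real.log_le_log (by exact_mod_cast hz0) (by exact_mod_cast p1))
    have q2 : Real.log p ≤ 0.4 * L := by rw [← lp]; exact Real.log_le_log hp0 (Nat.lt_ceil.1 p2).le
    set τ := Real.log p / L with hτ
    have hτL : Real.log p = τ * L := by rw [hτ]; field_simp
    have t1 : 1 / 18 ≤ τ := by rw [hτ, le_div_iff₀ (by linarith)]; exact q1
    have t2 : τ ≤ 0.4 := by rw [hτ, div_le_iff₀ (by linarith)]; exact q2
    have u1 : Real.log (uN N p) = 9 / 50 * ((4189 / 10000 - τ) * L) := by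
      rw [uN, Real.log_rpow (by positivity), Real.log_div (by positivity) hp0.ne', lp, hτL]; ring
    have ha : 0.0189 ≤ 4189 / 10000 - τ := by linarith
    have u0 : 0 < uN N p := by unfold uN; positivity
    have u2 : 0.0189 * L ≤ (4189 / 10000 - τ) * L := mul_le_mul_of_nonneg_right ha (by linarith)
    have u3 : 1 ≤ uN N p := by
      rw [← Real.log_nonneg_iff u0, u1]; linarith
    have u4 := floor_log u3
    have z1 : 0.003 * L ≤ Real.log (zpN N p) := by
      unfold zpN
      rcases min_choice (zN N) ⌊uN N p⌋₊ with h | h <;> rw [h] <;> linarith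
    refine ⟨t1, t2, u3, big _ z1 (lt_min hz0 (Nat.floor_pos.2 u3)), z1, ?_⟩
    have z2 : 0 ≤ Real.log (zpN N p) := by linarith
    unfold zpN at z1 z2 ⊢
    rcases min_choice (zN N) ⌊uN N p⌋₊ with h | h
    · rw [h] at z2 ⊢
      refine le_mul_of_one_le_left z2 ?_
      have := le_max_left 1 (25 / 81 / (4189 / 10000 - τ)); linarith
    · rw [h] at z1 z2 ⊢
      have v1 : 25 / 81 / (4189 / 10000 - τ) * (9 / 50 * ((4189 / 10000 - τ) * L) - 0.7) ≤ max 1 (25 / 81 / (4189 / 10000 - τ)) * Real.log ⌊uN N p⌋₊ :=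
        (mul_le_mul_of_nonneg_left (by rw [← u1]; exact u4) (by positivity)).trans
          (mul_le_mul_of_nonneg_right (le_max_right _ _) z2)
      have v2 : 25 / 81 / (4189 / 10000 - τ) * (9 / 50 * ((4189 / 10000 - τ) * L) - 0.7) =
          L / 18 - 25 / 81 * 0.7 / (4189 / 10000 - τ) := by
        have : 4189 / 10000 - τ ≠ 0 := by linarith
        generalize 4189 / 10000 - τ = b at this ⊢
        field_simp; ring
      have v3 : 25 / 81 * 0.7 / (4189 / 10000 - τ) ≤ 12 := by
        rw [div_le_iff₀ (by linarith)]; linarith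
      rw [mul_assoc]
      linarith
  refine ⟨by omega, fun p hp => ?_, ?_, ?_⟩
  · obtain ⟨k1, k2, k3, k4, k5, k6⟩ := key p hp
    obtain ⟨p1, p2, p3, p4⟩ := hpp p hp
    have hp0 : (0:ℝ) < p := by exact_mod_cast p3.pos
    refine ⟨by omega, min_le_left _ _, ?_, mem_PPN (by linarith) p2, by unfold wp; linarith⟩
    have : (zpN N p : ℝ) ≤ uN N p := (Nat.cast_le.2 (min_le_right _ _)).trans (Nat.floor_le (by linarith))
    have h2 : (zpN N p : ℝ) ^ (50 / 9 : ℝ) ≤ (N:ℝ) ^ (0.4189 : ℝ) / p := by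
      refine (Real.rpow_le_rpow (Nat.cast_nonneg _) this (by norm_num)).trans (le_of_eq ?_)
      rw [uN, ← Real.rpow_mul (by positivity)]; norm_num
    rwa [le_div_iff₀' hp0] at h2
  · have hz0' : (0:ℝ) < zN N := by exact_mod_cast hz0
    rw [← Real.log_le_log_iff (by positivity) (by positivity), lp, Real.log_mul (by positivity) (by positivity), Real.log_rpow hz0']
    linarith
  · have V0 := Vp_nonneg hN (zN N)
    have step : ∀ p ∈ PP N (zN N) (yN N), wp N p * (nu N p * Vp (nu N) (zpN N p)) ≤
        2 / 3 * 1.0003 ^ 2 * Vp (nu N) (zN N) * (hh (Real.log p / L) * nu N p) := fun p hp => by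
      obtain ⟨k1, k2, k3, k4, k5, k6⟩ := key p hp
      obtain ⟨p1, p2, p3, p4⟩ := hpp p hp
      have m1 := (mert N (zpN N p) (zN N) hN (by omega) (min_le_left _ _)).2
      set K := max 1 (25 / 81 / (4189 / 10000 - Real.log p / L)) with hK
      have lz : 0 < Real.log (zpN N p) := by linarith
      have e1 : Real.exp (A / Real.log (zpN N p)) ≤ 1.0003 := by
        rw [← Real.le_log_iff_exp_le (by norm_num), div_le_iff₀ lz]
        rw [div_le_iff₀ (by positivity)] at hL2
        nlinarith
      have e2 : Real.log (zN N) / Real.log (zpN N p) ≤ 1.0003 * K := by rwa [div_le_iff₀ lz]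
      have e3 : Vp (nu N) (zpN N p) ≤ Vp (nu N) (zN N) * (1.0003 * K * 1.0003) := by
        refine m1.trans (mul_le_mul_of_nonneg_left ?_ V0.le)
        have : 0 ≤ Real.log (zN N) / Real.log (zpN N p) := by apply div_nonneg <;> linarith
        exact mul_le_mul e2 e1 (Real.exp_pos _).le (this.trans e2)
      calc _ ≤ wp N p * (nu N p * (Vp (nu N) (zN N) * (1.0003 * K * 1.0003))) :=
            mul_le_mul_of_nonneg_left (mul_le_mul_of_nonneg_left e3 (nu_nonneg _ _)) (mem_PPN (by linarith) p2)
        _ = _ := by rw [wp, hh, ← hK]; ring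
    have x0 : xN N 0 = zN N := by simp [xN, zN, tt]
    have xm : Monotone (xN N) := monotone_nat_of_le_succ fun i => Nat.ceil_mono
      (Real.rpow_le_rpow_of_exponent_le hN1 (by rw [tt_succ]; linarith [tt_pos i]))
    have t100 : 0.4 ≤ tt 100 := by unfold tt; norm_num
    have t99 : ∀ i < 100, tt i ≤ 0.4 := fun i hi => by
      have : ((51:ℝ) / 50) ^ i ≤ (51 / 50) ^ 99 := pow_le_pow_right₀ (by norm_num) (by omega)
      unfold tt; norm_num at this ⊢; linarith
    set f : ℕ → ℝ := fun p => if p < yN N then hh (Real.log p / L) * nu N p else 0 with hf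
    have cells : ∀ k, ∑ p ∈ Ico (xN N 0) (xN N k), f p = ∑ i ∈ range k, ∑ p ∈ Ico (xN N i) (xN N (i + 1)), f p := by
      intro k
      induction k with
      | zero => simp
      | succ k ih => rw [sum_range_succ, ← ih, sum_Ico_consecutive _ (xm (Nat.zero_le k)) (xm (Nat.le_succ k))]
    have fle : ∀ i < 100, ∀ p ∈ Ico (xN N i) (xN N (i + 1)), f p ≤ hh (tt i) * nu N p ∧ 0 ≤ f p := fun i hi p hp => by
      have h0 := mul_nonneg (hh_nonneg (t99 i hi)) (nu_nonneg N p)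
      simp only [hf]
      split_ifs with hy
      · have hp1 : (N:ℝ) ^ tt i ≤ p := (Nat.le_ceil _).trans (Nat.cast_le.2 (mem_Ico.1 hp).1)
        have hp0 : (0:ℝ) < p := lt_of_lt_of_le (by positivity) hp1
        have q1 := Real.log_le_log (by positivity) hp1
        have q2 := Real.log_le_log hp0 (Nat.lt_ceil.1 hy).le
        rw [lp] at q1 q2
        have q3 : Real.log p / L ≤ 0.4 := by rw [div_le_iff₀ (by linarith)]; exact q2
        exact ⟨mul_le_mul_of_nonneg_right (hh_anti (by rw [le_div_iff₀ (by linarith)]; exact q1) q3) (nu_nonneg _ _),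
          mul_nonneg (hh_nonneg q3) (nu_nonneg _ _)⟩
      · exact ⟨h0, le_rfl⟩
    have nus : ∀ i, ∑ p ∈ Ico (xN N i) (xN N (i + 1)), nu N p ≤ 0.01985 := fun i => by
      have g0 := tt_ge i
      have g1 := (cl (tt i) (by linarith)).1
      have g2 := (cl (tt (i + 1)) (by linarith [tt_ge (i + 1)])).2
      rw [tt_succ] at g2
      have gL : 1 / 18 * L ≤ tt i * L := mul_le_mul_of_nonneg_right g0 (by linarith)
      change _ ≤ Real.log (xN N i) at g1
      rw [← tt_succ] at g2
      change Real.log (xN N (i + 1)) ≤ _ at g2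
      rw [tt_succ] at g2
      have g3 : 3 ≤ xN N i := by
        have := xm (Nat.zero_le i); rw [x0] at this; omega
      have m1 := (mert N (xN N i) (xN N (i + 1)) hN g3 (xm (Nat.le_succ i))).1
      have g4 : 0 < Real.log (xN N i) := by linarith
      have g6 : Real.log (xN N i) ≤ Real.log (xN N (i + 1)) :=
        Real.log_le_log (by exact_mod_cast (by omega)) (by exact_mod_cast xm (Nat.le_succ i))
      have g5 : Real.log (Real.log (xN N (i + 1)) / Real.log (xN N i)) ≤ 0.019825 := by
        rw [Real.log_le_iff_le_exp (by apply div_pos <;> linarith)]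
        have := Real.quadratic_le_exp_of_nonneg (show (0:ℝ) ≤ 0.019825 by norm_num)
        refine le_trans ?_ this
        rw [div_le_iff₀ g4]; norm_num; nlinarith
      have g7 : A / Real.log (xN N i) ≤ 0.000025 := by
        rw [div_le_iff₀ g4]; linarith
      linarith
    have tot : ∑ p ∈ PP N (zN N) (yN N), hh (Real.log p / L) * nu N p ≤ 71.2 * 0.01985 := by
      calc _ = ∑ p ∈ PP N (zN N) (yN N), f p := sum_congr rfl fun p hp => by
            simp only [hf]; rw [if_pos (hpp p hp).2.1]
        _ ≤ ∑ p ∈ Ico (xN N 0) (xN N 100), f p := by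
            refine sum_le_sum_of_subset_of_nonneg (fun p hp => ?_) fun p hp _ => ?_
            · obtain ⟨p1, p2, _⟩ := hpp p hp
              rw [mem_Ico, x0]
              exact ⟨p1, p2.trans_le (Nat.ceil_mono (Real.rpow_le_rpow_of_exponent_le hN1 t100))⟩
            · simp only [hf]
              split_ifs with hy
              · have hp0 : (0:ℝ) < p := by
                  have := (mem_Ico.1 hp).1; rw [x0] at this
                  exact_mod_cast hz0.trans_le this
                have q2 := Real.log_le_log hp0 (Nat.lt_ceil.1 hy).le
                rw [lp] at q2
                exact mul_nonneg (hh_nonneg (by rw [div_le_iff₀ (by linarith)]; exact q2)) (nu_nonneg _ _)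
              · rfl
        _ ≤ ∑ i ∈ range 100, hh (tt i) * 0.01985 := by
            rw [cells]
            refine sum_le_sum fun i hi => ?_
            refine (sum_le_sum fun p hp => (fle i (mem_range.1 hi) p hp).1).trans ?_
            rw [← mul_sum]
            exact mul_le_mul_of_nonneg_left (nus i) (hh_nonneg (t99 i (mem_range.1 hi)))
        _ ≤ _ := by rw [← sum_mul]; exact mul_le_mul_of_nonneg_right hh_sum (by norm_num)
    have := sum_le_sum step
    rw [← mul_sum] at this
    have h3 := mul_le_mul_of_nonneg_left tot (show 0 ≤ 2 / 3 * 1.0003 ^ 2 * Vp (nu N) (zN N) by positivity)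
    nlinarith
end

section
open Finset Filter Topology ArithmeticFunction

lemma ev_pow (k : ℕ) {b c : ℝ} (hb : 0 < b) (hc : 0 < c) : ∀ᶠ L : ℝ in atTop, L ^ k ≤ c * Real.exp (b * L) := by
  filter_upwards [(isLittleO_pow_exp_pos_mul_atTop (k := k) hb).bound hc] with L h
  rw [Real.norm_eq_abs, Real.norm_eq_abs, abs_of_pos (Real.exp_pos _)] at h
  exact (le_abs_self _).trans h

lemma rem_bd {C X κ L l : ℝ} (hκ : 0 < κ) (X0 : 0 < X) (hL : 1 ≤ L) (e : 16 * C / κ ≤ L)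
    (h : 0.838 * L ≤ l) : C * X / l ^ 3 ≤ κ / 8 * X / L := by
  have a1 : (0.838 * L) ^ 3 ≤ l ^ 3 := pow_le_pow_left₀ (by positivity) h 3
  have p3 : 0 < L ^ 3 := by positivity
  rw [mul_pow] at a1
  have a3 : L ^ 3 / 2 ≤ l ^ 3 := by norm_num at a1 ⊢; linarith
  rw [div_le_iff₀ hκ] at e
  rw [div_le_div_iff₀ (by linarith) (by linarith)]
  have a4 : 16 * C * L ≤ L * κ * L ^ 2 := mul_le_mul e (by nlinarith) (by linarith) (by positivity)
  have a5 : C * L ≤ κ / 8 * (L ^ 3 / 2) := by linarith [show L * κ * L ^ 2 = κ * L ^ 3 by ring]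
  calc _ = C * L * X := by ring
    _ ≤ κ / 8 * l ^ 3 * X := mul_le_mul_of_nonneg_right (a5.trans (by gcongr)) X0.le
    _ = _ := by ring

set_option maxHeartbeats 1000000

theorem chen_P3_small_primes :
    ∃ c : ℝ, 0 < c ∧ ∃ N₀ : ℕ, ∀ N : ℕ, N₀ ≤ N → Even N →
      ∀ θ : ℝ, 0.838 ≤ θ → θ ≤ 1 →
        c * CN N * (N : ℝ) ^ θ / (Real.log N) ^ 2 ≤
          ({p : ℕ | p.Prime ∧ (p : ℝ) ≤ (N : ℝ) ^ θ ∧ 1 ≤ N - p ∧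
              (N - p).primeFactorsList.length ≤ 3}.ncard : ℝ) := by
  obtain ⟨Z0, HL⟩ := SS_lower
  obtain ⟨L0, hL0, HS⟩ := setup Z0
  obtain ⟨C, X1, hC, HB⟩ := BV 3
  obtain ⟨v, hv, HV⟩ := Vp_lower
  obtain ⟨X2, HP⟩ := Psi_lower
  set κ := 0.001 * v with hκ
  have hκ0 : 0 < κ := by positivity
  have ev : ∀ᶠ L : ℝ in atTop, L0 ≤ L ∧ 100 ≤ L ∧ L ^ 24 ≤ 1 * Real.exp (0.0001 * L) ∧
      L ^ 2 ≤ κ / 24 * Real.exp (1 / 18 * L) ∧ 16 * C / κ ≤ L ∧ max X1 X2 ≤ L :=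
    (eventually_ge_atTop _).and <| (eventually_ge_atTop _).and <| (ev_pow 24 (by norm_num) one_pos).and <|
      (ev_pow 2 (by norm_num) (by positivity)).and <| (eventually_ge_atTop _).and (eventually_ge_atTop _)
  obtain ⟨N₀, hN₀⟩ := eventually_atTop.1 ((Real.tendsto_log_atTop.comp tendsto_natCast_atTop_atTop).eventually ev)
  refine ⟨κ / 2, by positivity, N₀, fun N hN hev θ h1 h2 => ?_⟩
  obtain ⟨e1, e2, e3, e4, e5, e6⟩ := hN₀ N hN
  simp only [Function.comp] at e1 e2 e3 e4 e5 e6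
  set L := Real.log N with hL
  have hN2 := hev.two_dvd
  have hN0 : N ≠ 0 := by rintro rfl; norm_num [hL] at e2
  have hNp : (0:ℝ) < N := by positivity
  have hN1 : (1:ℝ) ≤ N := by exact_mod_cast Nat.pos_of_ne_zero hN0
  have er : ∀ a : ℝ, Real.exp (a * L) = (N:ℝ) ^ a := fun a => by rw [Real.rpow_def_of_pos hNp, mul_comm]
  rw [er] at e3 e4
  have mono : ∀ a b : ℝ, a ≤ b → (N:ℝ) ^ a ≤ (N:ℝ) ^ b := fun a b h => Real.rpow_le_rpow_of_exponent_le hN1 h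
  set X := (N:ℝ) ^ θ with hX
  have X0 : 0 < X := by positivity
  have lX : Real.log X = θ * L := Real.log_rpow hNp θ
  have lX1 : 0.838 * L ≤ Real.log X := by rw [lX]; exact mul_le_mul_of_nonneg_right h1 (by linarith)
  have lX2 : Real.log X ≤ L := by rw [lX]; exact mul_le_of_le_one_left (by linarith) h2
  have XN : X ≤ N := by simpa using mono θ 1 h2
  have LX : L ≤ X := by
    have : 0.838 * L + 1 ≤ X := by
      have := Real.add_one_le_exp (Real.log X); rw [Real.exp_log X0] at this; linarith
    have h3 : L + 1 ≤ N := by have := Real.add_one_le_exp L; rwa [hL, Real.exp_log hNp] at this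
    have h4 : L ^ 1 ≤ L ^ 24 := pow_le_pow_right₀ (by linarith) (by norm_num)
    linarith [mono 0.0001 θ (by linarith)]
  have hX1 : X1 ≤ X := by linarith [le_max_left X1 X2]
  have hX2 : X2 ≤ X := by linarith [le_max_right X1 X2]
  obtain ⟨s1, s2, s3, s4⟩ := HS N e1 hN2
  have hlow := HL N (zN N) (yN N) X _ (zpN N) hN2 XN X0 s1 s2 s3
  have hup := SS_upper (N := N) (z := zN N) (y := yN N) (X := X) (by linarith) XN
  have hz : (N:ℝ) ^ (1 / 18 : ℝ) ≤ zN N := Nat.le_ceil _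
  have hLz : L ^ 1 ≤ L ^ 24 := pow_le_pow_right₀ (by linarith) (by norm_num)
  have z38 : 38 ≤ zN N := by
    have : (38:ℝ) ≤ zN N := by linarith [mono 0.0001 (1/18) (by norm_num)]
    exact_mod_cast this
  have hup := hup (by omega) (fun p hp => wp_nonpos (by linarith) hp) (fun p hp => mem_PPN (by linarith) hp)
  have z18 : N ≤ zN N ^ 18 := by
    have : (N:ℝ) ≤ (zN N : ℝ) ^ 18 := by
      calc (N:ℝ) = ((N:ℝ) ^ (1 / 18 : ℝ)) ^ 18 := by rw [← Real.rpow_natCast, ← Real.rpow_mul hNp.le]; norm_num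
        _ ≤ _ := pow_le_pow_left₀ (by positivity) hz 18
    exact_mod_cast this
  have hV := HV N (zN N) hN2 hN0 z38 z18
  have hPsi := HP X hX2
  have G1 := GG_ge N
  -- the remainder
  have hB : ∑ d ∈ Icc 1 ⌊(N:ℝ) ^ (0.4189:ℝ)⌋₊ with N.Coprime d, |Rm X N d| ≤ C * X / Real.log X ^ 3 := by
    refine HB X hX1 N _ ?_
    calc _ ≤ (N:ℝ) ^ (0.4189:ℝ) * (N:ℝ) ^ (0.0001 : ℝ) := by
          refine mul_le_mul (Nat.floor_le (by positivity)) ?_ (pow_nonneg (by linarith) _) (by positivity)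
          exact (pow_le_pow_left₀ (by linarith) lX2 _).trans (by linarith)
      _ = (N:ℝ) ^ (0.419:ℝ) := by rw [← Real.rpow_add hNp]; norm_num
      _ ≤ √X := by
        rw [Real.sqrt_eq_rpow, hX, ← Real.rpow_mul hNp.le]
        exact mono _ _ (by linarith)
  have hB2 := rem_bd hκ0 X0 (by linarith) e5 lX1
  -- the bad terms
  have hbad : 2 * √X * Real.log X + L + L * (X * (2 / zN N) + √N) ≤ κ / 4 * X / L := by
    set M := (N:ℝ) ^ (-(1 / 18) : ℝ) with hM
    have M0 : 0 < M := by positivity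
    have b1 : √X ≤ X * M := by
      rw [Real.sqrt_eq_rpow, hX, ← Real.rpow_mul hNp.le, hM, ← Real.rpow_add hNp]
      exact mono _ _ (by linarith)
    have b2 : √N ≤ X * M := by
      rw [Real.sqrt_eq_rpow, hX, hM, ← Real.rpow_add hNp]
      exact mono _ _ (by linarith)
    have b3 : 1 ≤ X * M := by
      rw [hX, hM, ← Real.rpow_add hNp]
      exact Real.one_le_rpow hN1 (by linarith)
    have b4 : X * (2 / zN N) ≤ 2 * (X * M) := by
      have : (1:ℝ) / zN N ≤ M := by
        rw [hM, Real.rpow_neg hNp.le, ← one_div]; exact one_div_le_one_div_of_le (by positivity) hz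
      calc _ = 2 * (X * (1 / zN N)) := by ring
        _ ≤ _ := by gcongr
    have b5 : L ^ 2 * M ≤ κ / 24 := by
      have : (N:ℝ) ^ (1 / 18 : ℝ) * M = 1 := by rw [hM, ← Real.rpow_add hNp]; norm_num
      calc _ ≤ κ / 24 * (N:ℝ) ^ (1 / 18 : ℝ) * M := mul_le_mul_of_nonneg_right e4 M0.le
        _ = _ := by rw [mul_assoc, this, mul_one]
    have b6 : 2 * √X * Real.log X + L + L * (X * (2 / zN N) + √N) ≤ 6 * (X * M) * L := by
      have c1 : √X * Real.log X ≤ X * M * L := mul_le_mul b1 lX2 (by linarith) (by positivity)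
      have c2 : L * (X * (2 / zN N) + √N) ≤ L * (3 * (X * M)) := mul_le_mul_of_nonneg_left (by linarith) (by linarith)
      have c3 : L ≤ X * M * L := le_mul_of_one_le_left (by linarith) b3
      linarith
    rw [le_div_iff₀ (by linarith)]
    calc _ ≤ 6 * (X * M) * L * L := mul_le_mul_of_nonneg_right b6 (by linarith)
      _ = 6 * X * (L ^ 2 * M) := by ring
      _ ≤ 6 * X * (κ / 24) := by gcongr
      _ = _ := by ring
  -- the main term
  have lz : Real.log (zN N) ≤ L := by
    refine Real.log_le_log (by exact_mod_cast (by omega)) ?_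
    exact_mod_cast Nat.ceil_le.2 (by simpa using mono (1 / 18) 1 (by norm_num))
  have lz0 : 0 < Real.log (zN N) := Real.log_pos (by exact_mod_cast (by omega))
  have hmain : κ * GG N * X / L ≤ Psi X * (0.9937 * Vp (nu N) (zN N) - 1.043 * ∑ p ∈ PP N (zN N) (yN N), wp N p * (nu N p * Vp (nu N) (zpN N p))) := by
    have d1 : v * GG N / L ≤ Vp (nu N) (zN N) :=
      (div_le_div_of_nonneg_left (by positivity) lz0 lz).trans hV
    have d2 : 0 ≤ v * GG N / L := by positivity
    calc κ * GG N * X / L = X / 10 * (0.01 * (v * GG N / L)) := by rw [hκ]; ring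
      _ ≤ _ := mul_le_mul hPsi (by linarith) (by positivity) (by linarith)
  have hgood : (#(good N X) : ℝ) ≤ ({p : ℕ | p.Prime ∧ (p : ℝ) ≤ X ∧ 1 ≤ N - p ∧
      (N - p).primeFactorsList.length ≤ 3}.ncard : ℝ) := by
    rw [← Set.ncard_coe_finset]
    refine Nat.cast_le.2 (Set.ncard_le_ncard (fun p hp => ?_) ?_)
    · simp only [good, coe_filter, mem_Icc, Set.mem_ofPred_eq] at hp ⊢
      exact ⟨hp.2.1, (Nat.le_floor_iff X0.le).1 hp.1.2, by omega, hp.2.2.2⟩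
    · refine (Set.finite_le_nat ⌊X⌋₊).subset fun p hp => ?_
      exact Nat.le_floor hp.2.1
  refine le_trans ?_ hgood
  have hE : κ / 4 * X / L ≤ κ / 4 * GG N * X / L := by
    have : κ / 4 * X ≤ κ / 4 * GG N * X := mul_le_mul_of_nonneg_right (le_mul_of_one_le_right (by positivity) G1) X0.le
    exact div_le_div_of_nonneg_right this (by linarith)
  have hfin : κ / 2 * GG N * X / L ≤ L * #(good N X) := by
    have r1 : κ * GG N * X / L = 2 * (κ / 2 * GG N * X / L) := by ring
    have r2 : κ / 4 * GG N * X / L = (κ / 2 * GG N * X / L) / 2 := by ring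
    have r3 : κ / 8 * X / L = (κ / 4 * X / L) / 2 := by ring
    linarith
  calc _ ≤ κ / 2 * GG N * X / L ^ 2 := by
        have := CN_le N
        gcongr
    _ = κ / 2 * GG N * X / L / L := by rw [div_div, sq]
    _ ≤ _ := by rw [div_le_iff₀ (by linarith)]; linarith
end
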